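/- Let $1 \leq m \leq 9n/10$ and let $A \subseteq S^{n-1}$ be measurable with $\sigma(A) \geq C\exp(-cn^{1/3})$. If $H$ is a uniformly random $(n-m)$-dimensional subspace of $\mathbb{R}^n$, then $\left|\frac{\sigma_H(A\cap H)}{\sigma(A)} - 1\right| < 0.1$ except with probability at most $C\exp(-cn^{1/3})$, for universal constants $c, C > 0$. -/

import Mathlib

open MeasureTheory Metric

/-- The uniform (rotation-invariant) probability measure on the unit sphere
`S^{n-1} ⊂ ℝⁿ`. -/
noncomputable def uSphere (n : ℕ) : Measure (sphere (0 : EuclideanSpace ℝ (Fin n)) 1) :=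
  ((volume : Measure (EuclideanSpace ℝ (Fin n))).toSphere Set.univ)⁻¹ •
    (volume : Measure (EuclideanSpace ℝ (Fin n))).toSphere

/-- The map between unit spheres induced by a linear isometry. -/
noncomputable def sphereMap {m n : ℕ}
    (e : EuclideanSpace ℝ (Fin m) →ₗᵢ[ℝ] EuclideanSpace ℝ (Fin n))
    (ω : sphere (0 : EuclideanSpace ℝ (Fin m)) 1) :
    sphere (0 : EuclideanSpace ℝ (Fin n)) 1 :=
  ⟨e ω, by
    have hω : ‖(ω : EuclideanSpace ℝ (Fin m))‖ = 1 := mem_sphere_zero_iff_norm.mp ω.2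
    simp [mem_sphere_zero_iff_norm, e.norm_map, hω]⟩

/-- The average of `f : S^{n-1} → ℝ` over the equator parametrized by the linear
isometry `e : ℝ^{n-1} → ℝⁿ` (whose range is the hyperplane orthogonal to a point). -/
noncomputable def equatorAvg {n : ℕ} (f : sphere (0 : EuclideanSpace ℝ (Fin n)) 1 → ℝ)
    (e : EuclideanSpace ℝ (Fin (n - 1)) →ₗᵢ[ℝ] EuclideanSpace ℝ (Fin n)) : ℝ :=
  ∫ ω, f (sphereMap e ω) ∂uSphere (n - 1)

/-- The Grassmannian of `d`-dimensional subspaces of `ℝⁿ`, encoded as the set of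
symmetric idempotent `n × n` matrices of trace `d` (orthogonal projections). -/
def Grass (n d : ℕ) : Type :=
  {P : Matrix (Fin n) (Fin n) ℝ // P.IsSymm ∧ P * P = P ∧ P.trace = d}

instance (n d : ℕ) : MeasurableSpace (Grass n d) :=
  @Subtype.instMeasurableSpace _ _ (inferInstanceAs (MeasurableSpace (Fin n → Fin n → ℝ)))

namespace SubspaceSampling

section PermSums
variable {ι : Type*} [Fintype ι] [DecidableEq ι]

/-- The (unnormalised) mean of the product of `x` over the image of `s` under a random
permutation. -/
def permSum (x : ι → ℝ) (s : Finset ι) : ℝ := ∑ π : Equiv.Perm ι, ∏ i ∈ s, x (π i)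

lemma permSum_nonneg {x : ι → ℝ} (hx : ∀ i, 0 ≤ x i) (s : Finset ι) : 0 ≤ permSum x s :=
  Finset.sum_nonneg fun _ _ => Finset.prod_nonneg fun _ _ => hx _

lemma sum_perm_swap (x g : ι → ℝ) {s : Finset ι} {a b : ι} (ha : a ∉ s) (hb : b ∉ s) :
    ∑ π : Equiv.Perm ι, g (π a) * ∏ i ∈ s, x (π i) =
      ∑ π : Equiv.Perm ι, g (π b) * ∏ i ∈ s, x (π i) := by
  rw [← Equiv.sum_comp (Equiv.mulRight (Equiv.swap a b))]
  refine Finset.sum_congr rfl fun π _ => ?_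
  simp only [Equiv.coe_mulRight, Equiv.Perm.mul_apply, Equiv.swap_apply_left]
  congr 1
  refine Finset.prod_congr rfl fun i hi => ?_
  have h1 : i ≠ a := fun h => ha (h ▸ hi)
  have h2 : i ≠ b := fun h => hb (h ▸ hi)
  rw [Equiv.swap_apply_of_ne_of_ne h1 h2]

lemma card_compl_mul_permSum_insert (x : ι → ℝ) {s : Finset ι} {a : ι} (ha : a ∉ s) :
    ((Fintype.card ι : ℝ) - s.card) * permSum x (insert a s) =
      (∑ i, x i) * permSum x s - ∑ i ∈ s, ∑ π : Equiv.Perm ι, x (π i) * ∏ k ∈ s, x (π k) := by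
  have h1 : ∀ b ∈ sᶜ, permSum x (insert a s) = ∑ π : Equiv.Perm ι, x (π b) * ∏ k ∈ s, x (π k) := by
    intro b hb
    rw [← sum_perm_swap x x ha (Finset.mem_compl.1 hb)]
    simp only [permSum, Finset.prod_insert ha]
  have h2 : ((Fintype.card ι : ℝ) - s.card) * permSum x (insert a s) =
      ∑ b ∈ sᶜ, ∑ π : Equiv.Perm ι, x (π b) * ∏ k ∈ s, x (π k) := by
    rw [← Finset.sum_congr rfl h1, Finset.sum_const, Finset.card_compl, nsmul_eq_mul,
      Nat.cast_sub (Finset.card_le_univ s)]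
  rw [h2, eq_sub_iff_add_eq, Finset.sum_compl_add_sum, Finset.sum_comm, permSum, Finset.mul_sum]
  refine Finset.sum_congr rfl fun π _ => ?_
  rw [← Finset.sum_mul, Equiv.sum_comp π x]

lemma card_mul_sum_sq_le {x : ι → ℝ} (hx : ∀ i, 0 ≤ x i) {s : Finset ι} {i : ι} (hi : i ∈ s) :
    ((Fintype.card ι : ℝ) - s.card + 1) * ∑ π : Equiv.Perm ι, x (π i) * ∏ k ∈ s, x (π k) ≤
      (∑ i, x i ^ 2) * permSum x (s.erase i) := by
  have h0 : ∀ π : Equiv.Perm ι, x (π i) * ∏ k ∈ s, x (π k)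
      = x (π i) ^ 2 * ∏ k ∈ s.erase i, x (π k) := by
    intro π
    rw [← Finset.mul_prod_erase s _ hi]; ring
  simp only [h0]
  have hin : i ∉ s.erase i := Finset.notMem_erase i s
  have h1 : ∀ b ∈ (s.erase i)ᶜ, ∑ π : Equiv.Perm ι, x (π i) ^ 2 * ∏ k ∈ s.erase i, x (π k) =
      ∑ π : Equiv.Perm ι, x (π b) ^ 2 * ∏ k ∈ s.erase i, x (π k) := fun b hb =>
    sum_perm_swap x (fun k => x k ^ 2) hin (Finset.mem_compl.1 hb)
  have hcard : (((s.erase i)ᶜ.card : ℕ) : ℝ) = (Fintype.card ι : ℝ) - s.card + 1 := by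
    rw [Finset.card_compl, Finset.card_erase_of_mem hi, Nat.cast_sub, Nat.cast_sub]
    · push_cast; ring
    · exact Finset.card_pos.2 ⟨i, hi⟩
    · exact (Nat.sub_le _ _).trans (Finset.card_le_univ s)
  rw [← hcard, ← nsmul_eq_mul, ← Finset.sum_const, Finset.sum_congr rfl h1, Finset.sum_comm, permSum,
    Finset.mul_sum]
  refine Finset.sum_le_sum fun π _ => ?_
  rw [← Finset.sum_mul]
  refine mul_le_mul_of_nonneg_right ?_ (Finset.prod_nonneg fun _ _ => hx _)
  rw [← Equiv.sum_comp π (fun k => x k ^ 2)]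
  exact Finset.sum_le_sum_of_subset_of_nonneg (Finset.subset_univ _) fun _ _ _ => sq_nonneg _

lemma recurrence_numeric {d j p Δ u : ℝ} (hj0 : 0 ≤ j) (hjp : j ≤ p) (hp : 8 * p ≤ d)
    (hΔ : 0 ≤ Δ) (hu0 : 0 ≤ u) (hu : u ≤ 1 / 2) (h : 16 * p * (Δ + p) ≤ u * d ^ 2) :
    j * (d + Δ) ≤ (d - (1 - u) * (d - j)) * ((d - j + 1) * (1 - u)) := by
  have hd : 0 ≤ d := by linarith
  have hp0 : 0 ≤ p := by linarith
  have h1 : j * (Δ + j) ≤ p * (Δ + p) := by gcongr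
  have h2 : u * (j * d) ≤ u * (d / 8 * d) := by gcongr; linarith
  have h3 : 0 ≤ u * d ^ 2 := by positivity
  have h5 : 0 ≤ (d - (1 - u) * (d - j)) * (1 - u) := by
    apply mul_nonneg
    · nlinarith [mul_nonneg hu0 hd, mul_nonneg hj0 (show 0 ≤ 1 - u by linarith)]
    · linarith
  have h6 : u * (d * (d - j)) * (1 / 2) ≤ u * (d * (d - j)) * (1 - u) := by
    have : 0 ≤ d - j := by linarith
    gcongr
    linarith
  have h7 : 0 ≤ j * (d - j) * u ^ 2 := by
    have : 0 ≤ d - j := by linarith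
    positivity
  have h8 : 0 ≤ u * j ^ 2 := by positivity
  nlinarith

/-- Inserting one more factor changes the mean product by a factor close to one. -/
lemma permSum_insert_ge {x : ι → ℝ} (hx : ∀ i, 0 ≤ x i) (hsum : ∑ i, x i = Fintype.card ι)
    {Δ p u : ℝ} (hΔ : ∑ i, (x i - 1) ^ 2 ≤ Δ) (hp : 8 * p ≤ Fintype.card ι) (hu0 : 0 ≤ u)
    (hu : u ≤ 1 / 2) (h : 16 * p * (Δ + p) ≤ u * (Fintype.card ι : ℝ) ^ 2) (j : ℕ) :
    ∀ s : Finset ι, s.card = j → (j : ℝ) ≤ p → ∀ a ∉ s,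
      (1 - u) * permSum x s ≤ permSum x (insert a s) := by
  have hΔ0 : 0 ≤ Δ := (Finset.sum_nonneg fun _ _ => sq_nonneg _).trans hΔ
  have hsq : ∑ i, x i ^ 2 ≤ Fintype.card ι + Δ := by
    have : ∑ i, (x i - 1) ^ 2 = ∑ i, x i ^ 2 - Fintype.card ι := by
      simp only [sub_sq, Finset.sum_add_distrib, Finset.sum_sub_distrib, mul_one, one_pow,
        ← Finset.mul_sum, hsum]
      simp
      ring
    linarith
  induction j with
  | zero =>
    intro s hs _ a ha
    obtain rfl := Finset.card_eq_zero.1 hs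
    have h1 := card_compl_mul_permSum_insert x ha
    rw [hsum] at h1
    simp only [Finset.card_empty, Nat.cast_zero, sub_zero, Finset.sum_empty] at h1
    have hc : (0 : ℝ) < Fintype.card ι := by exact_mod_cast Fintype.card_pos_iff.2 ⟨a⟩
    rw [mul_left_cancel₀ hc.ne' h1]
    nlinarith [permSum_nonneg hx (∅ : Finset ι)]
  | succ j ih =>
    intro s hs hjp a ha
    have hcard : ((j + 1 : ℕ) : ℝ) = s.card := by rw [hs]
    have hlt : (s.card : ℝ) < Fintype.card ι := by
      exact_mod_cast Finset.card_lt_univ_of_notMem ha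
    set d : ℝ := (Fintype.card ι : ℝ)
    set c : ℝ := (s.card : ℝ)
    have hjc : 0 ≤ c := Nat.cast_nonneg _
    have hcp : c ≤ p := hcard ▸ hjp
    have hpos : 0 < (d - c + 1) * (1 - u) := by
      apply mul_pos <;> linarith
    have h1 := card_compl_mul_permSum_insert x ha
    have hq := permSum_nonneg hx s
    have h2 : ∀ i ∈ s, ∑ π : Equiv.Perm ι, x (π i) * ∏ k ∈ s, x (π k) ≤
        (d + Δ) * permSum x s / ((d - c + 1) * (1 - u)) := by
      intro i hi
      rw [le_div_iff₀ hpos]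
      have h3 := card_mul_sum_sq_le hx hi
      have h4 := ih (s.erase i) (by rw [Finset.card_erase_of_mem hi, hs]; rfl)
        (le_trans (by push_cast; linarith) hjp) i (Finset.notMem_erase i s)
      rw [Finset.insert_erase hi] at h4
      have h5 : 0 ≤ permSum x (s.erase i) := permSum_nonneg hx _
      calc _ = ((d - c + 1) * ∑ π : Equiv.Perm ι, x (π i) * ∏ k ∈ s, x (π k)) * (1 - u) := by ring
        _ ≤ ((∑ i, x i ^ 2) * permSum x (s.erase i)) * (1 - u) := by
          gcongr; linarith
        _ ≤ ((d + Δ) * permSum x (s.erase i)) * (1 - u) := by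
          gcongr; linarith
        _ = (d + Δ) * ((1 - u) * permSum x (s.erase i)) := by ring
        _ ≤ _ := by gcongr
    have h6 := Finset.sum_le_sum h2
    rw [Finset.sum_const, nsmul_eq_mul] at h6
    have h7 := recurrence_numeric hjc hcp hp hΔ0 hu0 hu h
    have h8 : c * ((d + Δ) * permSum x s / ((d - c + 1) * (1 - u))) ≤
        (d - (1 - u) * (d - c)) * permSum x s := by
      rw [← mul_div_assoc, div_le_iff₀ hpos]
      nlinarith [mul_le_mul_of_nonneg_right h7 hq]
    rw [hsum] at h1
    have h9 : 0 < d - c := by linarith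
    refine le_of_mul_le_mul_left ?_ h9
    rw [h1]
    nlinarith

lemma permSum_ge {x : ι → ℝ} (hx : ∀ i, 0 ≤ x i) (hsum : ∑ i, x i = Fintype.card ι)
    {Δ u : ℝ} {p : ℕ} (hΔ : ∑ i, (x i - 1) ^ 2 ≤ Δ) (hp : 8 * (p : ℝ) ≤ Fintype.card ι) (hu0 : 0 ≤ u)
    (hu : u ≤ 1 / 2) (h : 16 * p * (Δ + p) ≤ u * (Fintype.card ι : ℝ) ^ 2) (s : Finset ι)
    (hs : s.card ≤ p) :
    (1 - u) ^ s.card * (Fintype.card ι).factorial ≤ permSum x s := by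
  induction s using Finset.induction_on with
  | empty => simp [permSum, Fintype.card_perm]
  | insert a s ha ih =>
    rw [Finset.card_insert_of_notMem ha] at hs ⊢
    have h1 := ih (by omega)
    have h2 := permSum_insert_ge hx hsum hΔ hp hu0 hu h s.card s rfl
      (by exact_mod_cast (by omega : s.card ≤ p)) a ha
    rw [pow_succ]
    nlinarith

end PermSums

open ProbabilityTheory Matrix
open scoped ENNReal

/-- The standard Gaussian measure on `κ → ℝ`. -/
noncomputable def gauss (κ : Type*) [Fintype κ] : Measure (κ → ℝ) :=
  Measure.pi fun _ => gaussianReal 0 1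

instance (κ : Type*) [Fintype κ] : IsProbabilityMeasure (gauss κ) := by
  unfold gauss; infer_instance

lemma toLp_mulVec_inner {ι κ : Type*} [Fintype ι] [Fintype κ] (W : Matrix ι κ ℝ)
    (x : ι → ℝ) (t : EuclideanSpace ℝ κ) :
    inner ℝ (WithLp.toLp 2 (Wᵀ *ᵥ x)) t = inner ℝ (WithLp.toLp 2 x) (WithLp.toLp 2 (W *ᵥ t.ofLp)) := by
  simp only [EuclideanSpace.inner_eq_star_dotProduct, star_trivial]
  rw [mulVec_transpose, dotProduct_comm, ← dotProduct_mulVec, dotProduct_comm]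

lemma dotProduct_mulVec_self {ι κ : Type*} [Fintype ι] [Fintype κ] [DecidableEq κ]
    {W : Matrix ι κ ℝ} (hW : Wᵀ * W = 1) (x y : κ → ℝ) :
    (W *ᵥ x) ⬝ᵥ (W *ᵥ y) = x ⬝ᵥ y := by
  rw [dotProduct_mulVec, ← mulVec_transpose, mulVec_mulVec, hW, one_mulVec]

/-- Coisometries push the standard Gaussian measure to the standard Gaussian measure. -/
lemma measurePreserving_gauss {ι κ : Type*} [Fintype ι] [Fintype κ] [DecidableEq κ]
    {W : Matrix ι κ ℝ} (hW : Wᵀ * W = 1) :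
    MeasurePreserving (fun x : ι → ℝ => Wᵀ *ᵥ x) (gauss ι) (gauss κ) := by
  have hm : Measurable (fun x : ι → ℝ => Wᵀ *ᵥ x) :=
    (Continuous.matrix_mulVec continuous_const continuous_id).measurable
  refine ⟨hm, ?_⟩
  have key : ((gauss ι).map (fun x : ι → ℝ => Wᵀ *ᵥ x)).map (WithLp.toLp 2)
      = (gauss κ).map (WithLp.toLp 2) := by
    have : IsProbabilityMeasure (((gauss ι).map (fun x : ι → ℝ => Wᵀ *ᵥ x)).map
        (WithLp.toLp 2 : (κ → ℝ) → EuclideanSpace ℝ κ)) := by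
      have := Measure.isProbabilityMeasure_map (μ := gauss ι) hm.aemeasurable
      exact Measure.isProbabilityMeasure_map (by fun_prop)
    have h2 : (gauss κ).map (WithLp.toLp 2) = stdGaussian (EuclideanSpace ℝ κ) :=
      map_pi_eq_stdGaussian
    have h1 : (gauss ι).map (WithLp.toLp 2) = stdGaussian (EuclideanSpace ℝ ι) :=
      map_pi_eq_stdGaussian
    rw [h2]
    apply Measure.ext_of_charFun
    ext t
    rw [charFun_stdGaussian, charFun_apply, integral_map (by fun_prop) (by fun_prop),
      integral_map hm.aemeasurable (by fun_prop)]
    have h3 := charFun_stdGaussian (WithLp.toLp 2 (W *ᵥ t.ofLp))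
    rw [← h1, charFun_apply, integral_map (by fun_prop) (by fun_prop)] at h3
    simp_rw [toLp_mulVec_inner]
    rw [h3]
    have h4 : ‖WithLp.toLp 2 (W *ᵥ t.ofLp)‖ ^ 2 = ‖t‖ ^ 2 := by
      rw [← real_inner_self_eq_norm_sq, ← real_inner_self_eq_norm_sq]
      simp only [EuclideanSpace.inner_eq_star_dotProduct, star_trivial]
      exact dotProduct_mulVec_self hW _ _
    norm_cast
    rw [h4]
  have h5 := congrArg (Measure.map (WithLp.ofLp : EuclideanSpace ℝ κ → κ → ℝ)) key
  rw [Measure.map_map (by fun_prop) (by fun_prop), Measure.map_map (by fun_prop) (by fun_prop),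
    Measure.map_map (by fun_prop) (by fun_prop)] at h5
  simpa [Function.comp_def] using h5

/-- The orthogonal group. -/
abbrev O (ι : Type*) [Fintype ι] [DecidableEq ι] := Matrix.unitaryGroup ι ℝ

section Haar
variable {ι : Type*} [Fintype ι] [DecidableEq ι]

instance : MeasurableSpace (O ι) := borel _
instance : BorelSpace (O ι) := ⟨rfl⟩

lemma O_transpose_mul (U : O ι) : (U : Matrix ι ι ℝ)ᵀ * (U : Matrix ι ι ℝ) = 1 := by
  have := (Matrix.mem_unitaryGroup_iff' (A := (U : Matrix ι ι ℝ))).1 U.2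
  simpa [star_eq_conjTranspose] using this

lemma O_mul_transpose (U : O ι) : (U : Matrix ι ι ℝ) * (U : Matrix ι ι ℝ)ᵀ = 1 := by
  have := (Matrix.mem_unitaryGroup_iff (A := (U : Matrix ι ι ℝ))).1 U.2
  simpa [star_eq_conjTranspose] using this

lemma mem_O_of (A : Matrix ι ι ℝ) (h : Aᵀ * A = 1) : A ∈ Matrix.unitaryGroup ι ℝ := by
  rw [Matrix.mem_unitaryGroup_iff']
  simpa [star_eq_conjTranspose] using h

instance : CompactSpace (O ι) := by
  refine isCompact_iff_compactSpace.1 (?_ : IsCompact (unitary (Matrix ι ι ℝ) : Set (Matrix ι ι ℝ)))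
  have hK : IsCompact {A : Matrix ι ι ℝ | ∀ i j, A i j ∈ Set.Icc (-1 : ℝ) 1} := by
    have := isCompact_univ_pi (fun _ : ι => isCompact_univ_pi (fun _ : ι =>
      (isCompact_Icc : IsCompact (Set.Icc (-1 : ℝ) 1))))
    have h : {A : ι → ι → ℝ | ∀ i j, A i j ∈ Set.Icc (-1 : ℝ) 1} =
        Set.univ.pi (fun _ => Set.univ.pi (fun _ => Set.Icc (-1 : ℝ) 1)) := by
      ext A
      simp only [Set.mem_pi, Set.mem_ofPred_eq, Set.mem_univ, true_imp_iff]
    rw [← h] at this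
    exact this
  refine hK.of_isClosed_subset isClosed_unitary ?_
  intro A hA i j
  have := O_mul_transpose ⟨A, hA⟩
  have h1 := congrFun (congrFun this i) i
  simp only [mul_apply, transpose_apply, one_apply_eq] at h1
  have h2 : A i j * A i j ≤ 1 := by
    rw [← h1]
    exact Finset.single_le_sum (f := fun j => A i j * A i j) (fun k _ => mul_self_nonneg _)
      (Finset.mem_univ j)
  constructor <;> nlinarith

/-- The Haar probability measure on the orthogonal group. -/
noncomputable def haarO (ι : Type*) [Fintype ι] [DecidableEq ι] : Measure (O ι) :=
  Measure.haarMeasure ⊤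

instance : IsProbabilityMeasure (haarO ι) := ⟨by
  simpa [haarO] using Measure.haarMeasure_self (K₀ := (⊤ : TopologicalSpace.PositiveCompacts (O ι)))⟩

instance : (haarO ι).IsHaarMeasure := by unfold haarO; infer_instance

instance : (haarO ι).IsMulRightInvariant := by
  constructor
  intro g
  have : IsProbabilityMeasure ((haarO ι).map (· * g)) :=
    Measure.isProbabilityMeasure_map (by fun_prop)
  exact Measure.isHaarMeasure_eq_of_isProbabilityMeasure _ _

lemma measurable_O_entry (i j : ι) : Measurable (fun U : O ι => (U : Matrix ι ι ℝ) i j) := by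
  apply Continuous.measurable
  exact (continuous_subtype_val.matrix_elem i j)

lemma measurable_O_mulVec {κ α : Type*} [Fintype κ] [MeasurableSpace α] (W : Matrix ι κ ℝ)
    {u : α → O ι} {x : α → κ → ℝ} (hu : Measurable u) (hx : Measurable x) :
    Measurable (fun a => ((u a : Matrix ι ι ℝ) * W) *ᵥ x a) := by
  simp only [← mulVec_mulVec]
  refine measurable_pi_lambda _ fun i => ?_
  simp only [mulVec, dotProduct]
  refine Finset.measurable_sum _ fun j _ => ((measurable_O_entry i j).comp hu).mul ?_
  refine Finset.measurable_sum _ fun k _ => measurable_const.mul ?_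
  exact (measurable_pi_apply k).comp hx

end Haar

section Frames
variable {ι κ : Type*} [Fintype ι] [DecidableEq ι] [Fintype κ] [DecidableEq κ]

lemma orthonormal_columns {W : Matrix ι κ ℝ} :
    Wᵀ * W = 1 ↔ Orthonormal ℝ (fun k => (WithLp.toLp 2 (Wᵀ k) : EuclideanSpace ℝ ι)) := by
  rw [orthonormal_iff_ite, ← Matrix.ext_iff]
  refine forall_congr' fun i => forall_congr' fun j => ?_
  rw [mul_apply, one_apply]
  simp [PiLp.inner_apply, mul_comm]

/-- The coordinate inclusion matrix associated with a map of index sets. -/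
def inclMatrix (j : κ → ι) : Matrix ι κ ℝ := fun i k => if i = j k then 1 else 0

lemma exists_O_mul_incl {W : Matrix ι κ ℝ} (hW : Wᵀ * W = 1) (j : κ ↪ ι) :
    ∃ U : O ι, (U : Matrix ι ι ℝ) * inclMatrix j = W := by
  have ho := orthonormal_columns.1 hW
  let v : ι → EuclideanSpace ℝ ι :=
    Function.extend j (fun k => (WithLp.toLp 2 (Wᵀ k) : EuclideanSpace ℝ ι)) 0
  have hv : ∀ k, v (j k) = WithLp.toLp 2 (Wᵀ k) := fun k => j.injective.extend_apply _ _ k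
  have hres : Orthonormal ℝ ((Set.range j).domRestrict v) := by
    have h := ho.comp (fun x : Set.range j => x.2.choose) (by
      intro x y hxy
      apply Subtype.ext
      rw [← x.2.choose_spec, ← y.2.choose_spec]
      exact congrArg j hxy)
    convert h using 1
    ext1 x
    have := hv x.2.choose
    rw [x.2.choose_spec] at this
    exact this
  obtain ⟨b, hb⟩ := hres.exists_orthonormalBasis_extension_of_card_eq (by simp)
  let U : Matrix ι ι ℝ := Matrix.of fun i l => (b l).ofLp i
  have hU : Uᵀ * U = 1 := orthonormal_columns.2 b.orthonormal
  refine ⟨⟨U, mem_O_of U hU⟩, ?_⟩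
  ext i k
  have h1 : (b (j k)) = WithLp.toLp 2 (Wᵀ k) := by rw [hb _ ⟨k, rfl⟩, hv]
  simp [mul_apply, inclMatrix, U, h1]

lemma nonempty_embedding {W : Matrix ι κ ℝ} (hW : Wᵀ * W = 1) : Nonempty (κ ↪ ι) := by
  have h := (orthonormal_columns.1 hW).linearIndependent.fintype_card_le_finrank
  rw [finrank_euclideanSpace] at h
  exact Function.Embedding.nonempty_of_card_le h

/-- Any two frames of the same size differ by a rotation. -/
lemma exists_O_mul_eq {W W' : Matrix ι κ ℝ} (hW : Wᵀ * W = 1) (hW' : W'ᵀ * W' = 1) :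
    ∃ V : O ι, (V : Matrix ι ι ℝ) * W' = W := by
  obtain ⟨j⟩ := nonempty_embedding hW
  obtain ⟨U, hU⟩ := exists_O_mul_incl hW j
  obtain ⟨U', hU'⟩ := exists_O_mul_incl hW' j
  refine ⟨U * U'⁻¹, ?_⟩
  rw [← hU', ← Matrix.mul_assoc]
  have : ((U * U'⁻¹ : O ι) : Matrix ι ι ℝ) * (U' : Matrix ι ι ℝ) = U := by
    rw [← Submonoid.coe_mul]; simp
  rw [this, hU]

lemma inclMatrix_isometry (j : κ ↪ ι) : (inclMatrix j)ᵀ * inclMatrix j = 1 := by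
  ext a b
  simp [mul_apply, inclMatrix, one_apply, eq_comm]

lemma isometry_mul {τ : Type*} [Fintype τ] [DecidableEq τ] {W : Matrix ι κ ℝ} {B : Matrix κ τ ℝ}
    (hW : Wᵀ * W = 1) (hB : Bᵀ * B = 1) : (W * B)ᵀ * (W * B) = 1 := by
  rw [transpose_mul, Matrix.mul_assoc, ← Matrix.mul_assoc Wᵀ, hW, Matrix.one_mul, hB]

/-- A family of at most `d` vectors lies in the range of a frame of size `d`. -/
lemma exists_frame_range {τ : Type*} [Fintype τ] (w : τ → ι → ℝ)
    (h1 : Fintype.card τ ≤ Fintype.card κ) (h2 : Fintype.card κ ≤ Fintype.card ι) :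
    ∃ E : Matrix ι κ ℝ, Eᵀ * E = 1 ∧ ∀ t, E *ᵥ (Eᵀ *ᵥ w t) = w t := by
  classical
  let S : Submodule ℝ (EuclideanSpace ℝ ι) := Submodule.span ℝ (Set.range fun t => WithLp.toLp 2 (w t))
  have hS : Module.finrank ℝ S ≤ Fintype.card κ := (finrank_range_le_card _).trans h1
  obtain ⟨q⟩ := Function.Embedding.nonempty_of_card_le
    (show Fintype.card (Fin (Module.finrank ℝ S)) ≤ Fintype.card κ by simpa using hS)
  obtain ⟨j⟩ := Function.Embedding.nonempty_of_card_le h2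
  let b := stdOrthonormalBasis ℝ S
  let B : Matrix ι (Fin (Module.finrank ℝ S)) ℝ := fun i k => (b k : EuclideanSpace ℝ ι).ofLp i
  have hB : Bᵀ * B = 1 := by
    rw [orthonormal_columns]
    exact b.orthonormal.comp_linearIsometry S.subtypeₗᵢ
  obtain ⟨U, hU⟩ := exists_O_mul_incl hB (q.trans j)
  refine ⟨(U : Matrix ι ι ℝ) * inclMatrix j, isometry_mul (O_transpose_mul U) (inclMatrix_isometry j), fun t => ?_⟩
  have hw : ∃ c, w t = B *ᵥ c := by
    have hmem : (WithLp.toLp 2 (w t) : EuclideanSpace ℝ ι) ∈ S := Submodule.subset_span ⟨t, rfl⟩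
    refine ⟨(b.repr ⟨_, hmem⟩).ofLp, ?_⟩
    have h := congrArg (Subtype.val) (b.sum_repr ⟨_, hmem⟩)
    have h' := congrArg WithLp.ofLp h
    simp only at h'
    refine h'.symm.trans ?_
    ext i
    simp [mulVec, dotProduct, B, mul_comm]
  obtain ⟨c, hc⟩ := hw
  have hBE : B = ((U : Matrix ι ι ℝ) * inclMatrix j) * inclMatrix q := by
    rw [← hU, Matrix.mul_assoc]
    congr 1
    ext i k
    simp [mul_apply, inclMatrix]
  have hE := isometry_mul (O_transpose_mul U) (inclMatrix_isometry j)
  rw [hc, hBE, mulVec_mulVec, mulVec_mulVec, Matrix.mul_assoc,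
    ← Matrix.mul_assoc (_ᵀ), hE, Matrix.one_mul]

end Frames

/-- Bounded measurable functions that are positively homogeneous of degree zero. -/
structure Homog {ι : Type*} (f : (ι → ℝ) → ℝ) : Prop where
  meas : Measurable f
  homog : ∀ (t : ℝ) (x : ι → ℝ), 0 < t → f (t • x) = f x
  bdd : ∃ C : ℝ, ∀ x, |f x| ≤ C

section Averages
variable {ι κ : Type*} [Fintype ι] [Fintype κ]

/-- The average of `f` over the range of the frame `W`. -/
noncomputable def avg (f : (ι → ℝ) → ℝ) (W : Matrix ι κ ℝ) : ℝ := ∫ z, f (W *ᵥ z) ∂gauss κ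

lemma measurable_mulVec (W : Matrix ι κ ℝ) : Measurable fun z : κ → ℝ => W *ᵥ z :=
  (Continuous.matrix_mulVec continuous_const continuous_id).measurable

lemma Homog.comp_mulVec {f : (ι → ℝ) → ℝ} (hf : Homog f) (W : Matrix ι κ ℝ) :
    Homog fun z : κ → ℝ => f (W *ᵥ z) where
  meas := hf.meas.comp (measurable_mulVec W)
  homog t x ht := by rw [mulVec_smul, hf.homog t _ ht]
  bdd := by
    obtain ⟨C, hC⟩ := hf.bdd
    exact ⟨C, fun x => hC _⟩

lemma Homog.integrable {f : (ι → ℝ) → ℝ} (hf : Homog f) {α : Type*} [MeasurableSpace α]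
    (μ : Measure α) [IsFiniteMeasure μ] {u : α → ι → ℝ} (hu : Measurable u) :
    Integrable (fun a => f (u a)) μ := by
  obtain ⟨C, hC⟩ := hf.bdd
  exact Integrable.of_bound (hf.meas.comp hu).aestronglyMeasurable C
    (Filter.Eventually.of_forall fun a => hC _)

lemma abs_avg_le {f : (ι → ℝ) → ℝ} {C : ℝ} (hC : ∀ x, |f x| ≤ C) (W : Matrix ι κ ℝ) :
    |avg f W| ≤ C := by
  have h := norm_integral_le_of_norm_le_const (μ := gauss κ) (f := fun z => f (W *ᵥ z))
    (C := C) (Filter.Eventually.of_forall fun a => hC _)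
  simpa [avg] using h

variable [DecidableEq ι]

lemma Homog.measurable_avg {f : (ι → ℝ) → ℝ} (hf : Homog f) {α : Type*} [MeasurableSpace α]
    {u : α → O ι} (hu : Measurable u) (W : Matrix ι κ ℝ) :
    Measurable fun a => avg f ((u a : Matrix ι ι ℝ) * W) := by
  have h : Measurable fun p : α × (κ → ℝ) => f (((u p.1 : Matrix ι ι ℝ) * W) *ᵥ p.2) :=
    hf.meas.comp (measurable_O_mulVec W (hu.comp measurable_fst) measurable_snd)
  exact (h.stronglyMeasurable.integral_prod_right').measurable

lemma lintegral_frame_eq [DecidableEq κ] (G : Matrix ι κ ℝ → ℝ≥0∞) {W W' : Matrix ι κ ℝ} (hW : Wᵀ * W = 1)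
    (hW' : W'ᵀ * W' = 1) :
    ∫⁻ U : O ι, G ((U : Matrix ι ι ℝ) * W) ∂haarO ι = ∫⁻ U : O ι, G ((U : Matrix ι ι ℝ) * W') ∂haarO ι := by
  obtain ⟨V, rfl⟩ := exists_O_mul_eq hW hW'
  rw [← lintegral_mul_right_eq_self (μ := haarO ι)
    (fun U : O ι => G ((U : Matrix ι ι ℝ) * W')) V]
  simp only [Submonoid.coe_mul, Matrix.mul_assoc]

lemma integral_frame_eq [DecidableEq κ] (G : Matrix ι κ ℝ → ℝ) {W W' : Matrix ι κ ℝ} (hW : Wᵀ * W = 1)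
    (hW' : W'ᵀ * W' = 1) :
    ∫ U : O ι, G ((U : Matrix ι ι ℝ) * W) ∂haarO ι = ∫ U : O ι, G ((U : Matrix ι ι ℝ) * W') ∂haarO ι := by
  obtain ⟨V, rfl⟩ := exists_O_mul_eq hW hW'
  rw [← integral_mul_right_eq_self (μ := haarO ι)
    (fun U : O ι => G ((U : Matrix ι ι ℝ) * W')) V]
  simp only [Submonoid.coe_mul, Matrix.mul_assoc]

lemma measurePreserving_gauss_O (V : O ι) :
    MeasurePreserving (fun x : ι → ℝ => (V : Matrix ι ι ℝ) *ᵥ x) (gauss ι) (gauss ι) := by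
  have h := measurePreserving_gauss (W := (V : Matrix ι ι ℝ)ᵀ)
    (by rw [transpose_transpose]; exact O_mul_transpose V)
  simpa using h

lemma measurable_O_apply : Measurable fun p : O ι × (ι → ℝ) => (p.1 : Matrix ι ι ℝ) *ᵥ p.2 := by
  have h := measurable_O_mulVec (1 : Matrix ι ι ℝ) (α := O ι × (ι → ℝ)) measurable_fst measurable_snd
  simpa using h

lemma integral_O_apply_unit (g : (ι → ℝ) → ℝ) {x y : ι → ℝ} (hx : x ⬝ᵥ x = 1) (hy : y ⬝ᵥ y = 1) :
    ∫ V : O ι, g ((V : Matrix ι ι ℝ) *ᵥ x) ∂haarO ι = ∫ V : O ι, g ((V : Matrix ι ι ℝ) *ᵥ y) ∂haarO ι := by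
  have hW : ∀ x : ι → ℝ, x ⬝ᵥ x = 1 →
      (Matrix.of fun (i : ι) (_ : Unit) => x i)ᵀ * (Matrix.of fun (i : ι) (_ : Unit) => x i) = 1 := by
    intro x hx
    ext a b
    simpa [mul_apply, dotProduct] using hx
  have h := integral_frame_eq (fun W : Matrix ι Unit ℝ => g (fun i => W i ())) (hW x hx) (hW y hy)
  simp only [mul_apply, of_apply] at h
  exact h

lemma Homog.integral_O_apply_eq {g : (ι → ℝ) → ℝ} (hg : Homog g) {x y : ι → ℝ} (hx : x ≠ 0)
    (hy : y ≠ 0) :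
    ∫ V : O ι, g ((V : Matrix ι ι ℝ) *ᵥ x) ∂haarO ι = ∫ V : O ι, g ((V : Matrix ι ι ℝ) *ᵥ y) ∂haarO ι := by
  have key : ∀ x : ι → ℝ, x ≠ 0 → ∃ x' : ι → ℝ, x' ⬝ᵥ x' = 1 ∧
      ∀ V : O ι, g ((V : Matrix ι ι ℝ) *ᵥ x) = g ((V : Matrix ι ι ℝ) *ᵥ x') := by
    intro x hx
    have hpos : 0 < x ⬝ᵥ x := by
      have h0 : 0 ≤ x ⬝ᵥ x := Finset.sum_nonneg fun i _ => mul_self_nonneg _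
      exact lt_of_le_of_ne h0 fun h => hx (dotProduct_self_eq_zero.1 h.symm)
    have hs : 0 < (Real.sqrt (x ⬝ᵥ x))⁻¹ := inv_pos.2 (Real.sqrt_pos.2 hpos)
    refine ⟨(Real.sqrt (x ⬝ᵥ x))⁻¹ • x, ?_, fun V => ?_⟩
    · rw [smul_dotProduct, dotProduct_smul, smul_eq_mul, smul_eq_mul]
      have := Real.mul_self_sqrt hpos.le
      have h2 := (Real.sqrt_pos.2 hpos).ne'
      field_simp
      nlinarith
    · rw [mulVec_smul, hg.homog _ _ hs]
  obtain ⟨x', hx', h1⟩ := key x hx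
  obtain ⟨y', hy', h2⟩ := key y hy
  simp_rw [h1, h2]
  exact integral_O_apply_unit g hx' hy'

lemma Homog.integral_mul_eq_integral_mul_integral_O {g : (ι → ℝ) → ℝ} (hg : Homog g) (ρ : Measure (ι → ℝ)) [SFinite ρ]
    (h0 : ρ {0} = 0)
    (hρ : ∀ V : O ι, MeasurePreserving (fun x : ι → ℝ => (V : Matrix ι ι ℝ) *ᵥ x) ρ ρ)
    {w : (ι → ℝ) → ℝ} (hwm : Measurable w) (hw : Integrable w ρ)
    (hwV : ∀ (V : O ι) x, w ((V : Matrix ι ι ℝ) *ᵥ x) = w x) {y : ι → ℝ} (hy : y ≠ 0) :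
    ∫ x, g x * w x ∂ρ = (∫ x, w x ∂ρ) * ∫ V : O ι, g ((V : Matrix ι ι ℝ) *ᵥ y) ∂haarO ι := by
  have h1 : ∀ V : O ι, ∫ x, g ((V : Matrix ι ι ℝ) *ᵥ x) * w x ∂ρ = ∫ x, g x * w x ∂ρ := by
    intro V
    conv_rhs => rw [← (hρ V).map_eq]
    rw [integral_map (f := fun x => g x * w x) (hρ V).measurable.aemeasurable
      (hg.meas.mul hwm).aestronglyMeasurable]
    simp only [hwV]
  have hint : Integrable (fun p : O ι × (ι → ℝ) => g ((p.1 : Matrix ι ι ℝ) *ᵥ p.2) * w p.2)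
      ((haarO ι).prod ρ) := by
    obtain ⟨C, hC⟩ := hg.bdd
    have hw' : Integrable (fun p : O ι × (ι → ℝ) => w p.2) ((haarO ι).prod ρ) :=
      hw.comp_snd (haarO ι)
    exact hw'.bdd_mul (hg.meas.comp measurable_O_apply).aestronglyMeasurable
      (c := C) (Filter.Eventually.of_forall fun p => hC _)
  have h2 : ∫ V : O ι, ∫ x, g ((V : Matrix ι ι ℝ) *ᵥ x) * w x ∂ρ ∂haarO ι = ∫ x, g x * w x ∂ρ := by
    simp_rw [h1]; simp
  rw [← h2, integral_integral_swap hint, ← integral_mul_const]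
  apply integral_congr_ae
  have : ∀ᵐ x ∂ρ, x ≠ 0 := by
    rw [ae_iff]; simpa using h0
  filter_upwards [this] with x hx
  rw [integral_mul_const, hg.integral_O_apply_eq hx hy, mul_comm]

omit [DecidableEq ι] in
lemma gauss_singleton [Nonempty ι] (x : ι → ℝ) : gauss ι {x} = 0 := by
  have : NullSingletonClass (gaussianReal 0 1) := nullSingletonClass_gaussianReal one_ne_zero
  have i : ι := Classical.arbitrary ι
  refine measure_mono_null (t := Function.eval i ⁻¹' {x i}) (by rintro _ rfl; simp) ?_
  exact Measure.pi_eval_preimage_null _ (measure_singleton _)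

/-- A random rotation of a fixed nonzero vector averages degree-zero homogeneous functions to
their Gaussian mean. -/
lemma Homog.integral_O_apply {g : (ι → ℝ) → ℝ} (hg : Homog g) {y : ι → ℝ} (hy : y ≠ 0) :
    ∫ V : O ι, g ((V : Matrix ι ι ℝ) *ᵥ y) ∂haarO ι = ∫ x, g x ∂gauss ι := by
  have : Nonempty ι := by
    by_contra h
    rw [not_nonempty_iff] at h
    exact hy (Subsingleton.elim _ _)
  have h := hg.integral_mul_eq_integral_mul_integral_O (gauss ι) (gauss_singleton 0) measurePreserving_gauss_O
    (w := fun _ => 1) measurable_const (integrable_const _) (fun _ _ => rfl) hy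
  simpa using h.symm

lemma Homog.integral_mul_invariant [Nonempty ι] {g : (ι → ℝ) → ℝ} (hg : Homog g)
    (ρ : Measure (ι → ℝ)) [SFinite ρ] (h0 : ρ {0} = 0)
    (hρ : ∀ V : O ι, MeasurePreserving (fun x : ι → ℝ => (V : Matrix ι ι ℝ) *ᵥ x) ρ ρ)
    {w : (ι → ℝ) → ℝ} (hwm : Measurable w) (hw : Integrable w ρ)
    (hwV : ∀ (V : O ι) x, w ((V : Matrix ι ι ℝ) *ᵥ x) = w x) :
    ∫ x, g x * w x ∂ρ = (∫ x, w x ∂ρ) * ∫ x, g x ∂gauss ι := by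
  obtain ⟨y, hy⟩ := exists_ne (0 : ι → ℝ)
  rw [hg.integral_mul_eq_integral_mul_integral_O ρ h0 hρ hwm hw hwV hy, hg.integral_O_apply hy]

end Averages

section Blocks
variable {ι κ θ R : Type*} [Fintype ι] [DecidableEq ι] [Fintype κ] [DecidableEq κ] [Fintype θ]
  [DecidableEq θ] [Fintype R]

omit [DecidableEq κ] [DecidableEq θ] [Fintype R] in
lemma integrable_comp_of_bdd {α : Type*} [MeasurableSpace α] (μ : Measure α) [IsFiniteMeasure μ]
    {Ψ : ℝ → ℝ} (hΨ : Continuous Ψ) {u : α → ℝ} (hu : Measurable u) {C : ℝ} (hC : ∀ a, |u a| ≤ C) :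
    Integrable (fun a => Ψ (u a)) μ := by
  obtain ⟨D, hD⟩ := (isCompact_Icc (a := -C) (b := C)).exists_bound_of_continuousOn hΨ.continuousOn
  exact Integrable.of_bound (hΨ.measurable.comp hu).aestronglyMeasurable D
    (Filter.Eventually.of_forall fun a => hD _ ⟨(abs_le.1 (hC a)).1, (abs_le.1 (hC a)).2⟩)

lemma mulVec_ne_zero_of_isometry {B : Matrix κ θ ℝ} (hB : Bᵀ * B = 1) {z : θ → ℝ} (hz : z ≠ 0) :
    B *ᵥ z ≠ 0 := by
  intro h
  apply hz
  rw [← one_mulVec z, ← hB, ← mulVec_mulVec, h, mulVec_zero]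

lemma avg_eq_integral_O [Nonempty θ] {f : (ι → ℝ) → ℝ} (hf : Homog f) (E : Matrix ι κ ℝ)
    {B : Matrix κ θ ℝ} (hB : Bᵀ * B = 1) :
    ∫ V : O κ, avg f (E * (V : Matrix κ κ ℝ) * B) ∂haarO κ = avg f E := by
  unfold avg
  have hm : Measurable fun p : O κ × (θ → ℝ) => E *ᵥ (((p.1 : Matrix κ κ ℝ) * B) *ᵥ p.2) :=
    (measurable_mulVec E).comp (measurable_O_mulVec B measurable_fst measurable_snd)
  have hint : Integrable (fun p : O κ × (θ → ℝ) => f ((E * (p.1 : Matrix κ κ ℝ) * B) *ᵥ p.2))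
      ((haarO κ).prod (gauss θ)) := by
    refine hf.integrable _ ?_
    simpa only [mulVec_mulVec, Matrix.mul_assoc] using hm
  rw [integral_integral_swap hint]
  have hz : ∀ᵐ z ∂gauss θ, ∫ V : O κ, f ((E * (V : Matrix κ κ ℝ) * B) *ᵥ z) ∂haarO κ =
      ∫ x, f (E *ᵥ x) ∂gauss κ := by
    have : ∀ᵐ z ∂gauss θ, z ≠ 0 := by rw [ae_iff]; simpa using gauss_singleton 0
    filter_upwards [this] with z hz
    rw [← (hf.comp_mulVec E).integral_O_apply (mulVec_ne_zero_of_isometry hB hz)]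
    simp only [mulVec_mulVec, Matrix.mul_assoc]
  rw [integral_congr_ae hz]
  simp

lemma measurable_avg_mul_O {f : (ι → ℝ) → ℝ} (hf : Homog f) (E : Matrix ι κ ℝ) (B : Matrix κ θ ℝ) :
    Measurable fun V : O κ => avg f (E * ((V : Matrix κ κ ℝ) * B)) := by
  have h := (hf.comp_mulVec E).measurable_avg (α := O κ) measurable_id B
  have h2 : ∀ V : O κ, avg (fun z => f (E *ᵥ z)) ((V : Matrix κ κ ℝ) * B)
      = avg f (E * ((V : Matrix κ κ ℝ) * B)) := by
    intro V
    simp only [avg, mulVec_mulVec]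
  simpa only [h2, id_eq] using h

lemma integrable_avg_mul_O {f : (ι → ℝ) → ℝ} (hf : Homog f) (E : Matrix ι κ ℝ) (B : Matrix κ θ ℝ) :
    Integrable (fun V : O κ => avg f (E * ((V : Matrix κ κ ℝ) * B))) (haarO κ) := by
  obtain ⟨C, hC⟩ := hf.bdd
  exact Integrable.of_bound (measurable_avg_mul_O hf E B).aestronglyMeasurable C
    (Filter.Eventually.of_forall fun V => abs_avg_le hC _)

lemma measurable_avg_mul_O₂ {f : (ι → ℝ) → ℝ} (hf : Homog f) (E : Matrix ι κ ℝ) (B : Matrix κ θ ℝ) :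
    Measurable fun p : O ι × O κ =>
      avg f ((p.1 : Matrix ι ι ℝ) * (E * ((p.2 : Matrix κ κ ℝ) * B))) := by
  have h : Measurable fun q : (O ι × O κ) × (θ → ℝ) =>
      ((q.1.1 : Matrix ι ι ℝ) * E) *ᵥ (((q.1.2 : Matrix κ κ ℝ) * B) *ᵥ q.2) :=
    measurable_O_mulVec E (by fun_prop)
      (measurable_O_mulVec B (by fun_prop) (by fun_prop))
  have h' := (hf.meas.comp h).stronglyMeasurable.integral_prod_right' (ν := gauss θ)
  simpa only [avg, Function.comp_def, mulVec_mulVec, Matrix.mul_assoc] using h'.measurable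

/-- Averages over a random subspace are dominated, in the convex order, by the mean of the averages
over rotated copies of fixed smaller subspaces. -/
lemma integral_convex_avg_le [Nonempty θ] [Nonempty R] {f : (ι → ℝ) → ℝ} (hf : Homog f)
    {E : Matrix ι κ ℝ} (hE : Eᵀ * E = 1) (W : R → Matrix ι θ ℝ) (hW : ∀ i, (W i)ᵀ * W i = 1)
    (hEW : ∀ i, E * (Eᵀ * W i) = W i) {Ψ : ℝ → ℝ} (hΨ : ConvexOn ℝ Set.univ Ψ) (hΨc : Continuous Ψ) :
    ∫ U : O ι, Ψ (avg f ((U : Matrix ι ι ℝ) * E)) ∂haarO ι ≤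
      ∫ U : O ι, Ψ ((Fintype.card R : ℝ)⁻¹ * ∑ i, avg f ((U : Matrix ι ι ℝ) * W i)) ∂haarO ι := by
  obtain ⟨C, hC⟩ := hf.bdd
  have hr : (0 : ℝ) < Fintype.card R := by exact_mod_cast Fintype.card_pos
  have hB : ∀ i, (Eᵀ * W i)ᵀ * (Eᵀ * W i) = 1 := by
    intro i
    rw [transpose_mul, transpose_transpose, Matrix.mul_assoc, hEW, hW]
  obtain ⟨b, hb⟩ : ∃ b : O ι → O κ → ℝ, ∀ U V, b U V = (Fintype.card R : ℝ)⁻¹ *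
      ∑ i, avg f ((U : Matrix ι ι ℝ) * (E * ((V : Matrix κ κ ℝ) * (Eᵀ * W i)))) :=
    ⟨_, fun _ _ => rfl⟩
  have hbC : ∀ U V, |b U V| ≤ C := by
    intro U V
    rw [hb, abs_mul, abs_of_pos (inv_pos.2 hr), inv_mul_le_iff₀ hr]
    refine (Finset.abs_sum_le_sum_abs _ _).trans ?_
    refine (Finset.sum_le_sum fun i _ => abs_avg_le hC _).trans ?_
    simp
  have hbm : Measurable fun p : O ι × O κ => b p.1 p.2 := by
    simp only [hb]
    exact measurable_const.mul (Finset.measurable_sum _ fun i _ => measurable_avg_mul_O₂ hf E _)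
  have h1 : ∀ U : O ι, Ψ (avg f ((U : Matrix ι ι ℝ) * E)) ≤ ∫ V, Ψ (b U V) ∂haarO κ := by
    intro U
    have hmU : Measurable (b U) := hbm.of_uncurry_left
    have hmean : ∫ V, b U V ∂haarO κ = avg f ((U : Matrix ι ι ℝ) * E) := by
      have h2 : ∀ i, ∫ V : O κ, avg f ((U : Matrix ι ι ℝ) * (E * ((V : Matrix κ κ ℝ) * (Eᵀ * W i)))) ∂haarO κ
          = avg f ((U : Matrix ι ι ℝ) * E) := by
        intro i
        rw [← avg_eq_integral_O hf ((U : Matrix ι ι ℝ) * E) (hB i)]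
        simp only [Matrix.mul_assoc]
      simp only [hb]
      rw [integral_const_mul, integral_finsetSum _ fun i _ => ?_]
      · rw [Finset.sum_congr rfl fun i _ => h2 i, Finset.sum_const, Finset.card_univ, nsmul_eq_mul]
        field_simp
      · have h := integrable_avg_mul_O hf ((U : Matrix ι ι ℝ) * E) (Eᵀ * W i)
        simpa only [Matrix.mul_assoc] using h
    rw [← hmean]
    exact hΨ.map_integral_le hΨc.continuousOn isClosed_univ (by simp)
      (Integrable.of_bound hmU.aestronglyMeasurable C (Filter.Eventually.of_forall fun V => hbC U V))
      (integrable_comp_of_bdd _ hΨc hmU (hbC U))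
  have hint : Integrable (fun p : O ι × O κ => Ψ (b p.1 p.2)) ((haarO ι).prod (haarO κ)) :=
    integrable_comp_of_bdd _ hΨc hbm fun p => hbC p.1 p.2
  calc ∫ U : O ι, Ψ (avg f ((U : Matrix ι ι ℝ) * E)) ∂haarO ι
      ≤ ∫ U, ∫ V, Ψ (b U V) ∂haarO κ ∂haarO ι :=
        integral_mono (integrable_comp_of_bdd _ hΨc (hf.measurable_avg measurable_id E)
          fun U => abs_avg_le hC _) hint.integral_prod_left h1
    _ = ∫ V, ∫ U, Ψ (b U V) ∂haarO ι ∂haarO κ := integral_integral_swap hint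
    _ = ∫ V : O κ, ∫ U : O ι,
          Ψ ((Fintype.card R : ℝ)⁻¹ * ∑ i, avg f ((U : Matrix ι ι ℝ) * W i)) ∂haarO ι ∂haarO κ := by
        congr 1
        ext V
        obtain ⟨V', hV'⟩ := exists_O_mul_eq (isometry_mul hE (O_transpose_mul V)) hE
        rw [← integral_mul_right_eq_self (μ := haarO ι) (fun U : O ι =>
          Ψ ((Fintype.card R : ℝ)⁻¹ * ∑ i, avg f ((U : Matrix ι ι ℝ) * W i))) V']
        congr 1
        ext U
        simp only [hb]
        congr 2
        refine Finset.sum_congr rfl fun i _ => ?_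
        rw [← Matrix.mul_assoc E, ← hV', Matrix.mul_assoc (V' : Matrix ι ι ℝ), hEW,
          Submonoid.coe_mul, Matrix.mul_assoc]
    _ = _ := by simp

end Blocks

section OneDim

lemma exp_mul_sq_mul_pdf (t x : ℝ) :
    gaussianPDFReal 0 1 x * Real.exp (t * (x ^ 2 - 1)) =
      (Real.sqrt (2 * Real.pi))⁻¹ * Real.exp (-t) * Real.exp (-(1 / 2 - t) * x ^ 2) := by
  simp only [gaussianPDFReal, NNReal.coe_one, mul_one, sub_zero]
  rw [mul_assoc, mul_assoc, ← Real.exp_add, ← Real.exp_add]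
  congr 2
  ring

lemma integrable_exp_mul_sq {t : ℝ} (ht : t < 1 / 2) :
    Integrable (fun x : ℝ => Real.exp (t * (x ^ 2 - 1))) (gaussianReal 0 1) := by
  rw [gaussianReal_of_var_ne_zero _ one_ne_zero,
    integrable_withDensity_iff_integrable_smul' (by fun_prop)
      (Filter.Eventually.of_forall fun x => gaussianPDF_lt_top)]
  simp only [toReal_gaussianPDF, smul_eq_mul, exp_mul_sq_mul_pdf]
  exact (integrable_exp_neg_mul_sq (by linarith)).const_mul _

lemma one_le_mul_exp {x : ℝ} (hx : |x| ≤ 1 / 2) : 1 ≤ (1 - x) * Real.exp (x + x ^ 2) := by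
  obtain ⟨h1, h2⟩ := abs_le.1 hx
  rcases le_total x 0 with h | h
  · have := Real.add_one_le_exp (x + x ^ 2)
    have h3 : (1 - x) * (x + x ^ 2 + 1) ≤ (1 - x) * Real.exp (x + x ^ 2) := by
      gcongr; linarith
    have h4 : 0 ≤ (-x) ^ 3 := by have : 0 ≤ -x := by linarith
                                 positivity
    nlinarith
  · have h5 : 0 ≤ x + x ^ 2 := by positivity
    have := Real.quadratic_le_exp_of_nonneg h5
    have h3 : (1 - x) * (1 + (x + x ^ 2) + (x + x ^ 2) ^ 2 / 2) ≤ (1 - x) * Real.exp (x + x ^ 2) := by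
      gcongr; linarith
    have h4 : 0 ≤ x ^ 2 * ((1 - x) * (1 + x) ^ 2 / 2 - x) := by
      apply mul_nonneg (sq_nonneg _)
      nlinarith [mul_nonneg h (sub_nonneg.2 h2), mul_nonneg (mul_nonneg h h) (sub_nonneg.2 h2)]
    nlinarith

lemma integral_exp_mul_sq_le {t : ℝ} (ht : |t| ≤ 1 / 4) :
    ∫ x : ℝ, Real.exp (t * (x ^ 2 - 1)) ∂gaussianReal 0 1 ≤ Real.exp (2 * t ^ 2) := by
  obtain ⟨h1, h2⟩ := abs_le.1 ht
  rw [integral_gaussianReal_eq_integral_smul one_ne_zero]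
  simp only [smul_eq_mul, exp_mul_sq_mul_pdf]
  rw [integral_const_mul, integral_gaussian]
  have hpos : 0 < 1 - 2 * t := by linarith
  have h3 : Real.pi / (1 / 2 - t) = (2 * Real.pi) * (1 - 2 * t)⁻¹ := by
    rw [← div_eq_mul_inv, div_eq_div_iff (by linarith) hpos.ne']; ring
  have h4 : Real.sqrt (2 * Real.pi) ≠ 0 := (Real.sqrt_pos.2 (by positivity)).ne'
  rw [h3, Real.sqrt_mul (show (0 : ℝ) ≤ 2 * Real.pi by positivity) (1 - 2 * t)⁻¹]
  have h5 : (Real.sqrt (2 * Real.pi))⁻¹ * Real.exp (-t) *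
      (Real.sqrt (2 * Real.pi) * Real.sqrt (1 - 2 * t)⁻¹) = Real.exp (-t) * Real.sqrt (1 - 2 * t)⁻¹ := by
    field_simp
  rw [h5]
  have h6 := one_le_mul_exp (x := 2 * t) (by rw [abs_mul]; norm_num; linarith)
  refine le_of_sq_le_sq ?_ (Real.exp_pos _).le
  rw [mul_pow, Real.sq_sqrt (by positivity), ← div_eq_mul_inv, div_le_iff₀ hpos, ← Real.exp_nat_mul,
    ← Real.exp_nat_mul]
  have h7 : Real.exp ((2 : ℕ) * (2 * t ^ 2)) = Real.exp ((2 : ℕ) * -t) * Real.exp (2 * t + (2 * t) ^ 2) := by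
    rw [← Real.exp_add]; congr 1; push_cast; ring
  rw [h7]
  nlinarith [Real.exp_pos ((2 : ℕ) * -t)]

end OneDim

section Moments
variable {ι : Type*} [Fintype ι]

lemma integral_sq_gaussianReal : ∫ x : ℝ, x ^ 2 ∂gaussianReal 0 1 = 1 := by
  have h := variance_id_gaussianReal (μ := 0) (v := 1)
  rw [variance_of_integral_eq_zero (by fun_prop) (by simp)] at h
  simpa using h

lemma integrable_sq_gaussianReal : Integrable (fun x : ℝ => x ^ 2) (gaussianReal 0 1) :=
  (memLp_id_gaussianReal 2).integrable_sq

lemma measurePreserving_eval_gauss (a : ι) :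
    MeasurePreserving (fun x : ι → ℝ => x a) (gauss ι) (gaussianReal 0 1) :=
  measurePreserving_eval (fun _ : ι => gaussianReal 0 1) a

lemma integrable_sq_gauss (a : ι) : Integrable (fun x : ι → ℝ => x a ^ 2) (gauss ι) :=
  (measurePreserving_eval_gauss a).integrable_comp_of_integrable integrable_sq_gaussianReal

lemma integral_sq_gauss (a : ι) : ∫ x : ι → ℝ, x a ^ 2 ∂gauss ι = 1 := by
  rw [← integral_sq_gaussianReal, ← (measurePreserving_eval_gauss a).map_eq,
    integral_map (measurable_pi_apply a).aemeasurable (by fun_prop)]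

lemma integrable_mul_gauss (a b : ι) : Integrable (fun x : ι → ℝ => x a * x b) (gauss ι) := by
  refine ((integrable_sq_gauss a).add (integrable_sq_gauss b)).mono'
    (by fun_prop) (Filter.Eventually.of_forall fun x => ?_)
  simp only [Real.norm_eq_abs, Pi.add_apply]
  rw [abs_le]
  constructor <;> nlinarith [sq_nonneg (x a + x b), sq_nonneg (x a - x b)]

variable [DecidableEq ι]

lemma integral_mul_gauss {a b : ι} (hab : a ≠ b) : ∫ x : ι → ℝ, x a * x b ∂gauss ι = 0 := by
  have hV : (diagonal fun i : ι => if i = a then (-1 : ℝ) else 1)ᵀ *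
      (diagonal fun i : ι => if i = a then (-1 : ℝ) else 1) = 1 := by
    rw [diagonal_transpose, diagonal_mul_diagonal, ← diagonal_one]
    congr 1
    ext i
    split_ifs <;> norm_num
  have h := measurePreserving_gauss hV
  have h2 : ∫ x : ι → ℝ, x a * x b ∂gauss ι = ∫ x : ι → ℝ, -(x a * x b) ∂gauss ι := by
    conv_lhs => rw [← h.map_eq]
    rw [integral_map (by fun_prop) (by fun_prop)]
    simp [diagonal_transpose, mulVec_diagonal, hab.symm]
  rw [integral_neg] at h2
  linarith

lemma Homog.integrable_mul_mul {g : (ι → ℝ) → ℝ} (hg : Homog g) (a b : ι) :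
    Integrable (fun x : ι → ℝ => x a * x b * g x) (gauss ι) := by
  obtain ⟨C, hC⟩ := hg.bdd
  exact (integrable_mul_gauss a b).mul_bdd (c := C) hg.meas.aestronglyMeasurable
    (Filter.Eventually.of_forall fun x => hC x)

/-- The total second moment of a degree-zero homogeneous density. -/
lemma Homog.sum_integral_sq [Nonempty ι] {g : (ι → ℝ) → ℝ} (hg : Homog g) :
    ∑ a, ∫ x : ι → ℝ, x a * x a * g x ∂gauss ι = Fintype.card ι * ∫ x, g x ∂gauss ι := by
  have hw : Integrable (fun x : ι → ℝ => ∑ a, x a * x a) (gauss ι) :=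
    integrable_finsetSum _ fun a _ => integrable_mul_gauss a a
  have h := hg.integral_mul_invariant (gauss ι) (gauss_singleton 0) measurePreserving_gauss_O
    (w := fun x => ∑ a, x a * x a) (by fun_prop) hw
    (fun V x => dotProduct_mulVec_self (O_transpose_mul V) x x)
  rw [integral_finsetSum _ fun a _ => integrable_mul_gauss a a] at h
  simp only [← pow_two, integral_sq_gauss] at h
  simp only [← pow_two]
  simp only [Finset.sum_const, Finset.card_univ, nsmul_eq_mul, mul_one] at h
  rw [← h, ← integral_finsetSum _ fun a _ => by simpa only [← pow_two] using hg.integrable_mul_mul a a]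
  simp only [Finset.mul_sum, mul_comm]

end Moments

section LevelTwo
variable {ι : Type*} [Fintype ι]

lemma integrable_exp_sum {t : ι → ℝ} (ht : ∀ i, t i < 1 / 2) :
    Integrable (fun x : ι → ℝ => Real.exp (∑ i, t i * (x i ^ 2 - 1))) (gauss ι) := by
  simp only [Real.exp_sum]
  exact Integrable.fintype_prod (f := fun i (x : ℝ) => Real.exp (t i * (x ^ 2 - 1)))
    fun i => integrable_exp_mul_sq (ht i)

lemma integral_exp_sum_le {t : ι → ℝ} (ht : ∀ i, |t i| ≤ 1 / 4) :
    ∫ x : ι → ℝ, Real.exp (∑ i, t i * (x i ^ 2 - 1)) ∂gauss ι ≤ Real.exp (2 * ∑ i, t i ^ 2) := by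
  simp only [Real.exp_sum]
  have h := integral_fintype_prod_eq_prod (μ := fun _ : ι => gaussianReal 0 1)
    (fun i (x : ℝ) => Real.exp (t i * (x ^ 2 - 1)))
  refine h.le.trans ?_
  rw [Finset.mul_sum, Real.exp_sum]
  exact Finset.prod_le_prod (fun i _ => integral_nonneg fun x => (Real.exp_pos _).le)
    fun i _ => integral_exp_mul_sq_le (ht i)

/-- Level-two inequality, in linear form. -/
lemma sum_mul_le {g : (ι → ℝ) → ℝ} (hgm : Measurable g) {hi Z L : ℝ} (h0 : ∀ x, 0 ≤ g x)
    (hhi : ∀ x, g x ≤ hi) (hZ : ∫ x, g x ∂gauss ι = Z) (hZ0 : 0 < Z) (hL : hi ≤ Real.exp L * Z)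
    {t : ι → ℝ} (ht : ∀ i, |t i| ≤ 1 / 4) :
    ∑ i, t i * ((∫ x : ι → ℝ, x i * x i * g x ∂gauss ι) / Z - 1) ≤ L + 2 * ∑ i, t i ^ 2 := by
  obtain ⟨a, ha⟩ : ∃ a, a = ∑ i, t i * ((∫ x : ι → ℝ, x i * x i * g x ∂gauss ι) / Z - 1) := ⟨_, rfl⟩
  have hbd : ∀ x, ‖g x‖ ≤ hi := fun x => by
    rw [Real.norm_eq_abs, abs_of_nonneg (h0 x)]; exact hhi x
  have hg : Integrable g (gauss ι) :=
    Integrable.of_bound hgm.aestronglyMeasurable hi (Filter.Eventually.of_forall hbd)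
  have hsq : ∀ i, Integrable (fun x : ι → ℝ => x i * x i * g x) (gauss ι) := fun i =>
    (integrable_mul_gauss i i).mul_bdd (c := hi) hgm.aestronglyMeasurable
      (Filter.Eventually.of_forall hbd)
  have hlin : ∀ i, Integrable (fun x : ι → ℝ => t i * (x i * x i * g x - g x)) (gauss ι) :=
    fun i => ((hsq i).sub hg).const_mul _
  have hX : ∫ x : ι → ℝ, ∑ i, t i * (x i * x i * g x - g x) ∂gauss ι = a * Z := by
    rw [integral_finsetSum _ fun i _ => hlin i, ha, Finset.sum_mul]
    refine Finset.sum_congr rfl fun i _ => ?_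
    rw [integral_const_mul, integral_sub (hsq i) hg, hZ]
    field_simp
  have hexp := integrable_exp_sum (t := t) fun i => by
    have := (abs_le.1 (ht i)).2; linarith
  have key : ∫ x : ι → ℝ, (Real.exp a * ((∑ i, t i * (x i * x i * g x - g x)) + (1 - a) * g x)) ∂gauss ι
      ≤ ∫ x : ι → ℝ, hi * Real.exp (∑ i, t i * (x i ^ 2 - 1)) ∂gauss ι := by
    refine integral_mono (((integrable_finsetSum _ fun i _ => hlin i).add
      (hg.const_mul _)).const_mul _) (hexp.const_mul _) fun x => ?_
    have h1 : ∑ i, t i * (x i * x i * g x - g x) = (∑ i, t i * (x i ^ 2 - 1)) * g x := by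
      rw [Finset.sum_mul]; exact Finset.sum_congr rfl fun i _ => by ring
    obtain ⟨X, hXd⟩ : ∃ X, X = ∑ i, t i * (x i ^ 2 - 1) := ⟨_, rfl⟩
    have h2 : Real.exp a * (X - a + 1) ≤ Real.exp X := by
      calc Real.exp a * (X - a + 1) ≤ Real.exp a * Real.exp (X - a) := by
            gcongr; exact Real.add_one_le_exp _
        _ = Real.exp X := by rw [← Real.exp_add]; congr 1; ring
    simp only [h1, ← hXd]
    calc Real.exp a * (X * g x + (1 - a) * g x) = Real.exp a * (X - a + 1) * g x := by ring
      _ ≤ Real.exp X * g x := mul_le_mul_of_nonneg_right h2 (h0 x)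
      _ ≤ Real.exp X * hi := mul_le_mul_of_nonneg_left (hhi x) (Real.exp_pos _).le
      _ = hi * Real.exp X := mul_comm _ _
  have hsum := integrable_finsetSum Finset.univ fun i _ => hlin i
  rw [integral_const_mul, integral_add hsum (hg.const_mul _),
    hX, integral_const_mul, hZ, integral_const_mul] at key
  have hi0 : 0 ≤ hi := (h0 0).trans (hhi 0)
  have h3 : Real.exp a * Z ≤ Real.exp (L + 2 * ∑ i, t i ^ 2) * Z := by
    calc Real.exp a * Z = Real.exp a * (a * Z + (1 - a) * Z) := by ring
      _ ≤ hi * Real.exp (2 * ∑ i, t i ^ 2) :=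
          key.trans (mul_le_mul_of_nonneg_left (integral_exp_sum_le ht) hi0)
      _ ≤ (Real.exp L * Z) * Real.exp (2 * ∑ i, t i ^ 2) :=
          mul_le_mul_of_nonneg_right hL (Real.exp_pos _).le
      _ = _ := by rw [Real.exp_add]; ring
  rw [← ha]
  exact Real.exp_le_exp.1 (le_of_mul_le_mul_right h3 hZ0)

/-- Level-two inequality: the diagonal second moments of a bounded density are close to `1`. -/
lemma sum_sq_second_moment_le {g : (ι → ℝ) → ℝ} (hgm : Measurable g) {hi Z L : ℝ}
    (h0 : ∀ x, 0 ≤ g x) (hhi : ∀ x, g x ≤ hi) (hZ : ∫ x, g x ∂gauss ι = Z) (hZ0 : 0 < Z)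
    (hL0 : 0 ≤ L) (hL : hi ≤ Real.exp L * Z) :
    ∑ i, ((∫ x : ι → ℝ, x i * x i * g x ∂gauss ι) / Z - 1) ^ 2 ≤ (4 * L + 1) ^ 2 := by
  obtain ⟨δ, hδ⟩ : ∃ δ : ι → ℝ, ∀ i, δ i = (∫ x : ι → ℝ, x i * x i * g x ∂gauss ι) / Z - 1 :=
    ⟨_, fun _ => rfl⟩
  simp only [← hδ]
  obtain ⟨N, hN⟩ : ∃ N, N = Real.sqrt (∑ i, δ i ^ 2) := ⟨_, rfl⟩
  have hs : 0 ≤ ∑ i, δ i ^ 2 := Finset.sum_nonneg fun i _ => sq_nonneg _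
  have hN2 : N ^ 2 = ∑ i, δ i ^ 2 := by rw [hN, Real.sq_sqrt hs]
  have hN0 : 0 ≤ N := hN ▸ Real.sqrt_nonneg _
  rcases hN0.eq_or_lt with h | h
  · rw [← hN2, ← h, zero_pow two_ne_zero]; positivity
  have h1 := sum_mul_le hgm h0 hhi hZ hZ0 hL (t := fun i => δ i / (4 * N)) fun i => by
    rw [abs_div, abs_of_pos (by positivity : 0 < 4 * N), div_le_div_iff₀ (by positivity) (by norm_num)]
    have : |δ i| ≤ N := by
      rw [hN]
      exact Real.abs_le_sqrt (Finset.single_le_sum (f := fun i => δ i ^ 2)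
        (fun i _ => sq_nonneg _) (Finset.mem_univ i))
    linarith
  simp only [← hδ, div_pow] at h1
  rw [← Finset.sum_div, ← hN2] at h1
  have h2 : ∑ i, δ i / (4 * N) * δ i = N / 4 := by
    rw [show N / 4 = N ^ 2 / (4 * N) by field_simp, hN2, Finset.sum_div]
    exact Finset.sum_congr rfl fun i _ => by ring
  rw [h2, show N ^ 2 / (4 * N) ^ 2 = 1 / 16 by field_simp; norm_num] at h1
  rw [← hN2]
  exact pow_le_pow_left₀ hN0 (by linarith) 2

end LevelTwo

section DetSq
variable {ι : Type*} [Fintype ι] [DecidableEq ι]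

lemma det_sq_mul_prod (S : ι → ι → ℝ) (h : ι → (ι → ℝ) → ℝ) :
    (of S).det ^ 2 * ∏ i, h i (S i) =
      ∑ σ : Equiv.Perm ι, ∑ τ : Equiv.Perm ι, ((Equiv.Perm.sign σ : ℤ) : ℝ) *
        ((Equiv.Perm.sign τ : ℤ) : ℝ) * ∏ i, (S i (σ i) * S i (τ i) * h i (S i)) := by
  have h1 : (of S).det = ∑ σ : Equiv.Perm ι, ((Equiv.Perm.sign σ : ℤ) : ℝ) * ∏ i, S i (σ i) := by
    rw [← det_transpose, det_apply']; rfl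
  rw [pow_two, h1, Finset.sum_mul_sum, Finset.sum_mul]
  refine Finset.sum_congr rfl fun σ _ => ?_
  rw [Finset.sum_mul]
  refine Finset.sum_congr rfl fun τ _ => ?_
  simp only [Finset.prod_mul_distrib]
  ring

lemma integrable_det_sq_mul_prod {h : ι → (ι → ℝ) → ℝ}
    (hint : ∀ i a b, Integrable (fun x : ι → ℝ => x a * x b * h i x) (gauss ι)) :
    Integrable (fun S : ι → ι → ℝ => (of S).det ^ 2 * ∏ i, h i (S i))
      (Measure.pi fun _ : ι => gauss ι) := by
  simp only [det_sq_mul_prod]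
  exact integrable_finsetSum _ fun σ _ => integrable_finsetSum _ fun τ _ =>
    (Integrable.fintype_prod (f := fun i x => x (σ i) * x (τ i) * h i x)
      fun i => hint i _ _).const_mul _

/-- Expansion of a squared determinant of independent rows with diagonal second moments. -/
lemma integral_det_sq_mul_prod {h : ι → (ι → ℝ) → ℝ}
    (hint : ∀ i a b, Integrable (fun x : ι → ℝ => x a * x b * h i x) (gauss ι))
    (hdiag : ∀ i a b, a ≠ b → ∫ x : ι → ℝ, x a * x b * h i x ∂gauss ι = 0) :
    ∫ S : ι → ι → ℝ, (of S).det ^ 2 * ∏ i, h i (S i) ∂(Measure.pi fun _ : ι => gauss ι) =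
      ∑ σ : Equiv.Perm ι, ∏ i, ∫ x : ι → ℝ, x (σ i) * x (σ i) * h i x ∂gauss ι := by
  simp only [det_sq_mul_prod]
  have hI : ∀ σ τ : Equiv.Perm ι, Integrable (fun S : ι → ι → ℝ => ((Equiv.Perm.sign σ : ℤ) : ℝ) *
        ((Equiv.Perm.sign τ : ℤ) : ℝ) * ∏ i, (S i (σ i) * S i (τ i) * h i (S i)))
        (Measure.pi fun _ : ι => gauss ι) := fun σ τ =>
    (Integrable.fintype_prod (f := fun i x => x (σ i) * x (τ i) * h i x)
      fun i => hint i _ _).const_mul _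
  rw [integral_finsetSum _ fun σ _ => integrable_finsetSum _ fun τ _ => hI σ τ]
  refine Finset.sum_congr rfl fun σ _ => ?_
  rw [integral_finsetSum _ fun τ _ => hI σ τ, Finset.sum_eq_single σ]
  · rw [integral_const_mul]
    have := integral_fintype_prod_eq_prod (μ := fun _ : ι => gauss ι)
      (fun i (x : ι → ℝ) => x (σ i) * x (σ i) * h i x)
    rw [this, ← Int.cast_mul, ← Units.val_mul, Int.units_mul_self]
    simp
  · intro τ _ hτ
    rw [integral_const_mul]
    have := integral_fintype_prod_eq_prod (μ := fun _ : ι => gauss ι)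
      (fun i (x : ι → ℝ) => x (σ i) * x (τ i) * h i x)
    rw [this]
    obtain ⟨i, hi⟩ : ∃ i, σ i ≠ τ i := by
      by_contra! hc
      exact hτ (Equiv.ext fun i => (hc i).symm)
    rw [Finset.prod_eq_zero (Finset.mem_univ i) (hdiag i _ _ hi), mul_zero]
  · simp

lemma prod_ite_one {X : Type*} (s : Finset ι) (g : X → ℝ) (S : ι → X) :
    ∏ i, (if i ∈ s then g else fun _ => 1) (S i) = ∏ i ∈ s, g (S i) := by
  rw [← Finset.prod_subset (Finset.subset_univ s)]
  · exact Finset.prod_congr rfl fun i hi => by rw [if_pos hi]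
  · intro i _ hi; rw [if_neg hi]

lemma integrable_mul_mul_ite {g : (ι → ℝ) → ℝ} (hg : Homog g) (s : Finset ι) (i a b : ι) :
    Integrable (fun x : ι → ℝ => x a * x b * (if i ∈ s then g else fun _ => 1) x) (gauss ι) := by
  by_cases h : i ∈ s
  · simpa only [if_pos h] using hg.integrable_mul_mul a b
  · simpa only [if_neg h, mul_one] using integrable_mul_gauss a b

lemma integrable_det_sq_mul {g : (ι → ℝ) → ℝ} (hg : Homog g) (s : Finset ι) :
    Integrable (fun S : ι → ι → ℝ => (of S).det ^ 2 * ∏ i ∈ s, g (S i))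
      (Measure.pi fun _ : ι => gauss ι) := by
  simpa only [prod_ite_one] using integrable_det_sq_mul_prod (integrable_mul_mul_ite hg s)

lemma integral_det_sq_mul_of_diag {g : (ι → ℝ) → ℝ} (hg : Homog g) (s : Finset ι)
    (hdiag : ∀ a b, a ≠ b → ∫ x : ι → ℝ, x a * x b * g x ∂gauss ι = 0) :
    ∫ S : ι → ι → ℝ, (of S).det ^ 2 * ∏ i ∈ s, g (S i) ∂(Measure.pi fun _ : ι => gauss ι) =
      permSum (fun a => ∫ x : ι → ℝ, x a * x a * g x ∂gauss ι) s := by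
  have h := integral_det_sq_mul_prod (integrable_mul_mul_ite hg s) (fun i a b hab => by
    by_cases h : i ∈ s
    · simpa only [if_pos h] using hdiag a b hab
    · simpa only [if_neg h, mul_one] using integral_mul_gauss hab)
  simp only [prod_ite_one] at h
  rw [h, permSum]
  refine Finset.sum_congr rfl fun σ _ => ?_
  rw [← Finset.prod_subset (Finset.subset_univ s)]
  · exact Finset.prod_congr rfl fun i hi => by simp only [if_pos hi]
  · intro i _ hi
    simp only [if_neg hi, mul_one, ← pow_two, integral_sq_gauss]

lemma integral_det_sq : ∫ S : ι → ι → ℝ, (of S).det ^ 2 ∂(Measure.pi fun _ : ι => gauss ι) =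
    (Fintype.card ι).factorial := by
  have hg : Homog (fun _ : ι → ℝ => (1 : ℝ)) := ⟨measurable_const, fun _ _ _ => rfl, 1, by simp⟩
  have h := integral_det_sq_mul_of_diag hg ∅ (fun a b hab => by simpa using integral_mul_gauss hab)
  simpa [permSum, Fintype.card_perm] using h

/-- Rotating all rows leaves the squared determinant integral unchanged. -/
lemma integral_det_sq_mul_comp (g : (ι → ℝ) → ℝ) (hgm : Measurable g) (s : Finset ι) (V : O ι) :
    ∫ S : ι → ι → ℝ, (of S).det ^ 2 * ∏ i ∈ s, g ((V : Matrix ι ι ℝ) *ᵥ S i)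
      ∂(Measure.pi fun _ : ι => gauss ι) =
    ∫ S : ι → ι → ℝ, (of S).det ^ 2 * ∏ i ∈ s, g (S i) ∂(Measure.pi fun _ : ι => gauss ι) := by
  have hp : MeasurePreserving (fun (S : ι → ι → ℝ) i => (V : Matrix ι ι ℝ) *ᵥ S i)
      (Measure.pi fun _ : ι => gauss ι) (Measure.pi fun _ : ι => gauss ι) :=
    measurePreserving_pi _ _ fun _ => measurePreserving_gauss_O V
  have hm : Measurable fun S : ι → ι → ℝ => (of S).det ^ 2 * ∏ i ∈ s, g (S i) := by
    refine Measurable.mul (Measurable.pow_const ?_ _) (Finset.measurable_prod _ fun i _ =>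
      hgm.comp (measurable_pi_apply i))
    simp only [det_apply']
    refine Finset.measurable_sum _ fun σ _ => Measurable.const_mul (Finset.measurable_prod _
      fun i _ => ?_) _
    simp only [of_apply]
    fun_prop
  conv_rhs => rw [← hp.map_eq]
  rw [integral_map hp.measurable.aemeasurable hm.aestronglyMeasurable]
  congr 1
  ext S
  have h1 : (of fun i => (V : Matrix ι ι ℝ) *ᵥ S i) = of S * (V : Matrix ι ι ℝ)ᵀ := by
    ext i j
    simp [mul_apply, mulVec, dotProduct, mul_comm]
  have h2 : (V : Matrix ι ι ℝ)ᵀ.det ^ 2 = 1 := by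
    have := congrArg Matrix.det (O_transpose_mul V)
    rw [det_mul, det_one, det_transpose] at this
    rw [det_transpose, pow_two, this]
  rw [h1, det_mul, mul_pow, h2, mul_one]

lemma exists_diagonalize {g : (ι → ℝ) → ℝ} (hg : Homog g) :
    ∃ V : O ι, ∀ a b, a ≠ b →
      ∫ x : ι → ℝ, x a * x b * g ((V : Matrix ι ι ℝ) *ᵥ x) ∂gauss ι = 0 := by
  obtain ⟨M, hM⟩ : ∃ M : Matrix ι ι ℝ, ∀ a b, M a b = ∫ x : ι → ℝ, x a * x b * g x ∂gauss ι :=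
    ⟨of fun a b => ∫ x : ι → ℝ, x a * x b * g x ∂gauss ι, fun _ _ => rfl⟩
  have hMs : M.IsHermitian := by
    ext a b
    simp only [conjTranspose_apply, hM, star_trivial]
    congr 1; ext x; ring
  obtain ⟨V, D, hV⟩ : ∃ (V : O ι) (D : ι → ℝ),
      (V : Matrix ι ι ℝ)ᵀ * M * (V : Matrix ι ι ℝ) = diagonal D := by
    refine ⟨hMs.eigenvectorUnitary, hMs.eigenvalues, ?_⟩
    have := hMs.conjStarAlgAut_star_eigenvectorUnitary
    rw [Unitary.conjStarAlgAut_star_apply] at this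
    exact this
  refine ⟨V, fun a b hab => ?_⟩
  have h1 : ∫ x : ι → ℝ, x a * x b * g ((V : Matrix ι ι ℝ) *ᵥ x) ∂gauss ι =
      ∫ x : ι → ℝ, ((V : Matrix ι ι ℝ)ᵀ *ᵥ x) a * ((V : Matrix ι ι ℝ)ᵀ *ᵥ x) b * g x ∂gauss ι := by
    have hp := measurePreserving_gauss_O V
    conv_rhs => rw [← hp.map_eq]
    rw [integral_map hp.measurable.aemeasurable]
    · simp only [mulVec_mulVec, O_transpose_mul, one_mulVec]
    · refine (Measurable.mul (Measurable.mul ?_ ?_) hg.meas).aestronglyMeasurable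
      · exact (measurable_pi_apply a).comp (measurable_mulVec _)
      · exact (measurable_pi_apply b).comp (measurable_mulVec _)
  have h2 : ∀ x : ι → ℝ, ((V : Matrix ι ι ℝ)ᵀ *ᵥ x) a * ((V : Matrix ι ι ℝ)ᵀ *ᵥ x) b * g x =
      ∑ c, ∑ e, (V : Matrix ι ι ℝ) c a * (V : Matrix ι ι ℝ) e b * (x c * x e * g x) := by
    intro x
    simp only [mulVec, dotProduct, transpose_apply]
    rw [Finset.sum_mul_sum, Finset.sum_mul]
    refine Finset.sum_congr rfl fun c _ => ?_
    rw [Finset.sum_mul]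
    exact Finset.sum_congr rfl fun e _ => by ring
  have hI : ∀ c e, Integrable (fun x : ι → ℝ =>
      (V : Matrix ι ι ℝ) c a * (V : Matrix ι ι ℝ) e b * (x c * x e * g x)) (gauss ι) :=
    fun c e => (hg.integrable_mul_mul c e).const_mul _
  rw [h1]
  simp only [h2]
  rw [integral_finsetSum _ fun c _ => integrable_finsetSum _ fun e _ => hI c e]
  have h3 : ((V : Matrix ι ι ℝ)ᵀ * M * (V : Matrix ι ι ℝ)) a b = 0 := by
    rw [hV, diagonal_apply_ne _ hab]
  rw [← h3, Matrix.mul_assoc, mul_apply]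
  refine Finset.sum_congr rfl fun c _ => ?_
  rw [integral_finsetSum _ fun e _ => hI c e, mul_apply, Finset.mul_sum]
  refine Finset.sum_congr rfl fun e _ => ?_
  rw [integral_const_mul, hM, transpose_apply]
  ring

/-- Lower bound for the expected squared determinant reweighted by a bounded density. -/
lemma integral_det_sq_mul_ge [Nonempty ι] {g : (ι → ℝ) → ℝ} (hg : Homog g) {hi Z L : ℝ}
    (h0 : ∀ x, 0 ≤ g x) (hhi : ∀ x, g x ≤ hi) (hZ : ∫ x, g x ∂gauss ι = Z) (hZ0 : 0 < Z)
    (hL0 : 0 ≤ L) (hL : hi ≤ Real.exp L * Z) {p : ℕ} {u : ℝ} (hp : 8 * (p : ℝ) ≤ Fintype.card ι)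
    (hu0 : 0 ≤ u) (hu : u ≤ 1 / 2)
    (h : 16 * p * ((4 * L + 1) ^ 2 + p) ≤ u * (Fintype.card ι : ℝ) ^ 2)
    (s : Finset ι) (hs : s.card ≤ p) :
    (1 - u) ^ s.card * (Fintype.card ι).factorial * Z ^ s.card ≤
      ∫ S : ι → ι → ℝ, (of S).det ^ 2 * ∏ i ∈ s, g (S i) ∂(Measure.pi fun _ : ι => gauss ι) := by
  obtain ⟨V, hV⟩ := exists_diagonalize hg
  have hg' := hg.comp_mulVec (V : Matrix ι ι ℝ)
  have hZ' : ∫ x : ι → ℝ, g ((V : Matrix ι ι ℝ) *ᵥ x) ∂gauss ι = Z := by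
    rw [← hZ]
    have hp := measurePreserving_gauss_O V
    conv_rhs => rw [← hp.map_eq]
    rw [integral_map hp.measurable.aemeasurable hg.meas.aestronglyMeasurable]
  rw [← integral_det_sq_mul_comp g hg.meas s V, integral_det_sq_mul_of_diag hg' s hV]
  have hlev := sum_sq_second_moment_le hg'.meas (fun x => h0 _) (fun x => hhi _) hZ' hZ0 hL0 hL
  obtain ⟨lam, hlam⟩ : ∃ lam : ι → ℝ, ∀ a,
      lam a = (∫ x : ι → ℝ, x a * x a * g ((V : Matrix ι ι ℝ) *ᵥ x) ∂gauss ι) / Z :=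
    ⟨_, fun _ => rfl⟩
  have hlam' : ∀ a, ∫ x : ι → ℝ, x a * x a * g ((V : Matrix ι ι ℝ) *ᵥ x) ∂gauss ι = Z * lam a :=
    fun a => by rw [hlam]; field_simp
  have hps : permSum (fun a => Z * lam a) s = Z ^ s.card * permSum lam s := by
    simp only [permSum, Finset.prod_mul_distrib, Finset.prod_const, Finset.mul_sum]
  simp only [hlam']
  rw [hps]
  have hge := permSum_ge (x := lam) (fun a => by
      rw [hlam]
      exact div_nonneg (integral_nonneg fun x => mul_nonneg (mul_self_nonneg _) (h0 _)) hZ0.le)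
    (by
      have := hg'.sum_integral_sq
      simp only [hlam', hZ', ← Finset.mul_sum] at this
      rw [mul_comm] at this
      exact mul_right_cancel₀ hZ0.ne' this)
    (by simpa only [hlam] using hlev) hp hu0 hu h s hs
  rw [mul_comm]
  exact mul_le_mul_of_nonneg_left hge (by positivity)

end DetSq

section PiDensity
variable {κ : Type*} [Fintype κ]

lemma pi_withDensity_ofReal {X : Type*} [MeasurableSpace X] (μ : Measure X) [SigmaFinite μ]
    {r : X → ℝ} (h0 : ∀ x, 0 ≤ r x) (hr : Integrable r μ) :
    Measure.pi (fun _ : κ => μ.withDensity fun x => ENNReal.ofReal (r x)) =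
      (Measure.pi fun _ : κ => μ).withDensity fun x => ENNReal.ofReal (∏ i, r (x i)) := by
  have hfin : IsFiniteMeasure (μ.withDensity fun x => ENNReal.ofReal (r x)) :=
    isFiniteMeasure_withDensity_ofReal hr.2
  refine Measure.pi_eq fun s hs => ?_
  rw [withDensity_apply _ (MeasurableSet.univ_pi hs), ← lintegral_indicator (MeasurableSet.univ_pi hs)]
  have h1 : ∀ x : κ → X, (Set.univ.pi s).indicator (fun x => ENNReal.ofReal (∏ i, r (x i))) x =
      ENNReal.ofReal (∏ i, (s i).indicator r (x i)) := by
    intro x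
    by_cases hx : x ∈ Set.univ.pi s
    · rw [Set.indicator_of_mem hx]
      congr 1
      exact Finset.prod_congr rfl fun i _ => (Set.indicator_of_mem (hx i trivial) _).symm
    · rw [Set.indicator_of_notMem hx]
      obtain ⟨i, hi⟩ : ∃ i, x i ∉ s i := by simpa [Set.mem_pi] using hx
      rw [Finset.prod_eq_zero (Finset.mem_univ i) (Set.indicator_of_notMem hi _), ENNReal.ofReal_zero]
  have hI : ∀ i, Integrable ((s i).indicator r) μ := fun i => hr.indicator (hs i)
  have hn : ∀ i x, 0 ≤ (s i).indicator r x := fun i x => Set.indicator_nonneg (fun x _ => h0 x) x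
  simp only [h1]
  rw [← ofReal_integral_eq_lintegral_ofReal (Integrable.fintype_prod hI)
    (Filter.Eventually.of_forall fun x => Finset.prod_nonneg fun i _ => hn i _),
    integral_fintype_prod_eq_prod (μ := fun _ : κ => μ),
    ENNReal.ofReal_prod_of_nonneg fun i _ => integral_nonneg (hn i)]
  refine Finset.prod_congr rfl fun i _ => ?_
  rw [ofReal_integral_eq_lintegral_ofReal (hI i) (Filter.Eventually.of_forall (hn i)),
    withDensity_apply _ (hs i), ← lintegral_indicator (hs i)]
  congr 1
  ext x
  by_cases hx : x ∈ s i <;> simp [hx]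

/-- The density of `gauss` with respect to Lebesgue measure. -/
noncomputable def gaussDensity (x : κ → ℝ) : ℝ := ∏ i, gaussianPDFReal 0 1 (x i)

lemma gaussDensity_nonneg (x : κ → ℝ) : 0 ≤ gaussDensity x :=
  Finset.prod_nonneg fun _ _ => gaussianPDFReal_nonneg _ _ _

lemma measurable_gaussDensity : Measurable (gaussDensity : (κ → ℝ) → ℝ) :=
  Finset.measurable_prod _ fun i _ => (measurable_gaussianPDFReal 0 1).comp (measurable_pi_apply i)

lemma gauss_eq_withDensity :
    gauss κ = (volume : Measure (κ → ℝ)).withDensity fun x => ENNReal.ofReal (gaussDensity x) := by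
  have h := pi_withDensity_ofReal (κ := κ) (volume : Measure ℝ)
    (gaussianPDFReal_nonneg 0 1) (integrable_gaussianPDFReal 0 1)
  rw [gauss, gaussianReal_of_var_ne_zero _ one_ne_zero]
  exact h

lemma gaussDensity_eq (x : κ → ℝ) :
    gaussDensity x = (Real.sqrt (2 * Real.pi))⁻¹ ^ Fintype.card κ * Real.exp (-(x ⬝ᵥ x) / 2) := by
  simp only [gaussDensity, gaussianPDFReal, NNReal.coe_one, mul_one, sub_zero,
    Finset.prod_mul_distrib, Finset.prod_const, Finset.card_univ, ← Real.exp_sum]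
  congr 2
  rw [dotProduct, ← Finset.sum_neg_distrib, Finset.sum_div]
  exact Finset.sum_congr rfl fun i _ => by ring

lemma lintegral_gauss {Φ : (κ → ℝ) → ℝ≥0∞} (hΦ : Measurable Φ) :
    ∫⁻ x, Φ x ∂gauss κ = ∫⁻ x, ENNReal.ofReal (gaussDensity x) * Φ x := by
  rw [gauss_eq_withDensity, lintegral_withDensity_eq_lintegral_mul _
    measurable_gaussDensity.ennreal_ofReal hΦ]
  rfl

variable [DecidableEq κ]

lemma lintegral_volume_mulVec {M : Matrix κ κ ℝ} (hM : M.det ≠ 0) {Φ : (κ → ℝ) → ℝ≥0∞}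
    (hΦ : Measurable Φ) : ∫⁻ x, Φ x = ENNReal.ofReal |M.det| * ∫⁻ x, Φ (M *ᵥ x) := by
  have h := Real.map_matrix_volume_pi_eq_smul_volume_pi hM
  have h2 : ∫⁻ x, Φ (M *ᵥ x) = ENNReal.ofReal |M.det⁻¹| * ∫⁻ x, Φ x := by
    rw [← smul_eq_mul, ← lintegral_smul_measure, ← h,
      lintegral_map hΦ (show Measurable (toLin' M) from measurable_mulVec M)]
    rfl
  rw [h2, ← mul_assoc, ← ENNReal.ofReal_mul (abs_nonneg _), ← abs_mul, mul_inv_cancel₀ hM]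
  simp

lemma lintegral_gauss_mulVec {M : Matrix κ κ ℝ} (hM : M.det ≠ 0) {Φ : (κ → ℝ) → ℝ≥0∞}
    (hΦ : Measurable Φ) :
    ∫⁻ x, Φ x ∂gauss κ = ∫⁻ a, ENNReal.ofReal |M.det| *
      (ENNReal.ofReal (gaussDensity (M *ᵥ a)) * Φ (M *ᵥ a)) := by
  have hm := measurable_gaussDensity.ennreal_ofReal.mul hΦ
  rw [lintegral_gauss hΦ]
  refine Eq.trans ?_ (lintegral_const_mul _ (hm.comp (measurable_mulVec M))).symm
  exact lintegral_volume_mulVec hM hm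

lemma measurable_det : Measurable fun S : κ → κ → ℝ => (of S).det := by
  simp only [det_apply']
  refine Finset.measurable_sum _ fun σ _ => Measurable.const_mul (Finset.measurable_prod _
    fun i _ => ?_) _
  simp only [of_apply]
  fun_prop

lemma ae_det_ne_zero : ∀ᵐ S : κ → κ → ℝ ∂(Measure.pi fun _ : κ => gauss κ), (of S).det ≠ 0 := by
  have hms : MeasurableSet {S : κ → κ → ℝ | (of S).det = 0} :=
    measurable_det (measurableSet_singleton 0)
  have hac : (Measure.pi fun _ : κ => gauss κ) ≪ (volume : Measure (κ → κ → ℝ)) := by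
    have h : Integrable (gaussDensity : (κ → ℝ) → ℝ) volume :=
      Integrable.fintype_prod (f := fun _ : κ => gaussianPDFReal 0 1)
        fun _ => integrable_gaussianPDFReal 0 1
    rw [gauss_eq_withDensity, pi_withDensity_ofReal _ gaussDensity_nonneg h]
    exact withDensity_absolutelyContinuous _ _
  refine hac.ae_le ?_
  change volume {S : κ → κ → ℝ | (of S).det ≠ 0}ᶜ = 0
  rw [show {S : κ → κ → ℝ | (of S).det ≠ 0}ᶜ = {S | (of S).det = 0} by ext; simp]
  have hline : ∀ S : κ → κ → ℝ, volume {t : ℝ | (of (S + fun i j => t * (1 : Matrix κ κ ℝ) i j)).det = 0} = 0 := by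
    intro S
    refine Set.Finite.measure_zero (Set.Finite.subset
      ((-(of S)).charpoly.roots.toFinset.finite_toSet) fun t ht => ?_) _
    rw [Finset.mem_coe, Multiset.mem_toFinset, Polynomial.mem_roots (charpoly_monic _).ne_zero,
      Polynomial.IsRoot, eval_charpoly]
    rw [← (show _ = (0 : ℝ) from ht)]
    congr 1
    ext i j
    simp [scalar_apply, diagonal_apply, one_apply, add_comm]
  have hm2 : MeasurableSet {q : (κ → κ → ℝ) × ℝ |
      (of (q.1 + fun i j => q.2 * (1 : Matrix κ κ ℝ) i j)).det = 0} := by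
    refine (measurable_det.comp (g := fun S => (of S).det)
      (f := fun q : (κ → κ → ℝ) × ℝ => q.1 + fun i j => q.2 * (1 : Matrix κ κ ℝ) i j) ?_)
      (measurableSet_singleton 0)
    fun_prop
  have h1 : ((volume : Measure (κ → κ → ℝ)).prod (volume : Measure ℝ)) {q : (κ → κ → ℝ) × ℝ |
      (of (q.1 + fun i j => q.2 * (1 : Matrix κ κ ℝ) i j)).det = 0} = 0 := by
    rw [Measure.measure_prod_null hm2]
    exact Filter.Eventually.of_forall hline
  have h2 := Measure.prod_apply_symm (μ := (volume : Measure (κ → κ → ℝ))) (ν := (volume : Measure ℝ)) hm2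
  rw [h1] at h2
  have h3 : ∀ t : ℝ, volume ((fun S : κ → κ → ℝ => (S, t)) ⁻¹' {q : (κ → κ → ℝ) × ℝ |
      (of (q.1 + fun i j => q.2 * (1 : Matrix κ κ ℝ) i j)).det = 0}) =
      volume {S : κ → κ → ℝ | (of S).det = 0} := by
    intro t
    exact measure_preimage_add_right volume (fun i j => t * (1 : Matrix κ κ ℝ) i j)
      {S : κ → κ → ℝ | (of S).det = 0}
  simp only [h3, lintegral_const] at h2
  simpa using h2.symm

end PiDensity

section Split
variable {κ : Type*} [Fintype κ]

lemma measurePreserving_gauss_sum (κ κ' : Type*) [Fintype κ] [Fintype κ'] :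
    MeasurePreserving (fun x : κ ⊕ κ' → ℝ => ((fun i => x (.inl i)), fun i => x (.inr i)))
      (gauss (κ ⊕ κ')) ((gauss κ).prod (gauss κ')) :=
  measurePreserving_sumPiEquivProdPi (X := fun _ : κ ⊕ κ' => ℝ) fun _ => gaussianReal 0 1

lemma measurePreserving_gauss_add_two (κ : Type*) [Fintype κ] :
    MeasurePreserving (fun x : κ ⊕ (Unit ⊕ Unit) → ℝ =>
        ((fun i => x (.inl i)), (x (.inr (.inl ())), x (.inr (.inr ())))))
      (gauss (κ ⊕ (Unit ⊕ Unit))) ((gauss κ).prod ((gaussianReal 0 1).prod (gaussianReal 0 1))) :=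
  ((MeasurePreserving.id (gauss κ)).prod
    (((measurePreserving_eval_gauss ()).prod (measurePreserving_eval_gauss ())).comp
      (measurePreserving_gauss_sum Unit Unit))).comp (measurePreserving_gauss_sum κ (Unit ⊕ Unit))

lemma measurePreserving_split (κ : Type*) [Fintype κ] :
    MeasurePreserving (fun Z : κ → κ ⊕ (Unit ⊕ Unit) → ℝ =>
        ((fun i j => Z i (.inl j)), ((fun i => Z i (.inr (.inl ()))), fun i => Z i (.inr (.inr ())))))
      (Measure.pi fun _ : κ => gauss (κ ⊕ (Unit ⊕ Unit)))
      ((Measure.pi fun _ : κ => gauss κ).prod ((gauss κ).prod (gauss κ))) := by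
  have h1 := measurePreserving_pi (fun _ : κ => gauss (κ ⊕ (Unit ⊕ Unit))) _
    fun _ : κ => measurePreserving_gauss_add_two κ
  have h2 := measurePreserving_arrowProdEquivProdArrow (κ → ℝ) (ℝ × ℝ) κ (fun _ => gauss κ)
    fun _ => (gaussianReal 0 1).prod (gaussianReal 0 1)
  have h3 := measurePreserving_arrowProdEquivProdArrow ℝ ℝ κ (fun _ => gaussianReal 0 1)
    fun _ => gaussianReal 0 1
  exact (((MeasurePreserving.id _).prod h3).comp h2).comp h1

/-- The vector `y` extended by its inner products with `a` and `b`. -/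
def lift (a b y : κ → ℝ) : κ ⊕ (Unit ⊕ Unit) → ℝ :=
  Sum.elim y (Sum.elim (fun _ => y ⬝ᵥ a) fun _ => y ⬝ᵥ b)

lemma measurable_lift {α : Type*} [MeasurableSpace α] {a b y : α → κ → ℝ} (ha : Measurable a)
    (hb : Measurable b) (hy : Measurable y) : Measurable fun x => lift (a x) (b x) (y x) := by
  refine measurable_pi_lambda _ fun j => ?_
  rcases j with j | j | j
  · exact (measurable_pi_apply j).comp hy
  · exact Finset.measurable_sum _ fun i _ =>
      ((measurable_pi_apply i).comp hy).mul ((measurable_pi_apply i).comp ha)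
  · exact Finset.measurable_sum _ fun i _ =>
      ((measurable_pi_apply i).comp hy).mul ((measurable_pi_apply i).comp hb)

lemma measurable_dotProduct {α : Type*} [MeasurableSpace α] {x y : α → κ → ℝ} (hx : Measurable x)
    (hy : Measurable y) : Measurable fun t => x t ⬝ᵥ y t :=
  Finset.measurable_sum _ fun i _ =>
    ((measurable_pi_apply i).comp hx).mul ((measurable_pi_apply i).comp hy)

variable [DecidableEq κ]

/-- The density, at the pair of slopes `(a, b)`, of the mixture of graphs. -/
noncomputable def slopeIntegrand (G : (κ ⊕ (Unit ⊕ Unit) → ℝ) → ℝ≥0∞) (s : Finset κ)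
    (ab : (κ → ℝ) × (κ → ℝ)) (Y : κ → κ → ℝ) : ℝ≥0∞ :=
  ENNReal.ofReal ((of Y).det ^ 2) * (∏ i, ENNReal.ofReal (gaussianPDFReal 0 1 (Y i ⬝ᵥ ab.1) *
    gaussianPDFReal 0 1 (Y i ⬝ᵥ ab.2))) * ∏ i ∈ s, G (lift ab.1 ab.2 (Y i))

/-- The integral of `slopeIntegrand` over the random matrix. -/
noncomputable def slopeIntegral (G : (κ ⊕ (Unit ⊕ Unit) → ℝ) → ℝ≥0∞) (s : Finset κ)
    (ab : (κ → ℝ) × (κ → ℝ)) : ℝ≥0∞ :=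
  ∫⁻ Y, slopeIntegrand G s ab Y ∂(Measure.pi fun _ : κ => gauss κ)

lemma measurable_slopeIntegrand {α : Type*} [MeasurableSpace α]
    {H : α × (κ ⊕ (Unit ⊕ Unit) → ℝ) → ℝ≥0∞} (hH : Measurable H) (s : Finset κ) :
    Measurable fun q : (α × ((κ → ℝ) × (κ → ℝ))) × (κ → κ → ℝ) =>
      slopeIntegrand (fun z => H (q.1.1, z)) s q.1.2 q.2 := by
  have hY : ∀ i, Measurable fun q : (α × ((κ → ℝ) × (κ → ℝ))) × (κ → κ → ℝ) => q.2 i :=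
    fun i => (measurable_pi_apply i).comp measurable_snd
  have hpdf := measurable_gaussianPDFReal 0 1
  refine Measurable.mul (Measurable.mul ?_ ?_) ?_
  · exact ((measurable_det.comp measurable_snd).pow_const 2).ennreal_ofReal
  · exact Finset.measurable_prod _ fun i _ =>
      ((hpdf.comp (measurable_dotProduct (hY i) (by fun_prop))).mul
        (hpdf.comp (measurable_dotProduct (hY i) (by fun_prop)))).ennreal_ofReal
  · exact Finset.measurable_prod _ fun i _ =>
      hH.comp ((by fun_prop : Measurable fun q : (α × ((κ → ℝ) × (κ → ℝ))) × (κ → κ → ℝ) => q.1.1).prodMk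
        (measurable_lift (by fun_prop) (by fun_prop) (hY i)))

lemma measurable_slopeIntegral {α : Type*} [MeasurableSpace α]
    {H : α × (κ ⊕ (Unit ⊕ Unit) → ℝ) → ℝ≥0∞} (hH : Measurable H) (s : Finset κ) :
    Measurable fun q : α × ((κ → ℝ) × (κ → ℝ)) => slopeIntegral (fun z => H (q.1, z)) s q.2 :=
  (measurable_slopeIntegrand hH s).lintegral_prod_right'

/-- Rows in general position form a graph over their first block of coordinates; this is the
resulting change of variables. -/
lemma lintegral_prod_eq_slope {G : (κ ⊕ (Unit ⊕ Unit) → ℝ) → ℝ≥0∞} (hG : Measurable G)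
    (s : Finset κ) :
    ∫⁻ Z : κ → κ ⊕ (Unit ⊕ Unit) → ℝ, ∏ i ∈ s, G (Z i)
      ∂(Measure.pi fun _ : κ => gauss (κ ⊕ (Unit ⊕ Unit))) = ∫⁻ ab, slopeIntegral G s ab := by
  have hΦ : Measurable fun q : (κ → κ → ℝ) × ((κ → ℝ) × (κ → ℝ)) => ∏ i ∈ s,
      G (Sum.elim (q.1 i) (Sum.elim (fun _ => q.2.1 i) fun _ => q.2.2 i)) := by
    refine Finset.measurable_prod _ fun i _ => hG.comp (measurable_pi_lambda _ fun j => ?_)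
    rcases j with j | j | j
    · exact (by fun_prop : Measurable fun q : (κ → κ → ℝ) × ((κ → ℝ) × (κ → ℝ)) => q.1 i j)
    · exact (by fun_prop : Measurable fun q : (κ → κ → ℝ) × ((κ → ℝ) × (κ → ℝ)) => q.2.1 i)
    · exact (by fun_prop : Measurable fun q : (κ → κ → ℝ) × ((κ → ℝ) × (κ → ℝ)) => q.2.2 i)
  obtain ⟨Φ, hΦd⟩ : ∃ Φ : (κ → κ → ℝ) × ((κ → ℝ) × (κ → ℝ)) → ℝ≥0∞, ∀ q, Φ q = ∏ i ∈ s,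
      G (Sum.elim (q.1 i) (Sum.elim (fun _ => q.2.1 i) fun _ => q.2.2 i)) := ⟨_, fun _ => rfl⟩
  simp only [← hΦd] at hΦ
  have h1 : ∫⁻ Z : κ → κ ⊕ (Unit ⊕ Unit) → ℝ, ∏ i ∈ s, G (Z i)
      ∂(Measure.pi fun _ : κ => gauss (κ ⊕ (Unit ⊕ Unit))) =
      ∫⁻ q, Φ q ∂((Measure.pi fun _ : κ => gauss κ).prod ((gauss κ).prod (gauss κ))) := by
    rw [← (measurePreserving_split κ).lintegral_comp hΦ]
    refine lintegral_congr fun Z => ?_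
    rw [hΦd]
    refine Finset.prod_congr rfl fun i _ => congrArg G ?_
    ext j
    rcases j with j | j | j <;> rfl
  have hm := measurable_slopeIntegrand (α := Unit) (H := fun q => G q.2) (hG.comp measurable_snd) s
  obtain ⟨D, hD⟩ : ∃ D : (κ → κ → ℝ) × ((κ → ℝ) × (κ → ℝ)) → ℝ≥0∞,
    ∀ Y ab, slopeIntegrand G s ab Y = D (Y, ab) := ⟨fun q => slopeIntegrand G s q.2 q.1, fun _ _ => rfl⟩
  have hDm : Measurable D := by
    have h2 : Measurable fun q : (κ → κ → ℝ) × ((κ → ℝ) × (κ → ℝ)) =>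
      ((((), q.2), q.1) : (Unit × ((κ → ℝ) × (κ → ℝ))) × (κ → κ → ℝ)) := by fun_prop
    have h3 := hm.comp h2
    convert h3 using 1
    ext q
    exact (hD q.1 q.2).symm
  rw [h1, lintegral_prod _ hΦ.aemeasurable]
  simp only [slopeIntegral, hD]
  have hsw := lintegral_lintegral_swap (μ := Measure.pi fun _ : κ => gauss κ)
    (ν := (volume : Measure ((κ → ℝ) × (κ → ℝ)))) (f := fun Y ab => D (Y, ab)) hDm.aemeasurable
  rw [← hsw]
  refine lintegral_congr_ae ?_
  filter_upwards [ae_det_ne_zero (κ := κ)] with Y hY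
  have hΦY : Measurable fun t : (κ → ℝ) × (κ → ℝ) => Φ (Y, t) := hΦ.comp measurable_prodMk_left
  have hmY : Measurable fun ab : (κ → ℝ) × (κ → ℝ) => D (Y, ab) :=
    hDm.comp measurable_prodMk_left
  rw [lintegral_prod _ hΦY.aemeasurable, Measure.volume_eq_prod, lintegral_prod _ hmY.aemeasurable,
    lintegral_gauss_mulVec hY hΦY.lintegral_prod_right']
  refine lintegral_congr fun a => ?_
  have hΦa : Measurable fun t : κ → ℝ => Φ (Y, of Y *ᵥ a, t) := hΦY.comp measurable_prodMk_left
  rw [lintegral_gauss_mulVec hY hΦa, ← mul_assoc,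
    ← lintegral_const_mul]
  · refine lintegral_congr fun b => ?_
    rw [hΦd, ← hD, slopeIntegrand]
    have h2 : ENNReal.ofReal ((of Y).det ^ 2) = ENNReal.ofReal |(of Y).det| * ENNReal.ofReal |(of Y).det| := by
      rw [← ENNReal.ofReal_mul (abs_nonneg _), ← pow_two, sq_abs]
    have h3 : ∏ i, ENNReal.ofReal (gaussianPDFReal 0 1 (Y i ⬝ᵥ a) * gaussianPDFReal 0 1 (Y i ⬝ᵥ b)) =
        ENNReal.ofReal (gaussDensity (of Y *ᵥ a)) * ENNReal.ofReal (gaussDensity (of Y *ᵥ b)) := by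
      rw [← ENNReal.ofReal_mul (gaussDensity_nonneg _), gaussDensity, gaussDensity,
        ← Finset.prod_mul_distrib, ENNReal.ofReal_prod_of_nonneg]
      · rfl
      · exact fun i _ => mul_nonneg (gaussianPDFReal_nonneg _ _ _) (gaussianPDFReal_nonneg _ _ _)
    have h4 : ∏ i ∈ s, G (lift a b (Y i)) = ∏ i ∈ s,
      G (Sum.elim (Y i) (Sum.elim (fun _ => (of Y *ᵥ a) i) fun _ => (of Y *ᵥ b) i)) := rfl
    simp only [h2, h3, h4]
    ring
  · have hYb := measurable_mulVec (of Y)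
    exact (measurable_gaussDensity.comp hYb).ennreal_ofReal.mul
      (hΦa.comp hYb) |>.const_mul _

end Split

section Slope
variable {κ : Type*} [Fintype κ] [DecidableEq κ]

/-- The matrix of the graph of the slopes `(a, b)`. -/
def liftMatrix (a b : κ → ℝ) : Matrix (κ ⊕ (Unit ⊕ Unit)) κ ℝ :=
  of (Sum.elim (fun i => Pi.single i 1) (Sum.elim (fun _ => a) fun _ => b))

lemma liftMatrix_mulVec (a b y : κ → ℝ) : liftMatrix a b *ᵥ y = lift a b y := by
  ext j
  rcases j with j | j | j
  · simp [liftMatrix, lift, mulVec]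
  · simp [liftMatrix, lift, mulVec, dotProduct_comm]
  · simp [liftMatrix, lift, mulVec, dotProduct_comm]

lemma exists_lift_eq (a b : κ → ℝ) : ∃ (E : Matrix (κ ⊕ (Unit ⊕ Unit)) κ ℝ) (R : Matrix κ κ ℝ),
    Eᵀ * E = 1 ∧ R.det ≠ 0 ∧ ∀ y, lift a b y = E *ᵥ (R *ᵥ y) := by
  obtain ⟨E, hE, hEw⟩ := exists_frame_range (κ := κ) (fun t : κ => (liftMatrix a b)ᵀ t) le_rfl
    (by simp)
  have h1 : E * (Eᵀ * liftMatrix a b) = liftMatrix a b := by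
    ext i j
    have := congrFun (hEw j) i
    rw [mulVec_mulVec] at this
    rw [← Matrix.mul_assoc]
    exact this
  have h2 : ∀ y, lift a b y = E *ᵥ ((Eᵀ * liftMatrix a b) *ᵥ y) := fun y => by
    rw [mulVec_mulVec, h1, liftMatrix_mulVec]
  refine ⟨E, Eᵀ * liftMatrix a b, hE, fun hdet => ?_, h2⟩
  obtain ⟨y, hy0, hy⟩ := exists_mulVec_eq_zero_iff.2 hdet
  refine hy0 (funext fun i => ?_)
  have h3 := h2 y
  rw [hy, mulVec_zero] at h3
  exact congrFun h3 (.inl i)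

lemma gaussDensity_lift (a b y : κ → ℝ) : gaussDensity (lift a b y) =
    gaussDensity y * (gaussianPDFReal 0 1 (y ⬝ᵥ a) * gaussianPDFReal 0 1 (y ⬝ᵥ b)) := by
  simp [gaussDensity, lift, Fintype.prod_sum_type]

/-- For fixed slopes the rows are, up to normalization, Gaussian in the graph subspace. -/
lemma exists_slopeIntegral_eq (a b : κ → ℝ) :
    ∃ (c : ℝ≥0∞) (B : Matrix (κ ⊕ (Unit ⊕ Unit)) κ ℝ), Bᵀ * B = 1 ∧
      ∀ G : (κ ⊕ (Unit ⊕ Unit) → ℝ) → ℝ≥0∞, Measurable G → ∀ s : Finset κ,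
        slopeIntegral G s (a, b) = c * ∫⁻ S : κ → κ → ℝ, ENNReal.ofReal ((of S).det ^ 2) *
          ∏ i ∈ s, G (B *ᵥ S i) ∂(Measure.pi fun _ : κ => gauss κ) := by
  obtain ⟨E, R, hE, hR, hER⟩ := exists_lift_eq a b
  have hRu : IsUnit R.det := isUnit_iff_ne_zero.2 hR
  have hRi : (R⁻¹).det ≠ 0 := by rw [det_nonsing_inv, Ring.inverse_eq_inv']; exact inv_ne_zero hR
  obtain ⟨q, hq⟩ : ∃ q : (κ → ℝ) → ℝ, ∀ y, q y =
    gaussianPDFReal 0 1 (y ⬝ᵥ a) * gaussianPDFReal 0 1 (y ⬝ᵥ b) := ⟨_, fun _ => rfl⟩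
  have hq0 : ∀ y, 0 ≤ q y := fun y => by
    rw [hq]; exact mul_nonneg (gaussianPDFReal_nonneg _ _ _) (gaussianPDFReal_nonneg _ _ _)
  have hqm : Measurable q := by
    simp only [funext hq]
    exact ((measurable_gaussianPDFReal 0 1).comp (measurable_dotProduct measurable_id measurable_const)).mul
      ((measurable_gaussianPDFReal 0 1).comp (measurable_dotProduct measurable_id measurable_const))
  obtain ⟨K, hK⟩ : ∃ K : ℝ, K = (Real.sqrt (2 * Real.pi))⁻¹ := ⟨_, rfl⟩
  have hK0 : 0 ≤ K := by rw [hK]; positivity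
  have hdens : ∀ y, gaussDensity y * q y = K ^ 2 * gaussDensity (R *ᵥ y) := by
    intro y
    rw [hq, ← gaussDensity_lift, gaussDensity_eq, gaussDensity_eq, hER, dotProduct_mulVec_self hE,
      ← hK, Fintype.card_sum, pow_add]
    simp only [Fintype.card_sum, Fintype.card_unit]
    ring
  obtain ⟨c, hc⟩ : ∃ c : ℝ, c = |(R⁻¹).det| * K ^ 2 := ⟨_, rfl⟩
  have hc0 : 0 ≤ c := by rw [hc]; positivity
  have hqle : ∀ Φ : (κ → ℝ) → ℝ≥0∞, Measurable Φ → ∫⁻ y, ENNReal.ofReal (q y) * Φ y ∂gauss κ =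
      ENNReal.ofReal c * ∫⁻ y, Φ (R⁻¹ *ᵥ y) ∂gauss κ := by
    intro Φ hΦ
    have hΦR : Measurable fun y => Φ (R⁻¹ *ᵥ y) := hΦ.comp (measurable_mulVec _)
    have hqΦ : Measurable fun y => ENNReal.ofReal (q y) * Φ y := hqm.ennreal_ofReal.mul hΦ
    have hgqΦ : Measurable fun y => ENNReal.ofReal (gaussDensity y) * (ENNReal.ofReal (q y) * Φ y) :=
      measurable_gaussDensity.ennreal_ofReal.mul hqΦ
    rw [lintegral_gauss hqΦ, lintegral_gauss hΦR, lintegral_volume_mulVec hRi hgqΦ, hc,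
      ENNReal.ofReal_mul (abs_nonneg _), mul_assoc,
      ← lintegral_const_mul' (ENNReal.ofReal (K ^ 2)) _ ENNReal.ofReal_ne_top]
    congr 1
    refine lintegral_congr fun y => ?_
    rw [← mul_assoc, ← ENNReal.ofReal_mul (gaussDensity_nonneg _), hdens, mulVec_mulVec,
      mul_nonsing_inv _ hRu, one_mulVec, ENNReal.ofReal_mul (by positivity), mul_assoc]
  have hpR : Measurable fun y : κ → ℝ => R⁻¹ *ᵥ y := measurable_mulVec _
  have hprob : IsProbabilityMeasure ((gauss κ).map fun y => R⁻¹ *ᵥ y) :=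
    Measure.isProbabilityMeasure_map hpR.aemeasurable
  have hqint : Integrable q (gauss κ) := by
    refine ⟨hqm.aestronglyMeasurable, ?_⟩
    rw [hasFiniteIntegral_iff_ofReal (Filter.Eventually.of_forall hq0)]
    have := hqle (fun _ => 1) measurable_const
    simp only [mul_one, lintegral_one, measure_univ] at this
    rw [this]
    exact ENNReal.ofReal_lt_top
  have hmeas : ((gauss κ).withDensity fun y => ENNReal.ofReal (q y)) =
      ((gauss κ).map fun y => R⁻¹ *ᵥ y).withDensity fun _ => ENNReal.ofReal c := by
    refine Measure.ext_of_lintegral _ fun Φ hΦ => ?_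
    rw [lintegral_withDensity_eq_lintegral_mul _ hqm.ennreal_ofReal hΦ, withDensity_const,
      lintegral_smul_measure, lintegral_map hΦ hpR]
    exact hqle Φ hΦ
  have hpi : ∀ F : (κ → κ → ℝ) → ℝ≥0∞, Measurable F →
      ∫⁻ Y : κ → κ → ℝ, ENNReal.ofReal (∏ i, q (Y i)) * F Y ∂(Measure.pi fun _ : κ => gauss κ) =
        ENNReal.ofReal (c ^ Fintype.card κ) * ∫⁻ S : κ → κ → ℝ, F (fun i => R⁻¹ *ᵥ S i)
          ∂(Measure.pi fun _ : κ => gauss κ) := by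
    intro F hF
    have hprod : Measurable fun Y : κ → κ → ℝ => ENNReal.ofReal (∏ i, q (Y i)) :=
      (Finset.measurable_prod _ fun i _ => hqm.comp (measurable_pi_apply i)).ennreal_ofReal
    have h1 := lintegral_withDensity_eq_lintegral_mul (Measure.pi fun _ : κ => gauss κ) hprod hF
    rw [← pi_withDensity_ofReal _ hq0 hqint, hmeas,
      pi_withDensity_ofReal _ (fun _ => hc0) (integrable_const c)] at h1
    simp only [Finset.prod_const, Finset.card_univ] at h1
    rw [withDensity_const, lintegral_smul_measure, smul_eq_mul,
      ← Measure.pi_map_pi (fun _ => hpR.aemeasurable), lintegral_map hF] at h1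
    · exact h1.symm
    · exact measurable_pi_lambda _ fun i => hpR.comp (measurable_pi_apply i)
  refine ⟨ENNReal.ofReal (c ^ Fintype.card κ) * ENNReal.ofReal ((R⁻¹).det ^ 2), E, hE, fun G hG s => ?_⟩
  obtain ⟨F, hF⟩ : ∃ F : (κ → κ → ℝ) → ℝ≥0∞, ∀ Y, F Y = ENNReal.ofReal ((of Y).det ^ 2) *
    ∏ i ∈ s, G (lift a b (Y i)) := ⟨_, fun _ => rfl⟩
  have hFm : Measurable F := by
    simp only [funext hF]
    exact ((measurable_det.pow_const 2).ennreal_ofReal).mul (Finset.measurable_prod _ fun i _ =>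
      hG.comp (measurable_lift measurable_const measurable_const (measurable_pi_apply i)))
  have h1 : slopeIntegral G s (a, b) = ∫⁻ Y : κ → κ → ℝ, ENNReal.ofReal (∏ i, q (Y i)) * F Y
      ∂(Measure.pi fun _ : κ => gauss κ) := by
    refine lintegral_congr fun Y => ?_
    rw [slopeIntegrand, hF, ENNReal.ofReal_prod_of_nonneg fun i _ => hq0 _]
    simp only [hq]
    ring
  have h3 : ∀ S : κ → κ → ℝ, F (fun i => R⁻¹ *ᵥ S i) = ENNReal.ofReal ((R⁻¹).det ^ 2) *
      (ENNReal.ofReal ((of S).det ^ 2) * ∏ i ∈ s, G (E *ᵥ S i)) := by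
    intro S
    have h2 : (of fun i => R⁻¹ *ᵥ S i) = of S * (R⁻¹)ᵀ := by
      ext i j
      simp [mul_apply, mulVec, dotProduct, mul_comm]
    rw [hF, h2, det_mul, det_transpose, mul_pow, ENNReal.ofReal_mul (sq_nonneg _)]
    simp only [hER, mulVec_mulVec, mul_nonsing_inv _ hRu, Matrix.mul_one]
    ring
  rw [h1, hpi F hFm]
  simp only [h3]
  rw [lintegral_const_mul' _ _ ENNReal.ofReal_ne_top, mul_assoc]

end Slope

section Step
variable {ι κ : Type*} [Fintype ι] [DecidableEq ι] [Fintype κ] [DecidableEq κ]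

lemma ofReal_integral_pow {τ : Type*} [Fintype τ] {g : (τ → ℝ) → ℝ} (hg : Homog g)
    (h0 : ∀ x, 0 ≤ g x) (s : Finset κ) :
    ENNReal.ofReal ((∫ x, g x ∂gauss τ) ^ s.card) =
      ∫⁻ Z : κ → τ → ℝ, ∏ i ∈ s, ENNReal.ofReal (g (Z i)) ∂(Measure.pi fun _ : κ => gauss τ) := by
  have hI : ∀ i : κ, Integrable (if i ∈ s then g else fun _ => 1) (gauss τ) := by
    intro i
    by_cases h : i ∈ s
    · simpa only [if_pos h] using (show Integrable g (gauss τ) from hg.integrable (gauss τ) measurable_id)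
    · simpa only [if_neg h] using integrable_const (1 : ℝ)
  have h1 := integral_fintype_prod_eq_prod (μ := fun _ : κ => gauss τ)
    (fun i => if i ∈ s then g else fun _ => 1)
  have h2 := Integrable.fintype_prod hI
  simp only [prod_ite_one] at h1 h2
  have h3 : ∏ i : κ, ∫ x, (if i ∈ s then g else fun _ => 1) x ∂gauss τ = (∫ x, g x ∂gauss τ) ^ s.card := by
    rw [← Finset.prod_const, ← Finset.prod_subset (Finset.subset_univ s)]
    · exact Finset.prod_congr rfl fun i hi => by simp only [if_pos hi]
    · intro i _ hi; simp [if_neg hi]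
  rw [← h3, ← h1, ofReal_integral_eq_lintegral_ofReal h2
    (Filter.Eventually.of_forall fun Z => Finset.prod_nonneg fun i _ => h0 _)]
  exact lintegral_congr fun Z => ENNReal.ofReal_prod_of_nonneg fun i _ => h0 _

lemma le_avg {f : (ι → ℝ) → ℝ} (hf : Homog f) {lo : ℝ} (hlo : ∀ x, lo ≤ f x) (W : Matrix ι κ ℝ) :
    lo ≤ avg f W := by
  have h := integral_mono (μ := gauss κ) (integrable_const lo)
    (hf.integrable (gauss κ) (measurable_mulVec W)) fun x => hlo _
  simpa [avg] using h

lemma lintegral_det_sq : ∫⁻ S : κ → κ → ℝ, ENNReal.ofReal ((of S).det ^ 2)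
    ∂(Measure.pi fun _ : κ => gauss κ) = ENNReal.ofReal (Fintype.card κ).factorial := by
  have hI := integrable_det_sq_mul (ι := κ) (g := fun _ => (1 : ℝ))
    ⟨measurable_const, fun _ _ _ => rfl, 1, by simp⟩ ∅
  simp only [Finset.prod_empty, mul_one] at hI
  rw [← integral_det_sq, ofReal_integral_eq_lintegral_ofReal hI
    (Filter.Eventually.of_forall fun S => sq_nonneg _)]

lemma lintegral_slopeIntegral_one :
    ∫⁻ ab : (κ → ℝ) × (κ → ℝ), slopeIntegral (κ := κ) (fun _ => 1) ∅ ab = 1 := by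
  rw [← lintegral_prod_eq_slope measurable_const ∅]
  simp

lemma measurable_slopeIntegral_one :
    Measurable fun ab : (κ → ℝ) × (κ → ℝ) => slopeIntegral (κ := κ) (fun _ => 1) ∅ ab := by
  obtain ⟨H, hH⟩ : ∃ H : Unit × (κ ⊕ (Unit ⊕ Unit) → ℝ) → ℝ≥0∞, ∀ q, H q = 1 := ⟨_, fun _ => rfl⟩
  have hHm : Measurable H := by rw [funext hH]; exact measurable_const
  have h := (measurable_slopeIntegral hHm ∅).comp
    (measurable_prodMk_left : Measurable fun ab : (κ → ℝ) × (κ → ℝ) => ((), ab))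
  simpa only [hH, Function.comp_def] using h

/-- The determinant-weighted lower bound on the `p`-th moment within a fixed frame. -/
lemma le_lintegral_det_sq_mul [Nonempty κ] {f : (ι → ℝ) → ℝ} (hf : Homog f) {lo L : ℝ} (hlo0 : 0 < lo)
    (hlo : ∀ x, lo ≤ f x) (hL0 : 0 ≤ L) (hhi : ∀ x, f x ≤ Real.exp L * lo) {p : ℕ} {u : ℝ}
    (hp : 8 * (p : ℝ) ≤ Fintype.card κ) (hu0 : 0 ≤ u) (hu : u ≤ 1 / 2)
    (h : 16 * p * ((4 * L + 1) ^ 2 + p) ≤ u * (Fintype.card κ : ℝ) ^ 2)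
    {s : Finset κ} (hs : s.card = p) (W : Matrix ι κ ℝ) :
    ENNReal.ofReal (Fintype.card κ).factorial *
        (ENNReal.ofReal ((1 - u) ^ p) * ENNReal.ofReal (avg f W ^ p)) ≤
      ∫⁻ S : κ → κ → ℝ, ENNReal.ofReal ((of S).det ^ 2) * ∏ i ∈ s, ENNReal.ofReal (f (W *ᵥ S i))
        ∂(Measure.pi fun _ : κ => gauss κ) := by
  have hf0 : ∀ x, 0 ≤ f x := fun x => hlo0.le.trans (hlo x)
  have hg := hf.comp_mulVec W
  have hlow := le_avg hf hlo W
  have h4 := integral_det_sq_mul_ge hg (fun x => hf0 _) (fun x => hhi _)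
    (Z := avg f W) rfl (hlo0.trans_le hlow) hL0
    (mul_le_mul_of_nonneg_left hlow (Real.exp_pos L).le) hp hu0 hu h s hs.le
  have h5 := integrable_det_sq_mul hg s
  have h6 := ENNReal.ofReal_le_ofReal h4
  rw [ofReal_integral_eq_lintegral_ofReal h5 (Filter.Eventually.of_forall fun S =>
    mul_nonneg (sq_nonneg _) (Finset.prod_nonneg fun i _ => hf0 _)), hs] at h6
  calc _ = ENNReal.ofReal ((1 - u) ^ p * (Fintype.card κ).factorial * avg f W ^ p) := by
        have : 0 ≤ 1 - u := by linarith
        rw [ENNReal.ofReal_mul (by positivity), ENNReal.ofReal_mul (by positivity)]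
        ring
    _ ≤ _ := h6
    _ = _ := by
        refine lintegral_congr fun S => ?_
        rw [ENNReal.ofReal_mul (sq_nonneg _), ENNReal.ofReal_prod_of_nonneg fun i _ => hf0 _]

/-- Moments of averages over random frames nearly increase when two dimensions are added. -/
lemma moment_add_two_le [Nonempty κ] {f : (ι → ℝ) → ℝ} (hf : Homog f) {lo L : ℝ} (hlo0 : 0 < lo)
    (hlo : ∀ x, lo ≤ f x) (hL0 : 0 ≤ L) (hhi : ∀ x, f x ≤ Real.exp L * lo) {p : ℕ} {u : ℝ}
    (hp : 8 * (p : ℝ) ≤ Fintype.card κ) (hu0 : 0 ≤ u) (hu : u ≤ 1 / 2)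
    (h : 16 * p * ((4 * L + 1) ^ 2 + p) ≤ u * (Fintype.card κ : ℝ) ^ 2)
    {W₀ : Matrix ι (κ ⊕ (Unit ⊕ Unit)) ℝ} (hW₀ : W₀ᵀ * W₀ = 1)
    {W₁ : Matrix ι κ ℝ} (hW₁ : W₁ᵀ * W₁ = 1) :
    ENNReal.ofReal ((1 - u) ^ p) *
        ∫⁻ U : O ι, ENNReal.ofReal (avg f ((U : Matrix ι ι ℝ) * W₁) ^ p) ∂haarO ι ≤
      ∫⁻ U : O ι, ENNReal.ofReal (avg f ((U : Matrix ι ι ℝ) * W₀) ^ p) ∂haarO ι := by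
  have hf0 : ∀ x, 0 ≤ f x := fun x => hlo0.le.trans (hlo x)
  obtain ⟨s, hs⟩ : ∃ s : Finset κ, s.card = p := by
    have : p ≤ (Finset.univ : Finset κ).card := by
      have h8 : (p : ℝ) ≤ Fintype.card κ := by
        have : (0 : ℝ) ≤ p := p.cast_nonneg
        linarith
      simpa using (by exact_mod_cast h8 : p ≤ Fintype.card κ)
    obtain ⟨s, _, hs⟩ := Finset.exists_subset_card_eq this
    exact ⟨s, hs⟩
  obtain ⟨H, hH⟩ : ∃ H : O ι × (κ ⊕ (Unit ⊕ Unit) → ℝ) → ℝ≥0∞,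
    ∀ U z, H (U, z) = ENNReal.ofReal (f (((U : Matrix ι ι ℝ) * W₀) *ᵥ z)) :=
    ⟨fun q => ENNReal.ofReal (f (((q.1 : Matrix ι ι ℝ) * W₀) *ᵥ q.2)), fun _ _ => rfl⟩
  have hHm : Measurable H := by
    have h1 : Measurable fun q : O ι × (κ ⊕ (Unit ⊕ Unit) → ℝ) =>
        ENNReal.ofReal (f (((q.1 : Matrix ι ι ℝ) * W₀) *ᵥ q.2)) :=
      (hf.meas.comp (measurable_O_mulVec W₀ measurable_fst measurable_snd)).ennreal_ofReal
    convert h1 using 1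
    ext q
    exact hH q.1 q.2
  have hHU : ∀ U, Measurable fun z => H (U, z) := fun U => hHm.comp measurable_prodMk_left
  obtain ⟨D, hD⟩ : ∃ D : O ι × ((κ → ℝ) × (κ → ℝ)) → ℝ≥0∞,
    ∀ U ab, D (U, ab) = slopeIntegral (fun z => H (U, z)) s ab :=
    ⟨fun q => slopeIntegral (fun z => H (q.1, z)) s q.2, fun _ _ => rfl⟩
  have hDm : Measurable D := by
    have h1 := measurable_slopeIntegral hHm s
    convert h1 using 1
    ext q
    exact hD q.1 q.2
  have h1 : ∀ U : O ι, ENNReal.ofReal (avg f ((U : Matrix ι ι ℝ) * W₀) ^ p) = ∫⁻ ab, D (U, ab) := by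
    intro U
    simp only [hD]
    rw [← lintegral_prod_eq_slope (hHU U) s, avg, ← hs,
      ofReal_integral_pow (hf.comp_mulVec ((U : Matrix ι ι ℝ) * W₀)) (fun x => hf0 _)]
    simp only [hH]
  obtain ⟨M, hM⟩ : ∃ M, M = ∫⁻ U : O ι, ENNReal.ofReal (avg f ((U : Matrix ι ι ℝ) * W₁) ^ p) ∂haarO ι :=
    ⟨_, rfl⟩
  have h2 : ∀ ab : (κ → ℝ) × (κ → ℝ), slopeIntegral (fun _ => 1) ∅ ab *
      (ENNReal.ofReal ((1 - u) ^ p) * M) ≤ ∫⁻ U : O ι, D (U, ab) ∂haarO ι := by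
    rintro ⟨a, b⟩
    obtain ⟨c, B, hB, hc⟩ := exists_slopeIntegral_eq a b
    have h3 : slopeIntegral (fun _ => 1) ∅ (a, b) = c * ENNReal.ofReal (Fintype.card κ).factorial := by
      rw [hc _ measurable_const]
      simp only [Finset.prod_empty, mul_one, lintegral_det_sq]
    have hWB : (W₀ * B)ᵀ * (W₀ * B) = 1 := isometry_mul hW₀ hB
    rw [h3, hM, ← lintegral_frame_eq (fun W => ENNReal.ofReal (avg f W ^ p)) hWB hW₁,
      ← lintegral_const_mul, ← lintegral_const_mul]
    · refine lintegral_mono fun U => ?_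
      rw [hD, hc _ (hHU U)]
      rw [mul_assoc]
      refine mul_le_mul_right ?_ c
      refine (le_lintegral_det_sq_mul hf hlo0 hlo hL0 hhi hp hu0 hu h hs _).trans_eq ?_
      simp only [hH, mulVec_mulVec, Matrix.mul_assoc]
    · exact (((hf.measurable_avg measurable_id _).pow_const p).ennreal_ofReal).const_mul _
    · exact ((hf.measurable_avg measurable_id _).pow_const p).ennreal_ofReal
  simp only [h1]
  rw [← hM, lintegral_lintegral_swap (f := fun U ab => D (U, ab)) hDm.aemeasurable]
  calc _ = (∫⁻ ab : (κ → ℝ) × (κ → ℝ), slopeIntegral (κ := κ) (fun _ => 1) ∅ ab) *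
        (ENNReal.ofReal ((1 - u) ^ p) * M) := by rw [lintegral_slopeIntegral_one, one_mul]
    _ = ∫⁻ ab : (κ → ℝ) × (κ → ℝ), slopeIntegral (κ := κ) (fun _ => 1) ∅ ab *
        (ENNReal.ofReal ((1 - u) ^ p) * M) := (lintegral_mul_const _ measurable_slopeIntegral_one).symm
    _ ≤ _ := lintegral_mono h2

end Step

section Chain
variable {ι : Type*} [Fintype ι] [DecidableEq ι]

lemma lintegral_avg_frame_eq {κ κ' : Type*} [Fintype κ] [DecidableEq κ] [Fintype κ'] [DecidableEq κ']
    (e : κ ≃ κ') (f : (ι → ℝ) → ℝ) (Φ : ℝ → ℝ≥0∞) {W : Matrix ι κ ℝ} {W' : Matrix ι κ' ℝ}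
    (hW : Wᵀ * W = 1) (hW' : W'ᵀ * W' = 1) :
    ∫⁻ U : O ι, Φ (avg f ((U : Matrix ι ι ℝ) * W)) ∂haarO ι =
      ∫⁻ U : O ι, Φ (avg f ((U : Matrix ι ι ℝ) * W')) ∂haarO ι := by
  have hP : (inclMatrix e.symm)ᵀ * inclMatrix e.symm = (1 : Matrix κ' κ' ℝ) :=
    inclMatrix_isometry e.symm.toEmbedding
  have hP' : inclMatrix e.symm * (inclMatrix e.symm)ᵀ = (1 : Matrix κ κ ℝ) :=
    (mul_eq_one_comm_of_card_eq (R := ℝ) _ _ (Fintype.card_congr e.symm)).1 hP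
  have h : ∀ V : Matrix ι κ ℝ, avg f (V * inclMatrix e.symm) = avg f V := by
    intro V
    have hmp := measurePreserving_gauss (W := (inclMatrix e.symm : Matrix κ κ' ℝ)ᵀ)
      (by rw [transpose_transpose]; exact hP')
    rw [transpose_transpose] at hmp
    have hemb : MeasurableEmbedding fun z : κ' → ℝ => (inclMatrix e.symm : Matrix κ κ' ℝ) *ᵥ z := by
      have hinv : ∀ z : κ' → ℝ, (inclMatrix e.symm : Matrix κ κ' ℝ)ᵀ *ᵥ
          ((inclMatrix e.symm : Matrix κ κ' ℝ) *ᵥ z) = z := fun z => by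
        rw [mulVec_mulVec, hP, one_mulVec]
      have hinv' : ∀ z : κ → ℝ, (inclMatrix e.symm : Matrix κ κ' ℝ) *ᵥ
          ((inclMatrix e.symm : Matrix κ κ' ℝ)ᵀ *ᵥ z) = z := fun z => by
        rw [mulVec_mulVec, hP', one_mulVec]
      exact (MeasurableEquiv.mk ⟨_, _, hinv, hinv'⟩ (measurable_mulVec _)
        (measurable_mulVec _)).measurableEmbedding
    have := hmp.integral_comp hemb fun z => f (V *ᵥ z)
    simpa only [mulVec_mulVec, avg] using this
  rw [← lintegral_frame_eq (fun V => Φ (avg f V)) (isometry_mul hW hP) hW']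
  simp only [← Matrix.mul_assoc, h]

lemma avg_mul_full {κ : Type*} [Fintype κ] [DecidableEq κ] (hcard : Fintype.card κ = Fintype.card ι)
    {f : (ι → ℝ) → ℝ} (hf : Homog f) {W : Matrix ι κ ℝ} (hW : Wᵀ * W = 1) :
    avg f W = ∫ x, f x ∂gauss ι := by
  have hW' : W * Wᵀ = 1 := (mul_eq_one_comm_of_card_eq (R := ℝ) _ _ hcard).1 hW
  have hmp := measurePreserving_gauss (W := Wᵀ) (by rw [transpose_transpose]; exact hW')
  rw [transpose_transpose] at hmp
  rw [avg, ← hmp.map_eq, integral_map hmp.measurable.aemeasurable hf.meas.aestronglyMeasurable]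

lemma one_sub_pow_inv_bound {u : ℝ} (hu0 : 0 ≤ u) (hu : u ≤ 1 / 2) (p : ℕ) :
    1 ≤ Real.exp (2 * p * u) * (1 - u) ^ p := by
  have h1 : 1 ≤ Real.exp (2 * u) * (1 - u) := by
    have := Real.add_one_le_exp (2 * u)
    nlinarith
  calc (1 : ℝ) ≤ (Real.exp (2 * u) * (1 - u)) ^ p := one_le_pow₀ h1
    _ = _ := by rw [mul_pow, ← Real.exp_nat_mul]; ring_nf

/-- Iterating `moment_add_two_le`. -/
lemma moment_add_two_mul_le {f : (ι → ℝ) → ℝ} (hf : Homog f) {lo L : ℝ} (hlo0 : 0 < lo)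
    (hlo : ∀ x, lo ≤ f x) (hL0 : 0 ≤ L) (hhi : ∀ x, f x ≤ Real.exp L * lo) {p d : ℕ} (hd : 2 ≤ d)
    (hp : 8 * (p : ℝ) ≤ d) (h : 32 * p * ((4 * L + 1) ^ 2 + p) ≤ (d : ℝ) ^ 2)
    {W₁ : Matrix ι (Fin d) ℝ} (hW₁ : W₁ᵀ * W₁ = 1) (q : ℕ) :
    ∀ W₀ : Matrix ι (Fin (d + 2 * q)) ℝ, W₀ᵀ * W₀ = 1 →
      ∫⁻ U : O ι, ENNReal.ofReal (avg f ((U : Matrix ι ι ℝ) * W₁) ^ p) ∂haarO ι ≤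
        ENNReal.ofReal (Real.exp (16 * p ^ 2 * ((4 * L + 1) ^ 2 + p) *
          (1 / ((d : ℝ) - 1) - 1 / ((d : ℝ) + 2 * q - 1)))) *
          ∫⁻ U : O ι, ENNReal.ofReal (avg f ((U : Matrix ι ι ℝ) * W₀) ^ p) ∂haarO ι := by
  induction q with
  | zero =>
    intro W₀ hW₀
    rw [lintegral_frame_eq (fun V => ENNReal.ofReal (avg f V ^ p)) (W := W₁) (W' := W₀) hW₁ hW₀]
    simp
  | succ q ih =>
    intro W₀ hW₀
    have hd2 : (2 : ℝ) ≤ d := by exact_mod_cast hd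
    have hq0 : (0 : ℝ) ≤ q := q.cast_nonneg
    have hp0 : (0 : ℝ) ≤ p := p.cast_nonneg
    let e : Fin (d + 2 * q) ⊕ (Unit ⊕ Unit) ≃ Fin (d + 2 * (q + 1)) :=
      Fintype.equivOfCardEq (by simp; ring)
    have hW : (W₀ * inclMatrix e)ᵀ * (W₀ * inclMatrix e) = 1 :=
      isometry_mul hW₀ (inclMatrix_isometry e.toEmbedding)
    have hV : (W₀ * inclMatrix (fun i => e (.inl i)))ᵀ * (W₀ * inclMatrix (fun i => e (.inl i))) = 1 :=
      isometry_mul hW₀ (inclMatrix_isometry (⟨fun i => e (.inl i), fun i j hij => by simpa using hij⟩ :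
        Fin (d + 2 * q) ↪ Fin (d + 2 * (q + 1))))
    have h1 := ih _ hV
    have : Nonempty (Fin (d + 2 * q)) := ⟨⟨0, by omega⟩⟩
    obtain ⟨D, hD⟩ : ∃ D : ℝ, D = (d : ℝ) + 2 * q := ⟨_, rfl⟩
    have hdD : (d : ℝ) ≤ D := by rw [hD]; linarith
    have hD2 : 2 ≤ D := hd2.trans hdD
    have hcard : (Fintype.card (Fin (d + 2 * q)) : ℝ) = D := by rw [hD]; simp
    obtain ⟨P, hP⟩ : ∃ P : ℝ, P = p * ((4 * L + 1) ^ 2 + p) := ⟨_, rfl⟩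
    have hP0 : 0 ≤ P := by rw [hP]; positivity
    have hu : 16 * P / D ^ 2 ≤ 1 / 2 := by
      rw [div_le_iff₀ (by positivity)]
      nlinarith
    have hu0 : 0 ≤ 16 * P / D ^ 2 := by positivity
    have h2 := moment_add_two_le hf hlo0 hlo hL0 hhi (p := p) (u := 16 * P / D ^ 2)
      (by rw [hcard]; linarith) hu0 hu (by rw [hcard, div_mul_cancel₀ _ (by positivity)]; linarith) hW hV
    rw [lintegral_avg_frame_eq e f (fun x => ENNReal.ofReal (x ^ p)) hW hW₀] at h2
    have h3 := one_sub_pow_inv_bound hu0 hu p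
    have hexp : 2 * p * (16 * P / D ^ 2) ≤ 16 * (p * P) * (1 / (D - 1) - 1 / (D + 1)) := by
      have h4 : 1 / (D - 1) - 1 / (D + 1) = 2 / (D ^ 2 - 1) := by
        have : D - 1 ≠ 0 := by linarith
        have : D + 1 ≠ 0 := by linarith
        have : D ^ 2 - 1 ≠ 0 := by nlinarith
        field_simp
        ring
      have h5 : 1 / D ^ 2 ≤ 1 / (D ^ 2 - 1) := one_div_le_one_div_of_le (by nlinarith) (by linarith)
      rw [h4]
      calc 2 * p * (16 * P / D ^ 2) = 32 * (p * P) * (1 / D ^ 2) := by ring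
        _ ≤ 32 * (p * P) * (1 / (D ^ 2 - 1)) := by gcongr
        _ = _ := by ring
    obtain ⟨M₀, hM₀⟩ : ∃ M, M = ∫⁻ U : O ι, ENNReal.ofReal (avg f ((U : Matrix ι ι ℝ) * W₀) ^ p) ∂haarO ι :=
      ⟨_, rfl⟩
    obtain ⟨M, hM⟩ : ∃ M, M = ∫⁻ U : O ι, ENNReal.ofReal (avg f ((U : Matrix ι ι ℝ) *
      (W₀ * inclMatrix (fun i => e (.inl i)))) ^ p) ∂haarO ι := ⟨_, rfl⟩
    rw [← hM₀, ← hM] at h2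
    rw [← hM] at h1
    rw [← hM₀]
    refine h1.trans ?_
    have h6 : M ≤ ENNReal.ofReal (Real.exp (16 * (p * P) * (1 / (D - 1) - 1 / (D + 1)))) * M₀ := by
      calc M = 1 * M := (one_mul _).symm
        _ ≤ ENNReal.ofReal (Real.exp (2 * p * (16 * P / D ^ 2)) * (1 - 16 * P / D ^ 2) ^ p) * M := by
            gcongr
            exact ENNReal.one_le_ofReal.2 h3
        _ = ENNReal.ofReal (Real.exp (2 * p * (16 * P / D ^ 2))) *
              (ENNReal.ofReal ((1 - 16 * P / D ^ 2) ^ p) * M) := by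
            rw [ENNReal.ofReal_mul (Real.exp_pos _).le, mul_assoc]
        _ ≤ _ := by gcongr
    calc _ ≤ _ := mul_le_mul_right h6 _
      _ = _ := by
        rw [← mul_assoc, ← ENNReal.ofReal_mul (Real.exp_pos _).le, ← Real.exp_add]
        congr 3
        rw [hP, hD]
        push_cast
        ring

lemma lintegral_avg_pow_le_of_le {θ κ : Type*} [Fintype θ] [DecidableEq θ] [Nonempty θ] [Fintype κ]
    [DecidableEq κ] {f : (ι → ℝ) → ℝ} (hf : Homog f) (hf0 : ∀ x, 0 ≤ f x) (p : ℕ) {E : Matrix ι κ ℝ}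
    (hE : Eᵀ * E = 1) {B : Matrix κ θ ℝ} (hB : Bᵀ * B = 1) :
    ∫ U : O ι, avg f ((U : Matrix ι ι ℝ) * E) ^ p ∂haarO ι ≤
      ∫ U : O ι, avg f ((U : Matrix ι ι ℝ) * (E * B)) ^ p ∂haarO ι := by
  have h0 : ∀ V : Matrix ι κ ℝ, |avg f V| = avg f V := fun V =>
    abs_of_nonneg (integral_nonneg fun _ => hf0 _)
  have h1 : ∀ V : Matrix ι θ ℝ, |avg f V| = avg f V := fun V =>
    abs_of_nonneg (integral_nonneg fun _ => hf0 _)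
  have h := integral_convex_avg_le (R := Unit) hf hE (fun _ => E * B) (fun _ => isometry_mul hE hB)
    (fun _ => by rw [← Matrix.mul_assoc Eᵀ, hE, Matrix.one_mul]) (Ψ := fun x => |x| ^ p)
    ((convexOn_norm convex_univ).pow (fun _ _ => norm_nonneg _) p) (by fun_prop)
  simpa [h0, h1] using h

/-- Comparison of the moments of averages over random subspaces with the global average. -/
lemma integral_avg_pow_le {f : (ι → ℝ) → ℝ} (hf : Homog f) {lo L : ℝ} (hlo0 : 0 < lo)
    (hlo : ∀ x, lo ≤ f x) (hL0 : 0 ≤ L) (hhi : ∀ x, f x ≤ Real.exp L * lo) {p k : ℕ} (hk : 3 ≤ k)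
    (hp : 8 * (p : ℝ) ≤ (k : ℝ) - 1) (h : 32 * p * ((4 * L + 1) ^ 2 + p) ≤ ((k : ℝ) - 1) ^ 2)
    (hkn : k ≤ Fintype.card ι) {W : Matrix ι (Fin k) ℝ} (hW : Wᵀ * W = 1) :
    ∫ U : O ι, avg f ((U : Matrix ι ι ℝ) * W) ^ p ∂haarO ι ≤
      Real.exp (16 * p ^ 2 * ((4 * L + 1) ^ 2 + p) / ((k : ℝ) - 2)) * (∫ x, f x ∂gauss ι) ^ p := by
  have hf0 : ∀ x, 0 ≤ f x := fun x => hlo0.le.trans (hlo x)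
  have hk3 : (3 : ℝ) ≤ k := by exact_mod_cast hk
  have hK : 0 ≤ 16 * (p : ℝ) ^ 2 * ((4 * L + 1) ^ 2 + p) := by positivity
  have hI0 : 0 ≤ ∫ x, f x ∂gauss ι := integral_nonneg hf0
  have even : ∀ d q : ℕ, 2 ≤ d → k ≤ d + 1 → d + 2 * q = Fintype.card ι →
      ∀ W₁ : Matrix ι (Fin d) ℝ, W₁ᵀ * W₁ = 1 →
      ∫ U : O ι, avg f ((U : Matrix ι ι ℝ) * W₁) ^ p ∂haarO ι ≤
      Real.exp (16 * p ^ 2 * ((4 * L + 1) ^ 2 + p) / ((k : ℝ) - 2)) * (∫ x, f x ∂gauss ι) ^ p := by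
    intro d q hd hkd hq W₁ hW₁
    have hkd' : (k : ℝ) - 1 ≤ d := by
      have : (k : ℝ) ≤ d + 1 := by exact_mod_cast hkd
      linarith
    have hd2 : (2 : ℝ) ≤ d := by exact_mod_cast hd
    obtain ⟨j⟩ : Nonempty (Fin (d + 2 * q) ↪ ι) := Function.Embedding.nonempty_of_card_le (by simp [hq])
    have h1 := moment_add_two_mul_le hf hlo0 hlo hL0 hhi hd (hp.trans hkd')
      (h.trans (pow_le_pow_left₀ (by linarith) hkd' 2)) hW₁ q _ (inclMatrix_isometry j)
    have h2 : ∀ U : O ι, avg f ((U : Matrix ι ι ℝ) * inclMatrix j) = ∫ x, f x ∂gauss ι := fun U =>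
      avg_mul_full (by simp [hq]) hf (isometry_mul (O_transpose_mul U) (inclMatrix_isometry j))
    simp only [h2, lintegral_const, measure_univ, mul_one] at h1
    have h3 : ∀ U : O ι, 0 ≤ avg f ((U : Matrix ι ι ℝ) * W₁) ^ p := fun U =>
      pow_nonneg (integral_nonneg fun _ => hf0 _) p
    rw [integral_eq_lintegral_of_nonneg_ae (Filter.Eventually.of_forall h3)
      ((hf.measurable_avg measurable_id _).pow_const p).aestronglyMeasurable]
    refine ENNReal.toReal_le_of_le_ofReal (by positivity) (h1.trans ?_)
    rw [← ENNReal.ofReal_mul (Real.exp_pos _).le]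
    refine ENNReal.ofReal_le_ofReal (mul_le_mul_of_nonneg_right (Real.exp_le_exp.2 ?_) (by positivity))
    rw [div_eq_mul_one_div (16 * (p : ℝ) ^ 2 * ((4 * L + 1) ^ 2 + p))]
    refine mul_le_mul_of_nonneg_left ?_ hK
    have h4 : 0 ≤ 1 / ((d : ℝ) + 2 * q - 1) := by
      have : (0 : ℝ) ≤ q := q.cast_nonneg
      exact one_div_nonneg.2 (by linarith)
    have h5 : 1 / ((d : ℝ) - 1) ≤ 1 / ((k : ℝ) - 2) := one_div_le_one_div_of_le (by linarith) (by linarith)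
    linarith
  rcases Nat.even_or_odd' (Fintype.card ι - k) with ⟨q, hq | hq⟩
  · exact even k q (by omega) (by omega) (by omega) W hW
  · let j : Fin (k - 1) ↪ Fin k := Fin.castLEEmb (by omega)
    have : Nonempty (Fin (k - 1)) := ⟨⟨0, by omega⟩⟩
    exact (lintegral_avg_pow_le_of_le hf hf0 p hW (inclMatrix_isometry j)).trans
      (even (k - 1) (q + 1) (by omega) (by omega) (by omega) _ (isometry_mul hW (inclMatrix_isometry j)))

end Chain

section Tails
variable {ι κ θ R : Type*} [Fintype ι] [DecidableEq ι] [Fintype κ] [DecidableEq κ] [Fintype θ]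
  [DecidableEq θ] [Fintype R]

lemma integral_avg_eq [Nonempty θ] {f : (ι → ℝ) → ℝ} (hf : Homog f) {J : Matrix ι θ ℝ}
    (hJ : Jᵀ * J = 1) : ∫ V : O ι, avg f ((V : Matrix ι ι ℝ) * J) ∂haarO ι = ∫ x, f x ∂gauss ι := by
  have h := avg_eq_integral_O hf 1 hJ
  simpa [avg] using h

/-- Exponential moments over a subspace are controlled by those over smaller subspaces, as if the
smaller subspaces were independent. -/
lemma integral_exp_avg_le [Nonempty θ] [Nonempty R] {f : (ι → ℝ) → ℝ} (hf : Homog f)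
    (hf0 : ∀ x, 0 ≤ f x) {E : Matrix ι κ ℝ} (hE : Eᵀ * E = 1) {J : Matrix ι θ ℝ} (hJ : Jᵀ * J = 1)
    (hcard : Fintype.card R * Fintype.card θ ≤ Fintype.card κ) {y : ℝ} (hy : 0 ≤ y) :
    ∫ U : O ι, Real.exp (-(Fintype.card R * y) * avg f ((U : Matrix ι ι ℝ) * E)) ∂haarO ι ≤
      (∫ V : O ι, Real.exp (-y * avg f ((V : Matrix ι ι ℝ) * J)) ∂haarO ι) ^ Fintype.card R := by
  obtain ⟨h, hh⟩ : ∃ h : O ι → ℝ, ∀ V : O ι, h V = Real.exp (-y * avg f ((V : Matrix ι ι ℝ) * J)) :=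
    ⟨_, fun _ => rfl⟩
  simp only [← hh]
  have hhm : Measurable fun p : O ι × O ι => h (p.1 * p.2) := by
    simp only [hh]
    have h1 := measurable_avg_mul_O₂ hf (1 : Matrix ι ι ℝ) J
    have h2 := (h1.const_mul (-y)).exp
    simpa only [Matrix.one_mul, Submonoid.coe_mul, Matrix.mul_assoc] using h2
  have h0 : ∀ V, 0 ≤ h V := fun V => by rw [hh]; positivity
  have hle : ∀ V, h V ≤ 1 := fun V => by
    rw [hh, Real.exp_le_one_iff]
    have : 0 ≤ avg f ((V : Matrix ι ι ℝ) * J) := integral_nonneg fun _ => hf0 _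
    nlinarith
  have hcR : (Fintype.card R : ℝ) ≠ 0 := by exact_mod_cast Fintype.card_ne_zero
  have hcardE : Fintype.card κ ≤ Fintype.card ι := by
    have hcol := (orthonormal_columns.1 hE).linearIndependent.fintype_card_le_finrank
    simpa using hcol
  have key : ∀ V : R → O ι,
      ∫ U : O ι, Real.exp (-(Fintype.card R * y) * avg f ((U : Matrix ι ι ℝ) * E)) ∂haarO ι ≤
        ∫ U : O ι, ∏ i, h (U * V i) ∂haarO ι := by
    intro V
    obtain ⟨E', hE', hEw⟩ := exists_frame_range (κ := κ)
      (fun (t : R × θ) i => ((V t.1 : Matrix ι ι ℝ) * J) i t.2) (by simpa using hcard) hcardE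
    rw [integral_frame_eq (fun W => Real.exp (-(Fintype.card R * y) * avg f W)) hE hE']
    have h1 := integral_convex_avg_le hf hE' (fun i => (V i : Matrix ι ι ℝ) * J)
      (fun i => isometry_mul (O_transpose_mul (V i)) hJ) (fun i => by
        ext a t
        have := congrFun (hEw (i, t)) a
        rw [mulVec_mulVec] at this
        rw [← Matrix.mul_assoc]
        exact this)
      (Ψ := fun x => Real.exp (-(Fintype.card R * y) * x))
      (by
        have := convexOn_exp.comp_linearMap (LinearMap.mulLeft ℝ (-(Fintype.card R * y)))
        simpa [Function.comp_def] using this) (by fun_prop)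
    refine h1.trans_eq (integral_congr_ae (Filter.Eventually.of_forall fun U => ?_))
    simp only [hh, ← Real.exp_sum, ← Finset.mul_sum, Submonoid.coe_mul, Matrix.mul_assoc]
    congr 1
    field_simp
  have hprodm : Measurable fun q : (R → O ι) × O ι => ∏ i, h (q.2 * q.1 i) :=
    Finset.measurable_prod _ fun i _ =>
      hhm.comp (by fun_prop : Measurable fun q : (R → O ι) × O ι => (q.2, q.1 i))
  have hint : Integrable (fun q : (R → O ι) × O ι => ∏ i, h (q.2 * q.1 i))
      ((Measure.pi fun _ : R => haarO ι).prod (haarO ι)) := by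
    refine Integrable.of_bound hprodm.aestronglyMeasurable 1 (Filter.Eventually.of_forall fun q => ?_)
    rw [Real.norm_of_nonneg (Finset.prod_nonneg fun i _ => h0 _)]
    exact Finset.prod_le_one (fun i _ => h0 _) fun i _ => hle _
  have h2 := integral_mono (μ := Measure.pi fun _ : R => haarO ι) (integrable_const _)
    hint.integral_prod_left key
  rw [integral_const, probReal_univ, one_smul, integral_integral_swap hint] at h2
  refine h2.trans_eq ?_
  have h3 : ∀ U : O ι, ∫ V : R → O ι, ∏ i, h (U * V i) ∂(Measure.pi fun _ : R => haarO ι) =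
      (∫ V, h V ∂haarO ι) ^ Fintype.card R := by
    intro U
    rw [integral_fintype_prod_eq_prod (μ := fun _ : R => haarO ι) (fun (_ : R) V => h (U * V)),
      Finset.prod_const, Finset.card_univ, integral_mul_left_eq_self h U]
  simp only [h3]
  simp

lemma exp_neg_le_quadratic {x : ℝ} (hx : 0 ≤ x) : Real.exp (-x) ≤ 1 - x + x ^ 2 / 2 := by
  have h1 := Real.quadratic_le_exp_of_nonneg hx
  have h2 : 1 ≤ Real.exp x * (1 - x + x ^ 2 / 2) := by nlinarith [sq_nonneg (x - 1), sq_nonneg (x ^ 2)]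
  rw [Real.exp_neg]
  rw [inv_le_iff_one_le_mul₀ (Real.exp_pos x)]
  linarith

lemma integral_exp_neg_mul_le {Ω : Type*} [MeasurableSpace Ω] (μ : Measure Ω) [IsProbabilityMeasure μ]
    {X : Ω → ℝ} (hX0 : ∀ ω, 0 ≤ X ω) (hi1 : Integrable X μ) (hi2 : Integrable (fun ω => X ω ^ 2) μ)
    {y Z : ℝ} (hy0 : 0 ≤ y) (hXZ : ∫ ω, X ω ∂μ = Z) (h2 : ∫ ω, X ω ^ 2 ∂μ ≤ 2 * Z ^ 2) :
    ∫ ω, Real.exp (-y * X ω) ∂μ ≤ Real.exp (-(y * Z) + (y * Z) ^ 2) := by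
  have h3 := integral_mono_of_nonneg (μ := μ) (f := fun ω => Real.exp (-y * X ω))
    (g := fun ω => 1 - y * X ω + y ^ 2 / 2 * X ω ^ 2)
    (Filter.Eventually.of_forall fun V => (Real.exp_pos _).le)
    (((integrable_const 1).sub (hi1.const_mul y)).add (hi2.const_mul (y ^ 2 / 2)))
    (Filter.Eventually.of_forall fun ω => by
      have := exp_neg_le_quadratic (mul_nonneg hy0 (hX0 ω))
      rw [← neg_mul] at this
      refine this.trans_eq ?_
      ring)
  have h4 : ∫ ω, (1 - y * X ω + y ^ 2 / 2 * X ω ^ 2) ∂μ =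
      1 - y * Z + y ^ 2 / 2 * ∫ ω, X ω ^ 2 ∂μ := by
    have h5 : Integrable (fun ω => 1 - y * X ω) μ := (integrable_const 1).sub (hi1.const_mul y)
    rw [integral_add h5 (hi2.const_mul (y ^ 2 / 2)),
      integral_sub (integrable_const 1) (hi1.const_mul y), integral_const_mul, integral_const_mul, hXZ]
    simp
  rw [h4] at h3
  refine h3.trans ?_
  have h5 : y ^ 2 / 2 * ∫ ω, X ω ^ 2 ∂μ ≤ (y * Z) ^ 2 := by
    calc _ ≤ y ^ 2 / 2 * (2 * Z ^ 2) := by gcongr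
      _ = _ := by ring
  have := Real.add_one_le_exp (-(y * Z) + (y * Z) ^ 2)
  linarith

lemma measureReal_le_of_integral_exp_le {Ω : Type*} [MeasurableSpace Ω] (μ : Measure Ω)
    [IsProbabilityMeasure μ] {X : Ω → ℝ} (hXm : Measurable X) (hX0 : ∀ ω, 0 ≤ X ω) {x a b : ℝ}
    (hx : 0 ≤ x) (h : ∫ ω, Real.exp (-x * X ω) ∂μ ≤ Real.exp b) :
    μ.real {ω | X ω ≤ a} ≤ Real.exp (b + x * a) := by
  have hiE : Integrable (fun ω => Real.exp (-x * X ω)) μ :=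
    Integrable.of_bound (hXm.const_mul _).exp.aestronglyMeasurable 1
      (Filter.Eventually.of_forall fun ω => by
        have h1 := mul_nonneg hx (hX0 ω)
        rw [Real.norm_of_nonneg (Real.exp_pos _).le, Real.exp_le_one_iff]
        linarith)
  have hmk := mul_meas_ge_le_integral_of_nonneg (μ := μ) (f := fun ω => Real.exp (-x * X ω))
    (Filter.Eventually.of_forall fun U => (Real.exp_pos _).le) hiE (Real.exp (-(x * a)))
  have hsub : μ.real {ω | X ω ≤ a} ≤ μ.real {ω | Real.exp (-(x * a)) ≤ Real.exp (-x * X ω)} := by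
    refine measureReal_mono fun ω (hω : X ω ≤ a) => Real.exp_le_exp.2 ?_
    have : x * X ω ≤ x * a := by gcongr
    linarith
  refine hsub.trans ?_
  have h7 := hmk.trans h
  rw [← le_div_iff₀' (Real.exp_pos _), ← Real.exp_sub, sub_neg_eq_add] at h7
  exact h7

/-- Lower tail for averages over a random subspace. -/
lemma measure_avg_le_le [Nonempty θ] [Nonempty R] {f : (ι → ℝ) → ℝ} (hf : Homog f)
    (hf0 : ∀ x, 0 ≤ f x) {Z : ℝ} (hZ : ∫ x, f x ∂gauss ι = Z) (hZ0 : 0 < Z) {E : Matrix ι κ ℝ}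
    (hE : Eᵀ * E = 1) {J : Matrix ι θ ℝ} (hJ : Jᵀ * J = 1)
    (hcard : Fintype.card R * Fintype.card θ ≤ Fintype.card κ)
    (h2 : ∫ V : O ι, avg f ((V : Matrix ι ι ℝ) * J) ^ 2 ∂haarO ι ≤ 2 * Z ^ 2) :
    (haarO ι).real {U : O ι | avg f ((U : Matrix ι ι ℝ) * E) ≤ 0.95 * Z} ≤
      Real.exp (-(Fintype.card R / 1600)) := by
  obtain ⟨C, hC⟩ := hf.bdd
  obtain ⟨X, hX⟩ : ∃ X : O ι → ℝ, ∀ V : O ι, X V = avg f ((V : Matrix ι ι ℝ) * J) := ⟨_, fun _ => rfl⟩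
  have hXm : Measurable X := by
    rw [funext hX]
    exact hf.measurable_avg measurable_id J
  have hXC : ∀ V, |X V| ≤ C := fun V => by rw [hX]; exact abs_avg_le hC _
  have hX0 : ∀ V, 0 ≤ X V := fun V => by rw [hX]; exact integral_nonneg fun _ => hf0 _
  have hXZ : ∫ V, X V ∂haarO ι = Z := by
    rw [← hZ, ← integral_avg_eq hf hJ]
    simp only [hX]
  simp only [← hX] at h2
  have hi1 : Integrable X (haarO ι) :=
    Integrable.of_bound hXm.aestronglyMeasurable C (Filter.Eventually.of_forall hXC)
  have hi2 : Integrable (fun V => X V ^ 2) (haarO ι) :=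
    Integrable.of_bound (hXm.pow_const 2).aestronglyMeasurable (C ^ 2)
      (Filter.Eventually.of_forall fun V => by
        rw [norm_pow]
        exact pow_le_pow_left₀ (norm_nonneg _) (hXC V) 2)
  obtain ⟨y, hy⟩ : ∃ y : ℝ, y = 1 / (40 * Z) := ⟨_, rfl⟩
  have hy0 : 0 ≤ y := by rw [hy]; positivity
  have hyZ : y * Z = 1 / 40 := by rw [hy]; field_simp
  have hsmall := integral_exp_neg_mul_le (haarO ι) hX0 hi1 hi2 hy0 hXZ h2
  have hexp := integral_exp_avg_le (R := R) hf hf0 hE hJ hcard hy0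
  simp only [← hX] at hexp
  have hexp' := hexp.trans (pow_le_pow_left₀ (integral_nonneg fun _ => (Real.exp_pos _).le) hsmall _)
  rw [← Real.exp_nat_mul] at hexp'
  refine (measureReal_le_of_integral_exp_le (haarO ι) (X := fun U : O ι => avg f ((U : Matrix ι ι ℝ) * E))
    (hf.measurable_avg measurable_id E) (fun U => integral_nonneg fun _ => hf0 _) (by positivity)
    hexp' (a := 0.95 * Z)).trans_eq ?_
  rw [show (Fintype.card R : ℝ) * y * (0.95 * Z) = Fintype.card R * (0.95 * (y * Z)) by ring, hyZ]
  congr 1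
  ring

/-- Upper tail for averages over a random subspace, from a moment bound. -/
lemma measure_le_avg_le {f : (ι → ℝ) → ℝ} (hf : Homog f)
    (hf0 : ∀ x, 0 ≤ f x) {Z t M : ℝ} (hZ0 : 0 < Z) (ht : 0 < t) (p : ℕ) (E : Matrix ι κ ℝ)
    (h : ∫ U : O ι, avg f ((U : Matrix ι ι ℝ) * E) ^ p ∂haarO ι ≤ M * Z ^ p) :
    (haarO ι).real {U : O ι | t * Z ≤ avg f ((U : Matrix ι ι ℝ) * E)} ≤ M / t ^ p := by
  obtain ⟨C, hC⟩ := hf.bdd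
  have hav0 : ∀ U : O ι, 0 ≤ avg f ((U : Matrix ι ι ℝ) * E) := fun V => integral_nonneg fun _ => hf0 _
  have hi : Integrable (fun V : O ι => avg f ((V : Matrix ι ι ℝ) * E) ^ p) (haarO ι) :=
    Integrable.of_bound ((hf.measurable_avg measurable_id E).pow_const p).aestronglyMeasurable (C ^ p)
      (Filter.Eventually.of_forall fun V => by
        rw [norm_pow]
        exact pow_le_pow_left₀ (norm_nonneg _) (abs_avg_le hC _) p)
  have hmk := mul_meas_ge_le_integral_of_nonneg (μ := haarO ι)
    (Filter.Eventually.of_forall fun U => pow_nonneg (hav0 U) p) hi ((t * Z) ^ p)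
  have hsub : (haarO ι).real {U : O ι | t * Z ≤ avg f ((U : Matrix ι ι ℝ) * E)} ≤
      (haarO ι).real {U : O ι | (t * Z) ^ p ≤ avg f ((U : Matrix ι ι ℝ) * E) ^ p} :=
    measureReal_mono fun U (hU : t * Z ≤ avg f ((U : Matrix ι ι ℝ) * E)) =>
      pow_le_pow_left₀ (by positivity) hU p
  refine hsub.trans ?_
  have h7 := hmk.trans h
  rw [← le_div_iff₀' (by positivity)] at h7
  refine h7.trans_eq ?_
  rw [mul_pow]
  field_simp

end Tails

section Concentration
variable {ι : Type*} [Fintype ι] [DecidableEq ι]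

lemma exp_mul_div_pow_le {x : ℝ} {p : ℕ} (hx : x ≤ 0.01 * p) :
    Real.exp x / 1.05 ^ p ≤ Real.exp (-(0.03 * p)) := by
  have h1 : Real.exp 0.04 ≤ 1.05 := by
    have h := Real.one_sub_le_exp_neg 0.04
    rw [Real.exp_neg] at h
    rw [← inv_inv (Real.exp 0.04)]
    calc _ ≤ (1 - 0.04 : ℝ)⁻¹ := inv_anti₀ (by norm_num) h
      _ ≤ _ := by norm_num
  rw [div_le_iff₀ (by positivity)]
  calc Real.exp x ≤ Real.exp (-(0.03 * p)) * Real.exp 0.04 ^ p := by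
        rw [← Real.exp_nat_mul, ← Real.exp_add]
        exact Real.exp_le_exp.2 (by linarith)
    _ ≤ _ := by gcongr

/-- Averages over random subspaces of proportional dimension concentrate around the mean. -/
lemma measure_avg_far_le {f : (ι → ℝ) → ℝ} (hf : Homog f) {lo L N Z : ℝ} (hlo0 : 0 < lo)
    (hlo : ∀ x, lo ≤ f x) (hL0 : 0 ≤ L) (hhi : ∀ x, f x ≤ Real.exp L * lo) (hN : 40000 ≤ N)
    (hLN : L ≤ N / 1000) (hZ : ∫ x, f x ∂gauss ι = Z) {k : ℕ} (hk : N ^ 3 ≤ 10 * k)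
    (hkn : k ≤ Fintype.card ι) {W : Matrix ι (Fin k) ℝ} (hW : Wᵀ * W = 1) :
    (haarO ι).real {U : O ι | avg f ((U : Matrix ι ι ℝ) * W) ≤ 0.95 * Z ∨
      1.05 * Z ≤ avg f ((U : Matrix ι ι ℝ) * W)} ≤ 3 * Real.exp (-(N / 1600)) := by
  have hf0 : ∀ x, 0 ≤ f x := fun x => hlo0.le.trans (hlo x)
  have hZ0 : 0 < Z := by
    have h := integral_mono (μ := gauss ι) (integrable_const lo)
      (hf.integrable (gauss ι) measurable_id) fun x => hlo _
    rw [integral_const, probReal_univ, one_smul] at h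
    exact hlo0.trans_le (h.trans_eq hZ)
  obtain ⟨Δ, hΔ⟩ : ∃ Δ : ℝ, Δ = (4 * L + 1) ^ 2 := ⟨_, rfl⟩
  have hΔ0 : 0 ≤ Δ := by rw [hΔ]; positivity
  have hΔN : Δ ≤ N ^ 2 / 40000 := by
    have h1 : 4 * L + 1 ≤ N / 200 := by linarith
    rw [hΔ]
    calc _ ≤ (N / 200) ^ 2 := pow_le_pow_left₀ (by positivity) h1 2
      _ = _ := by ring
  obtain ⟨p, hp⟩ : ∃ p : ℕ, p = ⌊N⌋₊ := ⟨_, rfl⟩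
  have hpN : (p : ℝ) ≤ N := by rw [hp]; exact Nat.floor_le (by linarith)
  have hNp : N - 1 ≤ p := by
    have := Nat.lt_floor_add_one N
    rw [hp]; linarith
  have hp1 : (1 : ℝ) ≤ p := by linarith
  have hk11 : N ^ 3 / 11 ≤ (k : ℝ) - 2 := by nlinarith [sq_nonneg N]
  have hN3 : 0 < N ^ 3 := by positivity
  have hN2 : 40000 * N ≤ N ^ 2 := by nlinarith
  have hN32 : 40000 * N ^ 2 ≤ N ^ 3 := by nlinarith [sq_nonneg N]
  have hk3 : 3 ≤ k := by
    have : (3 : ℝ) ≤ k := by linarith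
    exact_mod_cast this
  have hupper : (haarO ι).real {U : O ι | 1.05 * Z ≤ avg f ((U : Matrix ι ι ℝ) * W)} ≤
      Real.exp (-(0.03 * p)) := by
    have h1 := integral_avg_pow_le hf hlo0 hlo hL0 hhi (p := p) hk3 (by linarith)
      (by
        rw [← hΔ]
        have h2 : 32 * p * (Δ + p) ≤ 32 * N * (N ^ 2 + N) := by gcongr; linarith
        have h3 : (N ^ 3 / 11) ^ 2 ≤ ((k : ℝ) - 1) ^ 2 := pow_le_pow_left₀ (by positivity) (by linarith) 2
        nlinarith) hkn hW
    rw [hZ, ← hΔ] at h1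
    refine (measure_le_avg_le hf hf0 hZ0 (by norm_num) p W h1).trans (exp_mul_div_pow_le ?_)
    rw [div_le_iff₀ (by linarith)]
    have h2 : p * (Δ + p) ≤ N * (N ^ 2 / 40000 + N) := by gcongr
    calc 16 * (p : ℝ) ^ 2 * (Δ + p) = 16 * p * (p * (Δ + p)) := by ring
      _ ≤ 16 * p * (N * (N ^ 2 / 40000 + N)) := by gcongr
      _ ≤ 16 * p * (0.01 / 16 * (N ^ 3 / 11)) :=
          mul_le_mul_of_nonneg_left (by linarith) (by positivity)
      _ = 0.01 * p * (N ^ 3 / 11) := by ring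
      _ ≤ _ := by gcongr
  have hp0 : 0 < p := by exact_mod_cast (by linarith : (0 : ℝ) < p)
  obtain ⟨d, hd⟩ : ∃ d : ℕ, d = k / p := ⟨_, rfl⟩
  have hpd : p * d ≤ k := by rw [hd]; exact Nat.mul_div_le k p
  have hd11 : N ^ 2 / 11 ≤ (d : ℝ) - 2 := by
    have h1 : (k : ℝ) < p * (d + 1) := by
      rw [hd]
      exact_mod_cast Nat.lt_mul_div_succ k hp0
    have h2 : (p : ℝ) * (d + 1) ≤ N * (d + 1) := by gcongr
    have h3 : N * (N ^ 2 / 10) ≤ N * ((d : ℝ) + 1) := by nlinarith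
    have h4 := le_of_mul_le_mul_left h3 (by linarith)
    nlinarith
  have hd3 : 3 ≤ d := by
    have : (3 : ℝ) ≤ d := by linarith
    exact_mod_cast this
  have hdk : d ≤ k := by rw [hd]; exact Nat.div_le_self k p
  have hlower : (haarO ι).real {U : O ι | avg f ((U : Matrix ι ι ℝ) * W) ≤ 0.95 * Z} ≤
      Real.exp (-(p / 1600)) := by
    have hJ : (W * inclMatrix (Fin.castLEEmb hdk))ᵀ * (W * inclMatrix (Fin.castLEEmb hdk)) = 1 :=
      isometry_mul hW (inclMatrix_isometry (Fin.castLEEmb hdk))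
    have h1 := integral_avg_pow_le hf hlo0 hlo hL0 hhi (p := 2) hd3 (by push_cast; linarith)
      (by
        rw [← hΔ]
        have h3 : (N ^ 2 / 11) ^ 2 ≤ ((d : ℝ) - 1) ^ 2 := pow_le_pow_left₀ (by positivity) (by linarith) 2
        push_cast
        nlinarith) (hdk.trans hkn) hJ
    rw [hZ, ← hΔ] at h1
    have h2 : Real.exp (16 * ((2 : ℕ) : ℝ) ^ 2 * (Δ + ((2 : ℕ) : ℝ)) / ((d : ℝ) - 2)) ≤ 2 := by
      have h3 : 16 * ((2 : ℕ) : ℝ) ^ 2 * (Δ + ((2 : ℕ) : ℝ)) / ((d : ℝ) - 2) ≤ 1 / 2 := by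
        rw [div_le_iff₀ (by linarith)]
        push_cast
        nlinarith
      have h4 := Real.one_sub_le_exp_neg (1 / 2)
      rw [Real.exp_neg] at h4
      calc _ ≤ Real.exp (1 / 2) := Real.exp_le_exp.2 h3
        _ = ((Real.exp (1 / 2))⁻¹)⁻¹ := (inv_inv _).symm
        _ ≤ (1 - 1 / 2 : ℝ)⁻¹ := inv_anti₀ (by norm_num) h4
        _ = 2 := by norm_num
    have : Nonempty (Fin d) := ⟨⟨0, by omega⟩⟩
    have : Nonempty (Fin p) := ⟨⟨0, hp0⟩⟩
    have h5 := measure_avg_le_le (R := Fin p) hf hf0 hZ hZ0 hW hJ (by simpa using hpd)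
      (h1.trans (by gcongr))
    simpa using h5
  have hunion := measureReal_union_le (μ := haarO ι)
    {U : O ι | avg f ((U : Matrix ι ι ℝ) * W) ≤ 0.95 * Z}
    {U : O ι | 1.05 * Z ≤ avg f ((U : Matrix ι ι ℝ) * W)}
  refine (hunion.trans (add_le_add hlower hupper)).trans ?_
  have h6 : Real.exp (-(0.03 * p)) ≤ Real.exp (-((N - 1) / 1600)) := Real.exp_le_exp.2 (by linarith)
  have h7 : Real.exp (-(p / 1600)) ≤ Real.exp (-((N - 1) / 1600)) := Real.exp_le_exp.2 (by linarith)
  have h8 : Real.exp (-((N - 1) / 1600)) = Real.exp (1 / 1600) * Real.exp (-(N / 1600)) := by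
    rw [← Real.exp_add]; ring_nf
  have h9 : Real.exp (1 / 1600) ≤ 3 / 2 := by
    have h4 := Real.one_sub_le_exp_neg (1 / 1600)
    rw [Real.exp_neg] at h4
    rw [← inv_inv (Real.exp (1 / 1600))]
    calc _ ≤ (1 - 1 / 1600 : ℝ)⁻¹ := inv_anti₀ (by norm_num) h4
      _ ≤ _ := by norm_num
  have h10 := mul_le_mul_of_nonneg_right h9 (Real.exp_pos (-(N / 1600))).le
  linarith

end Concentration

section Sphere

open scoped Pointwise

/-- The cone over a subset of the sphere. -/
def cone {n : ℕ} (A : Set (sphere (0 : EuclideanSpace ℝ (Fin n)) 1)) : Set (Fin n → ℝ) :=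
  {x | ‖WithLp.toLp 2 x‖⁻¹ • WithLp.toLp 2 x ∈ Subtype.val '' A}

lemma measurableSet_cone {n : ℕ} {A : Set (sphere (0 : EuclideanSpace ℝ (Fin n)) 1)}
    (hA : MeasurableSet A) : MeasurableSet (cone A) := by
  have h1 : MeasurableSet (Subtype.val '' A) :=
    (MeasurableEmbedding.subtype_coe isClosed_sphere.measurableSet).measurableSet_image.2 hA
  have h2 : Measurable fun x : Fin n → ℝ => WithLp.toLp 2 x := by fun_prop
  exact (h2.norm.inv.smul h2) h1

lemma smul_mem_cone_iff {n : ℕ} {A : Set (sphere (0 : EuclideanSpace ℝ (Fin n)) 1)} {t : ℝ}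
    (ht : 0 < t) (x : Fin n → ℝ) : t • x ∈ cone A ↔ x ∈ cone A := by
  have h : ‖WithLp.toLp 2 (t • x)‖⁻¹ • WithLp.toLp 2 (t • x) =
      ‖WithLp.toLp 2 x‖⁻¹ • WithLp.toLp 2 x := by
    rw [WithLp.toLp_smul, norm_smul, Real.norm_of_nonneg ht.le, smul_smul]
    congr 1
    field_simp
  simp only [cone, Set.mem_ofPred_eq, h]

lemma homog_indicator_cone {n : ℕ} {A : Set (sphere (0 : EuclideanSpace ℝ (Fin n)) 1)}
    (hA : MeasurableSet A) : Homog ((cone A).indicator fun _ => (1 : ℝ)) where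
  meas := measurable_const.indicator (measurableSet_cone hA)
  homog t x ht := by
    have h := smul_mem_cone_iff (A := A) ht x
    by_cases hx : x ∈ cone A
    · rw [Set.indicator_of_mem hx, Set.indicator_of_mem (h.2 hx)]
    · rw [Set.indicator_of_notMem hx, Set.indicator_of_notMem (mt h.1 hx)]
  bdd := ⟨1, fun x => by by_cases h : x ∈ cone A <;> simp [h]⟩

lemma Ioo_smul_image_eq {n : ℕ} (A : Set (sphere (0 : EuclideanSpace ℝ (Fin n)) 1)) :
    WithLp.toLp 2 ⁻¹' (Set.Ioo (0 : ℝ) 1 • (Subtype.val '' A)) = cone A ∩ {x | ‖WithLp.toLp 2 x‖ < 1} := by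
  ext x
  simp only [Set.mem_preimage, Set.mem_smul, Set.mem_inter_iff, cone, Set.mem_ofPred_eq]
  constructor
  · rintro ⟨t, ht, y, ⟨a, ha, rfl⟩, hx⟩
    have hn : ‖(a : EuclideanSpace ℝ (Fin n))‖ = 1 := mem_sphere_zero_iff_norm.1 a.2
    have h1 : ‖WithLp.toLp 2 x‖ = t := by
      rw [← hx, norm_smul, hn, mul_one, Real.norm_of_nonneg ht.1.le]
    refine ⟨⟨a, ha, ?_⟩, h1 ▸ ht.2⟩
    rw [h1, ← hx, smul_smul, inv_mul_cancel₀ ht.1.ne', one_smul]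
  · rintro ⟨⟨a, ha, hax⟩, hx⟩
    have hn : ‖(a : EuclideanSpace ℝ (Fin n))‖ = 1 := mem_sphere_zero_iff_norm.1 a.2
    have hpos : 0 < ‖WithLp.toLp 2 x‖ := by
      refine lt_of_le_of_ne (norm_nonneg _) fun h0 => ?_
      rw [← h0, _root_.inv_zero, zero_smul] at hax
      rw [hax, norm_zero] at hn
      exact zero_ne_one hn
    refine ⟨_, ⟨hpos, hx⟩, a, ⟨a, ha, rfl⟩, ?_⟩
    rw [hax, smul_smul, mul_inv_cancel₀ hpos.ne', one_smul]

lemma norm_toLp_mulVec {n d : ℕ} {E : Matrix (Fin n) (Fin d) ℝ} (hE : Eᵀ * E = 1) (x : Fin d → ℝ) :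
    ‖WithLp.toLp 2 (E *ᵥ x)‖ = ‖WithLp.toLp 2 x‖ := by
  have h : ∀ {k : ℕ} (y : Fin k → ℝ), ‖WithLp.toLp 2 y‖ ^ 2 = y ⬝ᵥ y := fun y => by
    rw [EuclideanSpace.real_norm_sq_eq]
    simp [dotProduct, pow_two]
  have h2 := dotProduct_mulVec_self hE x x
  rw [← h, ← h] at h2
  exact (pow_left_inj₀ (norm_nonneg _) (norm_nonneg _) two_ne_zero).1 h2

lemma measurePreserving_volume_O {n : ℕ} (V : O (Fin n)) :
    MeasurePreserving (fun x : Fin n → ℝ => (V : Matrix (Fin n) (Fin n) ℝ) *ᵥ x) volume volume := by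
  have hdet : |(V : Matrix (Fin n) (Fin n) ℝ).det| = 1 := by
    have h := congrArg Matrix.det (O_transpose_mul V)
    rw [det_mul, det_transpose, det_one] at h
    exact (pow_eq_one_iff_of_nonneg (abs_nonneg _) two_ne_zero).1 (by rw [sq_abs, pow_two, h])
  refine ⟨measurable_mulVec _, ?_⟩
  have h := Real.map_matrix_volume_pi_eq_smul_volume_pi (M := (V : Matrix (Fin n) (Fin n) ℝ))
    (fun h0 => by rw [h0] at hdet; simp at hdet)
  rw [abs_inv, hdet, inv_one, ENNReal.ofReal_one, one_smul] at h
  exact h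

/-- The uniform measure on the sphere in terms of Gaussian vectors. -/
lemma uSphere_toReal {n : ℕ} [NeZero n] {A : Set (sphere (0 : EuclideanSpace ℝ (Fin n)) 1)}
    (hA : MeasurableSet A) :
    (uSphere n A).toReal = ∫ x, (cone A).indicator (fun _ => (1 : ℝ)) x ∂gauss (Fin n) := by
  have : Nontrivial (EuclideanSpace ℝ (Fin n)) := inferInstance
  obtain ⟨b, hb⟩ : ∃ b : Set (Fin n → ℝ), b = {x | ‖WithLp.toLp 2 x‖ < 1} := ⟨_, rfl⟩
  have hbm : MeasurableSet b := by
    rw [hb]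
    exact measurableSet_lt (by fun_prop) measurable_const
  have hmp := PiLp.volume_preserving_toLp (Fin n)
  have hball : (volume : Measure (EuclideanSpace ℝ (Fin n))) (ball 0 1) = volume b := by
    rw [← hmp.measure_preimage measurableSet_ball.nullMeasurableSet, hb]
    congr 1
    ext x
    simp
  have hAmeas : (volume : Measure (EuclideanSpace ℝ (Fin n))) (Set.Ioo (0 : ℝ) 1 • (Subtype.val '' A)) =
      volume (cone A ∩ b) := by
    have hemb := (MeasurableEquiv.toLp 2 (Fin n → ℝ)).measurableEmbedding
    rw [hb, ← Ioo_smul_image_eq]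
    exact (hmp.measure_preimage_emb hemb _).symm
  have hb0 : volume b ≠ 0 := by rw [← hball]; exact (measure_ball_pos _ _ one_pos).ne'
  have hbt : volume b ≠ ⊤ := by rw [← hball]; exact measure_ball_lt_top.ne
  have hA' : uSphere n A = (volume b)⁻¹ * volume (cone A ∩ b) := by
    rw [uSphere, Measure.smul_apply, smul_eq_mul, Measure.toSphere_apply_univ,
      Measure.toSphere_apply' _ hA, hball, hAmeas, finrank_euclideanSpace_fin,
      ENNReal.mul_inv (Or.inr hbt) (Or.inr hb0), mul_comm ((n : ℝ≥0∞)⁻¹), mul_assoc,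
      ← mul_assoc (n : ℝ≥0∞)⁻¹, ENNReal.inv_mul_cancel (by simp [NeZero.ne n]) (by simp), one_mul]
  have hw : Integrable (b.indicator fun _ => (1 : ℝ)) (volume : Measure (Fin n → ℝ)) :=
    (integrable_indicator_iff hbm).2 (integrableOn_const hbt)
  have h1 := (homog_indicator_cone hA).integral_mul_invariant (volume : Measure (Fin n → ℝ))
    (measure_singleton 0) measurePreserving_volume_O (measurable_const.indicator hbm) hw
    (fun V x => by
      have h2 : (V : Matrix (Fin n) (Fin n) ℝ) *ᵥ x ∈ b ↔ x ∈ b := by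
        rw [hb, Set.mem_ofPred_eq, Set.mem_ofPred_eq, norm_toLp_mulVec (O_transpose_mul V)]
      by_cases hx : x ∈ b
      · rw [Set.indicator_of_mem hx, Set.indicator_of_mem (h2.2 hx)]
      · rw [Set.indicator_of_notMem hx, Set.indicator_of_notMem (mt h2.1 hx)])
  have h3 : ∀ x, (cone A).indicator (fun _ => (1 : ℝ)) x * b.indicator (fun _ => 1) x =
      (cone A ∩ b).indicator (fun _ => 1) x := fun x => by
    by_cases hx : x ∈ cone A <;> by_cases hx' : x ∈ b <;> simp [hx, hx']
  simp only [h3] at h1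
  rw [integral_indicator_const _ ((measurableSet_cone hA).inter hbm), integral_indicator_const _ hbm,
    smul_eq_mul, smul_eq_mul, mul_one, mul_one] at h1
  have hbr : (volume b).toReal ≠ 0 := ENNReal.toReal_ne_zero.2 ⟨hb0, hbt⟩
  rw [hA', ENNReal.toReal_mul, ENNReal.toReal_inv]
  rw [measureReal_def, measureReal_def] at h1
  rw [h1, inv_mul_cancel_left₀ hbr]

end Sphere

section Transfer

variable {n d : ℕ}

/-- Every orthogonal projection of trace `d` is of the form `E * Eᵀ` for a `d`-frame `E`. -/
lemma exists_frame_grass (Q : Grass n d) :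
    ∃ E : Matrix (Fin n) (Fin d) ℝ, Eᵀ * E = 1 ∧ E * Eᵀ = Q.1 := by
  obtain ⟨Q, hs, hi, ht⟩ := Q
  have hproj : IsIdempotentElem (toLin' Q) := by
    rw [IsIdempotentElem, Module.End.mul_eq_comp, ← toLin'_mul, hi]
  have hrank : Module.finrank ℝ (LinearMap.range (toLin' Q)) = d := by
    have h := (LinearMap.IsIdempotentElem.isProj_range _ hproj).trace
    rw [trace_toLin'_eq, ht] at h
    exact_mod_cast h.symm
  have hdn : d ≤ n := by
    have h := Submodule.finrank_le (LinearMap.range (toLin' Q))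
    rwa [hrank, Module.finrank_fin_fun] at h
  have b := Module.finBasisOfFinrankEq ℝ (LinearMap.range (toLin' Q)) hrank
  obtain ⟨E, hE, hw⟩ := exists_frame_range (κ := Fin d) (fun t => (b t : Fin n → ℝ)) le_rfl
    (by simpa using hdn)
  refine ⟨E, hE, ?_⟩
  have h1 : ∀ v : LinearMap.range (toLin' Q), (E * Eᵀ) *ᵥ (v : Fin n → ℝ) = v := by
    intro v
    have h2 : (toLin' (E * Eᵀ)).comp (LinearMap.range (toLin' Q)).subtype =
        (LinearMap.range (toLin' Q)).subtype := b.ext fun t => by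
      simpa [← mulVec_mulVec] using hw t
    simpa using LinearMap.congr_fun h2 v
  have h2 : E * Eᵀ * Q = Q := by
    apply (toLin' (R := ℝ)).injective
    rw [toLin'_mul]
    exact LinearMap.ext fun x => h1 ⟨toLin' Q x, LinearMap.mem_range_self _ x⟩
  have h3 : Q * (E * Eᵀ) = Q := by
    have h := congrArg transpose h2
    rwa [transpose_mul, transpose_mul, transpose_transpose, hs.eq] at h
  have h4 : E * Eᵀ * (E * Eᵀ) = E * Eᵀ := by
    rw [Matrix.mul_assoc, ← Matrix.mul_assoc Eᵀ, hE, Matrix.one_mul]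
  have h5 : (E * Eᵀ - Q)ᴴ * (E * Eᵀ - Q) = E * Eᵀ - Q := by
    rw [conjTranspose_eq_transpose_of_trivial, transpose_sub, transpose_mul, transpose_transpose,
      hs.eq, Matrix.sub_mul, Matrix.mul_sub, Matrix.mul_sub, h2, h3, h4, hi]
    simp
  have h6 : (E * Eᵀ - Q).trace = 0 := by
    rw [trace_sub, trace_mul_comm, hE, ht]
    simp
  rw [← h5, trace_conjTranspose_mul_self_eq_zero_iff] at h6
  exact sub_eq_zero.1 h6

/-- The isometry of Euclidean spaces given by a frame. -/
noncomputable def frameIsometry (E : Matrix (Fin n) (Fin d) ℝ) (hE : Eᵀ * E = 1) :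
    EuclideanSpace ℝ (Fin d) →ₗᵢ[ℝ] EuclideanSpace ℝ (Fin n) where
  toFun v := WithLp.toLp 2 (E *ᵥ v.ofLp)
  map_add' v w := by simp [mulVec_add]
  map_smul' t v := by simp [mulVec_smul]
  norm_map' v := norm_toLp_mulVec hE v.ofLp

lemma mem_range_frameIsometry {E : Matrix (Fin n) (Fin d) ℝ} (hE : Eᵀ * E = 1)
    (v : EuclideanSpace ℝ (Fin n)) :
    v ∈ LinearMap.range (frameIsometry E hE).toLinearMap ↔ (E * Eᵀ) *ᵥ v.ofLp = v.ofLp := by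
  constructor
  · rintro ⟨w, rfl⟩
    change (E * Eᵀ) *ᵥ (E *ᵥ w.ofLp) = E *ᵥ w.ofLp
    rw [mulVec_mulVec, Matrix.mul_assoc, hE, Matrix.mul_one]
  · intro h
    refine ⟨WithLp.toLp 2 (Eᵀ *ᵥ v.ofLp), ?_⟩
    change WithLp.toLp 2 (E *ᵥ (Eᵀ *ᵥ v.ofLp)) = v
    rw [mulVec_mulVec, h]

lemma mem_cone_iff {A : Set (sphere (0 : EuclideanSpace ℝ (Fin n)) 1)} (x : Fin n → ℝ) :
    x ∈ cone A ↔ ∃ h : ‖WithLp.toLp 2 x‖⁻¹ • WithLp.toLp 2 x ∈ sphere (0 : EuclideanSpace ℝ (Fin n)) 1,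
      (⟨_, h⟩ : sphere (0 : EuclideanSpace ℝ (Fin n)) 1) ∈ A := by
  simp [cone]

lemma cone_sphereMap {A : Set (sphere (0 : EuclideanSpace ℝ (Fin n)) 1)}
    {E : Matrix (Fin n) (Fin d) ℝ} (hE : Eᵀ * E = 1) (z : Fin d → ℝ) :
    z ∈ cone {ω | sphereMap (frameIsometry E hE) ω ∈ A} ↔ E *ᵥ z ∈ cone A := by
  have h1 : WithLp.toLp 2 (E *ᵥ z) = frameIsometry E hE (WithLp.toLp 2 z) := rfl
  have h2 : ‖WithLp.toLp 2 (E *ᵥ z)‖⁻¹ • WithLp.toLp 2 (E *ᵥ z) =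
      frameIsometry E hE (‖WithLp.toLp 2 z‖⁻¹ • WithLp.toLp 2 z) := by
    rw [h1, LinearIsometry.norm_map, map_smul]
  rw [mem_cone_iff, mem_cone_iff]
  constructor
  · rintro ⟨h, h'⟩
    have h3 := (sphereMap (frameIsometry E hE) ⟨_, h⟩).2
    change sphereMap (frameIsometry E hE) ⟨_, h⟩ ∈ A at h'
    refine ⟨h2 ▸ h3, ?_⟩
    convert h' using 1
    exact Subtype.ext h2
  · rintro ⟨h, h'⟩
    have h3 : ‖WithLp.toLp 2 z‖⁻¹ • WithLp.toLp 2 z ∈ sphere (0 : EuclideanSpace ℝ (Fin d)) 1 := by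
      rw [h2, mem_sphere_zero_iff_norm, LinearIsometry.norm_map] at h
      exact mem_sphere_zero_iff_norm.2 h
    refine ⟨h3, ?_⟩
    change sphereMap _ _ ∈ A
    convert h' using 1
    exact Subtype.ext h2.symm

lemma measurable_sphereMap (e : EuclideanSpace ℝ (Fin d) →ₗᵢ[ℝ] EuclideanSpace ℝ (Fin n)) :
    Measurable (sphereMap e) :=
  (e.continuous.measurable.comp measurable_subtype_coe).subtype_mk

/-- The proportion of a subsphere covered by `A` is a Gaussian average over a frame. -/
lemma uSphere_sphereMap_toReal [NeZero d] {A : Set (sphere (0 : EuclideanSpace ℝ (Fin n)) 1)}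
    (hA : MeasurableSet A) {E : Matrix (Fin n) (Fin d) ℝ} (hE : Eᵀ * E = 1) :
    (uSphere d {ω | sphereMap (frameIsometry E hE) ω ∈ A}).toReal =
      avg ((cone A).indicator fun _ => 1) E := by
  have hB : MeasurableSet {ω | sphereMap (frameIsometry E hE) ω ∈ A} := measurable_sphereMap _ hA
  rw [uSphere_toReal hB, avg]
  refine integral_congr_ae (Filter.Eventually.of_forall fun z => ?_)
  have h := cone_sphereMap (A := A) hE z
  by_cases hz : E *ᵥ z ∈ cone A
  · simp only [Set.indicator_of_mem hz, Set.indicator_of_mem (h.2 hz)]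
  · simp only [Set.indicator_of_notMem hz, Set.indicator_of_notMem (mt h.1 hz)]

lemma avg_eq_integral_proj {f : (Fin n → ℝ) → ℝ} (hf : Homog f) {E : Matrix (Fin n) (Fin d) ℝ}
    (hE : Eᵀ * E = 1) : avg f E = ∫ x, f ((E * Eᵀ) *ᵥ x) ∂gauss (Fin n) := by
  have h := measurePreserving_gauss hE
  rw [avg, ← h.map_eq, integral_map h.measurable.aemeasurable
    (hf.comp_mulVec E).meas.aestronglyMeasurable]
  simp only [mulVec_mulVec]

lemma measurable_grass_entry (i j : Fin n) : Measurable fun Q : Grass n d => Q.1 i j := by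
  have h : @Measurable (Grass n d) (Fin n → Fin n → ℝ) _ _ Subtype.val := measurable_subtype_coe
  exact (measurable_pi_apply j).comp ((measurable_pi_apply i).comp h)

lemma measurable_integral_proj {f : (Fin n → ℝ) → ℝ} (hf : Measurable f) :
    Measurable fun Q : Grass n d => ∫ x, f (Q.1 *ᵥ x) ∂gauss (Fin n) := by
  have hm : Measurable fun p : Grass n d × (Fin n → ℝ) => p.1.1 *ᵥ p.2 := by
    refine measurable_pi_lambda _ fun i => ?_
    simp only [mulVec, dotProduct]
    refine Finset.measurable_sum _ fun j _ => Measurable.mul ?_ ?_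
    · exact (measurable_grass_entry i j).comp measurable_fst
    · exact (measurable_pi_apply j).comp measurable_snd
  have h : Measurable (Function.uncurry fun (Q : Grass n d) x => f (Q.1 *ᵥ x)) := hf.comp hm
  exact h.stronglyMeasurable.integral_prod_right.measurable

/-- The action of an orthogonal matrix on the Grassmannian. -/
def rotate (U : O (Fin n)) (Q : Grass n d) : Grass n d :=
  ⟨(U : Matrix (Fin n) (Fin n) ℝ) * Q.1 * (U : Matrix (Fin n) (Fin n) ℝ)ᵀ, by
    obtain ⟨Q, hs, hi, ht⟩ := Q
    have hU := O_transpose_mul U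
    refine ⟨?_, ?_, ?_⟩
    · simp only [IsSymm, transpose_mul, transpose_transpose, hs.eq, Matrix.mul_assoc]
    · simp only [Matrix.mul_assoc]
      rw [← Matrix.mul_assoc _ᵀ, hU, Matrix.one_mul, ← Matrix.mul_assoc Q, hi]
    · rw [trace_mul_comm, ← Matrix.mul_assoc, hU, Matrix.one_mul, ht]⟩

lemma measurable_rotate : Measurable (Function.uncurry fun (U : O (Fin n)) (Q : Grass n d) => rotate U Q) := by
  refine Measurable.subtype_mk ?_
  refine measurable_pi_lambda _ fun i => measurable_pi_lambda _ fun j => ?_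
  simp only [mul_apply, transpose_apply]
  refine Finset.measurable_sum _ fun k _ => Measurable.mul (Finset.measurable_sum _ fun l _ =>
    Measurable.mul ?_ ?_) ?_
  · exact (measurable_O_entry i l).comp measurable_fst
  · exact (measurable_grass_entry l k).comp measurable_snd
  · exact (measurable_O_entry j k).comp measurable_fst

/-- A set that a random rotation of any fixed subspace rarely hits has small invariant measure. -/
lemma measure_le_of_rotate (ν : Measure (Grass n d)) [IsProbabilityMeasure ν]
    (hν : ∀ U : O (Fin n), ν.map (rotate U) = ν) {B : Set (Grass n d)} (hB : MeasurableSet B)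
    {ε : ℝ≥0∞} (h : ∀ Q, haarO (Fin n) {U | rotate U Q ∈ B} ≤ ε) : ν B ≤ ε := by
  obtain ⟨R, hR⟩ : ∃ R : O (Fin n) → Grass n d → Grass n d, ∀ U Q, R U Q = rotate U Q :=
    ⟨_, fun _ _ => rfl⟩
  have hRm : Measurable (Function.uncurry R) := by
    have h : R = fun U Q => rotate U Q := funext fun U => funext fun Q => hR U Q
    rw [h]
    exact measurable_rotate
  have hm : MeasurableSet (Function.uncurry R ⁻¹' B) := hRm hB
  have h1 := Measure.prod_apply (μ := haarO (Fin n)) (ν := ν) hm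
  have h2 := Measure.prod_apply_symm (μ := haarO (Fin n)) (ν := ν) hm
  have h3 : ∀ U : O (Fin n), ν (Prod.mk U ⁻¹' (Function.uncurry R ⁻¹' B)) = ν B := fun U => by
    have hU : Measurable (R U) := hRm.of_uncurry_left
    have h4 := Measure.map_apply (μ := ν) hU hB
    rw [show R U = rotate U from funext (hR U), hν U] at h4
    rw [h4, ← show R U = rotate U from funext (hR U)]
    rfl
  simp only [← hR] at h
  simp only [h3, lintegral_const, measure_univ, mul_one] at h1
  rw [← h1, h2]
  calc _ ≤ ∫⁻ _ : Grass n d, ε ∂ν := lintegral_mono fun Q => h Q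
    _ = ε := by simp

end Transfer

section Main

variable {n d : ℕ}

lemma Homog.add_const {f : (Fin n → ℝ) → ℝ} (hf : Homog f) (s : ℝ) : Homog fun x => f x + s where
  meas := hf.meas.add_const s
  homog t x ht := by rw [hf.homog t x ht]
  bdd := by
    obtain ⟨C, hC⟩ := hf.bdd
    exact ⟨C + |s|, fun x => (abs_add_le _ _).trans (by linarith [hC x])⟩

lemma avg_add_const {f : (Fin n → ℝ) → ℝ} (hf : Homog f) (s : ℝ) (E : Matrix (Fin n) (Fin d) ℝ) :
    avg (fun x => f x + s) E = avg f E + s := by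
  have h : Integrable (fun z => f (E *ᵥ z)) (gauss (Fin d)) :=
    (hf.comp_mulVec E).integrable _ measurable_id
  rw [avg, integral_add h (integrable_const s)]
  simp [avg]

lemma uSphere_toReal_le_one [NeZero n] {A : Set (sphere (0 : EuclideanSpace ℝ (Fin n)) 1)}
    (hA : MeasurableSet A) : (uSphere n A).toReal ≤ 1 := by
  rw [uSphere_toReal hA, integral_indicator_const _ (measurableSet_cone hA)]
  simp [measureReal_le_one]

/-- A random rotation of a fixed frame samples `A` up to ten percent. -/
lemma measure_rotate_frame_le [NeZero n] {A : Set (sphere (0 : EuclideanSpace ℝ (Fin n)) 1)}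
    (hA : MeasurableSet A) {N s : ℝ} (hs : (uSphere n A).toReal = s) (hs0 : 0 < s)
    (hN : 40000 ≤ N) (hLN : Real.log (2 / s) ≤ N / 1000) (hd : N ^ 3 ≤ 10 * d) (hdn : d ≤ n)
    {E : Matrix (Fin n) (Fin d) ℝ} (hE : Eᵀ * E = 1) :
    haarO (Fin n) {U : O (Fin n) | 0.1 ≤ |avg ((cone A).indicator fun _ => 1)
      ((U : Matrix (Fin n) (Fin n) ℝ) * E) / s - 1|} ≤ ENNReal.ofReal (3 * Real.exp (-(N / 1600))) := by
  have hs1 : s ≤ 1 := hs ▸ uSphere_toReal_le_one hA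
  have hf := homog_indicator_cone hA
  have hZ : ∫ x, ((cone A).indicator (fun _ => (1 : ℝ)) x + s) ∂gauss (Fin n) = 2 * s := by
    have h : Integrable ((cone A).indicator fun _ => (1 : ℝ)) (gauss (Fin n)) :=
      hf.integrable _ measurable_id
    rw [integral_add h (integrable_const s), ← uSphere_toReal hA, hs]
    simp [two_mul]
  have hind : ∀ x, 0 ≤ (cone A).indicator (fun _ => (1 : ℝ)) x ∧
      (cone A).indicator (fun _ => (1 : ℝ)) x ≤ 1 := fun x => by
    by_cases hx : x ∈ cone A <;> simp [hx]
  have key := measure_avg_far_le (hf.add_const s) hs0 (L := Real.log (2 / s))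
    (fun x => by linarith [(hind x).1])
    (Real.log_nonneg (by rw [le_div_iff₀ hs0]; linarith))
    (fun x => by
      rw [Real.exp_log (by positivity), div_mul_cancel₀ _ hs0.ne']
      linarith [(hind x).2])
    hN hLN hZ hd (by simpa using hdn) hE
  rw [measureReal_def] at key
  refine (measure_mono fun U hU => ?_).trans ((ENNReal.le_ofReal_iff_toReal_le
    (measure_ne_top _ _) (by positivity)).2 key)
  rw [Set.mem_ofPred_eq] at hU ⊢
  rw [avg_add_const hf]
  generalize avg ((cone A).indicator fun _ => (1 : ℝ)) ((U : Matrix (Fin n) (Fin n) ℝ) * E) = a at hU ⊢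
  rcases le_abs'.1 hU with h | h
  · left
    have : a / s ≤ 0.9 := by linarith
    rw [div_le_iff₀ hs0] at this
    linarith
  · right
    have : 1.1 ≤ a / s := by linarith
    rw [le_div_iff₀ hs0] at this
    linarith

lemma measure_grass_le [NeZero n] [NeZero d] {A : Set (sphere (0 : EuclideanSpace ℝ (Fin n)) 1)}
    (hA : MeasurableSet A) {N s : ℝ} (hs : (uSphere n A).toReal = s) (hs0 : 0 < s)
    (hN : 40000 ≤ N) (hLN : Real.log (2 / s) ≤ N / 1000) (hd : N ^ 3 ≤ 10 * d) (hdn : d ≤ n)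
    (ν : Measure (Grass n d)) [IsProbabilityMeasure ν]
    (hν : ∀ U : O (Fin n), ν.map (rotate U) = ν) {F : Grass n d → ℝ}
    (hF : ∀ (Q : Grass n d) (e : EuclideanSpace ℝ (Fin d) →ₗᵢ[ℝ] EuclideanSpace ℝ (Fin n)),
      (∀ v : EuclideanSpace ℝ (Fin n), v ∈ LinearMap.range e.toLinearMap ↔ Q.1.mulVec v = v) →
      F Q = (uSphere d {ω | sphereMap e ω ∈ A}).toReal) :
    (ν {Q | 0.1 ≤ |F Q / s - 1|}).toReal ≤ 3 * Real.exp (-(N / 1600)) := by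
  have hFE : ∀ (Q : Grass n d) {E : Matrix (Fin n) (Fin d) ℝ}, Eᵀ * E = 1 → E * Eᵀ = Q.1 →
      F Q = avg ((cone A).indicator fun _ => 1) E := fun Q E hE hQ => by
    rw [hF Q (frameIsometry E hE) fun v => by rw [mem_range_frameIsometry, hQ]]
    exact uSphere_sphereMap_toReal hA hE
  have hf := homog_indicator_cone hA
  have hFm : Measurable F := by
    have h : F = fun Q : Grass n d => ∫ x, (cone A).indicator (fun _ => (1 : ℝ)) (Q.1 *ᵥ x) ∂gauss (Fin n) := by
      funext Q
      obtain ⟨E, hE, hQ⟩ := exists_frame_grass Q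
      rw [hFE Q hE hQ, avg_eq_integral_proj hf hE, hQ]
    rw [h]
    exact measurable_integral_proj hf.meas
  have hB : MeasurableSet {Q | 0.1 ≤ |F Q / s - 1|} :=
    measurableSet_le measurable_const ((hFm.div_const s).sub_const 1).abs
  refine ENNReal.toReal_le_of_le_ofReal (by positivity) (measure_le_of_rotate ν hν hB fun Q => ?_)
  obtain ⟨E, hE, hQ⟩ := exists_frame_grass Q
  have hrot : ∀ U : O (Fin n), F (rotate U Q) =
      avg ((cone A).indicator fun _ => 1) ((U : Matrix (Fin n) (Fin n) ℝ) * E) := fun U => by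
    refine hFE _ (isometry_mul (O_transpose_mul U) hE) ?_
    rw [transpose_mul, Matrix.mul_assoc, ← Matrix.mul_assoc E, hQ, ← Matrix.mul_assoc]
    rfl
  simp only [Set.mem_ofPred_eq, hrot]
  exact measure_rotate_frame_le hA hs hs0 hN hLN hd hdn hE

lemma constants {N s : ℝ} (hs1 : s ≤ 1)
    (hs : Real.exp 20 * Real.exp (-(1 / 2000) * N) ≤ s) :
    40000 ≤ N ∧ Real.log (2 / s) ≤ N / 1000 ∧
      3 * Real.exp (-(N / 1600)) ≤ Real.exp 20 * Real.exp (-(1 / 2000) * N) := by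
  rw [← Real.exp_add] at hs ⊢
  have hs0 : 0 < s := (Real.exp_pos _).trans_le hs
  have h1 : 20 + -(1 / 2000) * N ≤ Real.log s := (Real.le_log_iff_exp_le hs0).2 hs
  have h2 : Real.log s ≤ 0 := Real.log_nonpos hs0.le hs1
  have hN : 40000 ≤ N := by linarith
  have h3 : Real.log 2 ≤ 1 := by linarith [Real.log_two_lt_d9]
  refine ⟨hN, ?_, ?_⟩
  · rw [Real.log_div two_ne_zero hs0.ne']
    linarith
  · have h4 : (3 : ℝ) ≤ Real.exp 20 := by linarith [Real.add_one_le_exp (20 : ℝ)]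
    rw [Real.exp_add]
    exact mul_le_mul h4 (Real.exp_le_exp.2 (by linarith)) (Real.exp_pos _).le (Real.exp_pos _).le

end Main

end SubspaceSampling

/-- Sampling by lower-dimensional subspaces: there are universal constants `c, C > 0`
such that for `1 ≤ m ≤ 9n/10` and measurable `A ⊆ S^{n-1}` with
`σ(A) ≥ C exp(-c n^{1/3})`, a uniformly random `(n-m)`-dimensional subspace `H`
(i.e., `H` drawn from the rotation-invariant probability measure `ν` on the
Grassmannian) satisfies `|σ_H(A ∩ H)/σ(A) - 1| < 0.1` except with probability at
most `C exp(-c n^{1/3})`.  Here `F Q = σ_H(A ∩ H)` for the subspace `H` fixed by the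
projection `Q`, characterized through any isometric parametrization
`e : ℝ^{n-m} → ℝⁿ` of `H`. -/
theorem subspace_sampling :
    ∃ c : ℝ, 0 < c ∧ ∃ C : ℝ, 0 < C ∧
      ∀ (n m : ℕ), 1 ≤ m → 10 * m ≤ 9 * n →
      ∀ A : Set (sphere (0 : EuclideanSpace ℝ (Fin n)) 1), MeasurableSet A →
        C * Real.exp (-c * (n : ℝ) ^ ((1 : ℝ) / 3)) ≤ (uSphere n A).toReal →
      ∀ ν : Measure (Grass n (n - m)), IsProbabilityMeasure ν →
        (∀ U ∈ Matrix.orthogonalGroup (Fin n) ℝ, ∀ T : Grass n (n - m) → Grass n (n - m),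
          Measurable T → (∀ Q : Grass n (n - m), (T Q).1 = U * Q.1 * U.transpose) →
          ν.map T = ν) →
      ∀ F : Grass n (n - m) → ℝ,
        (∀ (Q : Grass n (n - m))
            (e : EuclideanSpace ℝ (Fin (n - m)) →ₗᵢ[ℝ] EuclideanSpace ℝ (Fin n)),
          (∀ v : EuclideanSpace ℝ (Fin n),
            v ∈ LinearMap.range e.toLinearMap ↔ Q.1.mulVec v = v) →
          F Q = (uSphere (n - m) {ω | sphereMap e ω ∈ A}).toReal) →
      (ν {Q | 0.1 ≤ |F Q / (uSphere n A).toReal - 1|}).toReal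
        ≤ C * Real.exp (-c * (n : ℝ) ^ ((1 : ℝ) / 3)) := by
  refine ⟨1 / 2000, by norm_num, Real.exp 20, Real.exp_pos _, ?_⟩
  intro n m hm hmn A hA hσ ν hν hinv F hF
  have : NeZero n := ⟨by omega⟩
  have : NeZero (n - m) := ⟨by omega⟩
  obtain ⟨hN, hL, h3⟩ := SubspaceSampling.constants (SubspaceSampling.uSphere_toReal_le_one hA) hσ
  refine (SubspaceSampling.measure_grass_le hA rfl ?_ hN hL ?_ (Nat.sub_le n m) ν
    (fun U => hinv U U.2 (SubspaceSampling.rotate U) ?_ fun Q => rfl) hF).trans h3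
  · exact (mul_pos (Real.exp_pos _) (Real.exp_pos _)).trans_le hσ
  · have h1 : ((n : ℝ) ^ ((1 : ℝ) / 3)) ^ 3 = n := by
      rw [← Real.rpow_natCast, ← Real.rpow_mul (Nat.cast_nonneg n)]
      norm_num
    rw [h1]
    have h2 : n ≤ 10 * (n - m) := by omega
    exact_mod_cast h2
  · exact SubspaceSampling.measurable_rotate.of_uncurry_left
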